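/- arXiv:2504.19899 — 2 statements merged into one kernel-verified Lean document; each statement's English description precedes it below -/
import Mathlib

section
/- Let r, s ∈ ℕ, let p_1,…,p_r be integral polynomials with zero constant term, and set P = (p_1,…,p_r). Assume that WP_i(P) = WP_s(P) for all i ≥ s (which holds precisely when s is at least the Weyl complexity W(P)). Call a Weyl system s-step if its unipotent integer matrix A satisfies (A − I)^s = 0. If R ⊆ ℕ is such that for every s-step Weyl system (X,μ,T) and every Borel A ⊆ X with μ(A) > 0 there exists n ∈ R with μ(A ∩ T^{−p_1(n)}A ∩ ⋯ ∩ T^{−p_r(n)}A) > 0, then the same conclusion holds for every (s+1)-step Weyl system. -/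
open MeasureTheory Polynomial Filter

noncomputable section

/-- An integral polynomial: a real polynomial taking integer values on the integers. -/
def IsIntegralPoly (p : Polynomial ℝ) : Prop := ∀ n : ℤ, ∃ m : ℤ, p.eval (n : ℝ) = (m : ℝ)

/-- The integer value of an (integral) polynomial at an integer. -/
def ieval (p : Polynomial ℝ) (n : ℤ) : ℤ := ⌊p.eval (n : ℝ)⌋

/-- A family of polynomials is essentially distinct if each member and each
difference of two distinct members is non-constant. -/
def EssentiallyDistinct {r : ℕ} (P : Fin r → Polynomial ℝ) : Prop :=
  (∀ i, 0 < (P i).natDegree) ∧ ∀ i j, i ≠ j → 0 < (P i - P j).natDegree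

/-- `p^[j]`: the polynomial `x ↦ p(x)(p(x)-1)⋯(p(x)-j+1)/j!`. -/
def pbr (p : Polynomial ℝ) (j : ℕ) : Polynomial ℝ :=
  Polynomial.C (1 / (Nat.factorial j : ℝ)) * ∏ i ∈ Finset.range j, (p - Polynomial.C (i : ℝ))

/-- The matrix `Λ_k(P)(x)`.  Rows are indexed by pairs `(i, m) ∈ Fin k × Fin r`
(zero-based), the pair `(i, m)` corresponding to row `i·r + m + 1` in the one-based
numbering: the entry in row `(i, m)` and column `c` is `p_m^{[i−c+1]}(x)` if `c ≤ i`
and `0` otherwise. -/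
def Lam {r : ℕ} (P : Fin r → Polynomial ℝ) (k : ℕ) (x : ℝ) :
    Matrix (Fin k × Fin r) (Fin k) ℝ := fun ρ c =>
  if (c : ℕ) ≤ (ρ.1 : ℕ) then (pbr (P ρ.2) ((ρ.1 : ℕ) - (c : ℕ) + 1)).eval x else 0

/-- The `k`-Weyl polynomials generated by the family `P` (with `WP P 0 = {0}`
by convention).  `WP P 1` is the real span of the members of `P`; for `k ≥ 2`,
`WP P k` is the set of real polynomials of the form `x ↦ (vᵀ Λ_k(P)(x))₁` where
`v ∈ ℝ^{kr}` is such that its vector `w` of last `(k−1)r` coordinates satisfies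
`wᵀ Λ_{k−1}(P)(x) = 0` for all `x`. -/
def WP {r : ℕ} (P : Fin r → Polynomial ℝ) : ℕ → Set (Polynomial ℝ)
  | 0 => {0}
  | 1 => (Submodule.span ℝ (Set.range P) : Submodule ℝ (Polynomial ℝ))
  | (k + 2) => { q | ∃ v : Fin (k + 2) × Fin r → ℝ,
      (∀ x : ℝ, Matrix.vecMul (fun w : Fin (k + 1) × Fin r => v (w.1.succ, w.2))
          (Lam P (k + 1) x) = 0) ∧
      ∀ x : ℝ, q.eval x = Matrix.vecMul v (Lam P (k + 2) x) 0 }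

end

noncomputable section

abbrev Torus := AddCircle (1 : ℝ)

/-- The Haar probability measure on `𝕋^N × F` (`F` a finite group):
the product of the Haar measure on `𝕋^N` and the uniform measure on `F`. -/
def weylMeasure (N : ℕ) (F : Type) [Fintype F] [MeasurableSpace F] :
    Measure ((Fin N → Torus) × F) :=
  (volume : Measure (Fin N → Torus)).prod
    ((Fintype.card F : ENNReal)⁻¹ • Measure.count)

/-- The transformation `x ↦ a + U x` of a Weyl system, as a bijection. -/
def weylT {N : ℕ} {F : Type} [AddCommGroup F]
    (a : (Fin N → Torus) × F)
    (U : ((Fin N → Torus) × F) ≃+ ((Fin N → Torus) × F)) :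
    Equiv.Perm ((Fin N → Torus) × F) :=
  U.toEquiv.trans (Equiv.addLeft a)

/-- `(X, μ, T)` with `X = 𝕋^N × F`, `μ` Haar, `T = a + U(·)`, is a Weyl system with
unipotent integer matrix `A`: `U` is a continuous automorphism restricting to `A` on
the identity component, `A` is unipotent, and `T` is ergodic for `μ`. -/
def IsWeylSystemWith {N : ℕ} {F : Type} [AddCommGroup F] [Fintype F]
    [TopologicalSpace F] [MeasurableSpace F]
    (a : (Fin N → Torus) × F)
    (U : ((Fin N → Torus) × F) ≃+ ((Fin N → Torus) × F))
    (A : Matrix (Fin N) (Fin N) ℤ) : Prop :=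
  (A - 1) ^ N = 0 ∧
  Continuous ⇑U ∧
  (∀ x : Fin N → Torus, U (x, (0 : F)) = (fun j => ∑ i, A j i • x i, (0 : F))) ∧
  Ergodic (⇑(weylT a U)) (weylMeasure N F)


end

noncomputable section

open Topology UnitAddTorus

variable {ι J : Type*} [Fintype ι] [Fintype J]

/-! ### Characters of the torus -/

theorem volume_torus_eq_haar : (volume : Measure Torus) = AddCircle.haarAddCircle := by
  simp [AddCircle.volume_eq_smul_haarAddCircle]

instance isProbabilityMeasure_torus : IsProbabilityMeasure (volume : Measure Torus) := by
  rw [volume_torus_eq_haar]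
  infer_instance

instance isProbabilityMeasure_torus_pi : IsProbabilityMeasure (volume : Measure (ι → Torus)) := by
  rw [volume_pi]
  infer_instance

/-- The pairing of an integer vector with a point of the torus. -/
def torusPair (k : ι → ℤ) : (ι → Torus) →+ Torus where
  toFun x := ∑ i, k i • x i
  map_zero' := by simp
  map_add' x y := by simp [smul_add, Finset.sum_add_distrib]

theorem torusPair_apply (k : ι → ℤ) (x : ι → Torus) : torusPair k x = ∑ i, k i • x i := rfl

theorem mFourier_eq_toCircle (k : ι → ℤ) (x : ι → Torus) :
    mFourier k x = (AddCircle.toCircle (torusPair k x) : ℂ) := by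
  have h : ∀ s : Finset ι, ∏ i ∈ s, (AddCircle.toCircle (k i • x i) : ℂ)
      = (AddCircle.toCircle (∑ i ∈ s, k i • x i) : ℂ) := by
    classical
    intro s
    induction s using Finset.induction_on with
    | empty => simp
    | insert i s hi ih =>
      rw [Finset.prod_insert hi, Finset.sum_insert hi, AddCircle.toCircle_add, ih]
      simp
  exact h Finset.univ

theorem mFourier_apply_add (k : ι → ℤ) (x y : ι → Torus) :
    mFourier k (x + y) = mFourier k x * mFourier k y := by
  simp [mFourier_eq_toCircle, AddCircle.toCircle_add]

theorem volume_torus_pi_eq : (volume : Measure (ι → Torus)) =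
    Measure.pi (fun _ => (AddCircle.haarAddCircle : Measure Torus)) := by
  rw [volume_pi, volume_torus_eq_haar]

theorem integral_mFourier (k : ι → ℤ) :
    ∫ x : ι → Torus, mFourier k x = if k = 0 then 1 else 0 := by
  classical
  split_ifs with hk
  · subst hk
    simp [mFourier_zero]
  · have h0 := mFourierCoeff_toLp (d := ι) (mFourier 0) (-k)
    rw [volume_torus_pi_eq]
    have h1 := orthonormal_mFourier (d := ι) |>.2 (i := -k) (j := 0) (by simpa using hk)
    have h2 := mFourierBasis_repr (d := ι) (mFourierLp 2 0) (-k)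
    rw [HilbertBasis.repr_apply_apply, coe_mFourierBasis, h1] at h2
    have h3 : mFourierCoeff (⇑(mFourier (0 : ι → ℤ))) (-k) = 0 := by
      rw [← h0]; exact h2.symm
    rw [mFourierCoeff] at h3
    simp only [neg_neg, mFourier_zero, ContinuousMap.one_apply, smul_eq_mul, mul_one] at h3
    exact h3

/-! ### Integer matrices acting on the torus -/

variable [DecidableEq ι]

/-- The endomorphism of the torus given by an integer matrix. -/
def torusEnd : Matrix ι ι ℤ →+* AddMonoid.End (ι → Torus) where
  toFun B :=
    { toFun := fun x j => ∑ i, B j i • x i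
      map_zero' := by ext; simp
      map_add' := fun x y => by ext; simp [smul_add, Finset.sum_add_distrib] }
  map_one' := by
    refine AddMonoidHom.ext fun x => funext fun j => ?_
    change ∑ i, (1 : Matrix ι ι ℤ) j i • x i = x j
    simp [Matrix.one_apply, ite_smul]
  map_mul' B C := by
    refine AddMonoidHom.ext fun x => funext fun j => ?_
    change ∑ i, (B * C) j i • x i = ∑ i, B j i • ∑ l, C i l • x l
    simp only [Matrix.mul_apply, Finset.sum_smul, Finset.smul_sum, mul_smul]
    exact Finset.sum_comm
  map_zero' := by
    refine AddMonoidHom.ext fun x => funext fun j => ?_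
    change ∑ i, (0 : Matrix ι ι ℤ) j i • x i = 0
    simp
  map_add' B C := by
    refine AddMonoidHom.ext fun x => funext fun j => ?_
    change ∑ i, (B + C) j i • x i = ∑ i, B j i • x i + ∑ i, C j i • x i
    simp [add_smul, Finset.sum_add_distrib]

theorem torusEnd_apply (B : Matrix ι ι ℤ) (x : ι → Torus) (j : ι) :
    torusEnd B x j = ∑ i, B j i • x i := rfl

theorem torusEnd_mul_apply (B C : Matrix ι ι ℤ) (x : ι → Torus) :
    torusEnd (B * C) x = torusEnd B (torusEnd C x) := by
  rw [map_mul]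
  rfl

theorem torusEnd_one_apply (x : ι → Torus) : torusEnd 1 x = x := by
  rw [map_one]
  rfl

theorem torusEnd_add_apply (B C : Matrix ι ι ℤ) (x : ι → Torus) :
    torusEnd (B + C) x = torusEnd B x + torusEnd C x := by
  rw [map_add]
  rfl

theorem continuous_torusEnd (B : Matrix ι ι ℤ) : Continuous (torusEnd B) := by
  refine continuous_pi fun j => ?_
  simp only [torusEnd_apply]
  fun_prop

theorem torusPair_torusEnd (k : ι → ℤ) (B : Matrix ι ι ℤ) (x : ι → Torus) :
    torusPair k (torusEnd B x) = torusPair (Matrix.vecMul k B) x := by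
  simp only [torusPair_apply, torusEnd_apply, Matrix.vecMul, dotProduct, Finset.smul_sum,
    Finset.sum_smul, mul_smul]
  exact Finset.sum_comm

theorem measurePreserving_torusEnd_add {B : Matrix ι ι ℤ} (hB : IsUnit B) (b : ι → Torus) :
    MeasurePreserving (fun x : ι → Torus => torusEnd B x + b) := by
  have h : Function.Surjective (torusEnd B) := by
    obtain ⟨u, rfl⟩ := hB
    intro y
    refine ⟨torusEnd (↑u⁻¹ : Matrix ι ι ℤ) y, ?_⟩
    rw [← torusEnd_mul_apply, u.mul_inv, torusEnd_one_apply]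
  have h1 : MeasurePreserving (torusEnd B : (ι → Torus) → (ι → Torus)) :=
    AddMonoidHom.measurePreserving (f := (torusEnd B : (ι → Torus) →+ (ι → Torus)))
      (continuous_torusEnd B) h rfl
  exact (measurePreserving_add_right volume b).comp h1

end

noncomputable section

open Topology UnitAddTorus

variable {κ G : Type*} [Fintype κ] [MeasurableSpace G] {μ : Measure G} [IsProbabilityMeasure μ]

/-! ### Returns near the origin from positive definiteness -/

/-- The real trigonometric polynomial `∑ cos (2π zᵢ)`, shifted and scaled to be positive with
natural Fourier coefficients; it attains its maximum exactly at the origin. -/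
def peak (z : κ → Torus) : ℝ :=
  2 * (Fintype.card κ + 1) + ∑ i, 2 * (AddCircle.toCircle (z i) : ℂ).re

theorem continuous_peak : Continuous (peak (κ := κ)) := by
  have : Continuous (AddCircle.toCircle (T := 1)) := AddCircle.continuous_toCircle
  unfold peak
  fun_prop

theorem neg_one_le_re_toCircle (t : Torus) : -1 ≤ (AddCircle.toCircle t : ℂ).re := by
  have := Complex.abs_re_le_norm (AddCircle.toCircle t : ℂ)
  rw [Circle.norm_coe] at this
  exact (abs_le.mp this).1

theorem re_toCircle_le_one (t : Torus) : (AddCircle.toCircle t : ℂ).re ≤ 1 := by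
  have := Complex.abs_re_le_norm (AddCircle.toCircle t : ℂ)
  rw [Circle.norm_coe] at this
  exact (abs_le.mp this).2

theorem eq_zero_of_re_toCircle_eq_one {t : Torus} (h : (AddCircle.toCircle t : ℂ).re = 1) :
    t = 0 := by
  apply AddCircle.injective_toCircle one_ne_zero
  have h1 : Complex.normSq (AddCircle.toCircle t : ℂ) = 1 := Circle.normSq_coe _
  rw [Complex.normSq_apply, h] at h1
  have h2 : (AddCircle.toCircle t : ℂ).im = 0 := by
    have : (AddCircle.toCircle t : ℂ).im * (AddCircle.toCircle t : ℂ).im = 0 := by linarith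
    simpa using this
  rw [AddCircle.toCircle_zero]
  exact Circle.ext (Complex.ext (by rw [h]; simp) (by rw [h2]; simp))

theorem peak_pos (z : κ → Torus) : 0 < peak z := by
  have h : ∑ i : κ, (-2 : ℝ) ≤ ∑ i, 2 * (AddCircle.toCircle (z i) : ℂ).re :=
    Finset.sum_le_sum fun i _ => by linarith [neg_one_le_re_toCircle (z i)]
  simp only [Finset.sum_const, Finset.card_univ, nsmul_eq_mul] at h
  unfold peak
  linarith

theorem peak_le (z : κ → Torus) : peak z ≤ peak (0 : κ → Torus) := by
  have : ∑ i, 2 * (AddCircle.toCircle (z i) : ℂ).re ≤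
      ∑ i, 2 * (AddCircle.toCircle ((0 : κ → Torus) i) : ℂ).re :=
    Finset.sum_le_sum fun i _ => by simpa using re_toCircle_le_one (z i)
  unfold peak
  linarith

theorem peak_lt {z : κ → Torus} (hz : z ≠ 0) : peak z < peak (0 : κ → Torus) := by
  obtain ⟨i, hi⟩ := Function.ne_iff.mp hz
  unfold peak
  have : ∑ i, 2 * (AddCircle.toCircle (z i) : ℂ).re <
      ∑ i, 2 * (AddCircle.toCircle ((0 : κ → Torus) i) : ℂ).re := by
    refine Finset.sum_lt_sum (fun i _ => by simpa using re_toCircle_le_one (z i))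
      ⟨i, Finset.mem_univ _, ?_⟩
    have h1 := re_toCircle_le_one (z i)
    have h2 : (AddCircle.toCircle (z i) : ℂ).re ≠ 1 := fun h =>
      hi (by simpa using eq_zero_of_re_toCircle_eq_one h)
    have h3 := lt_of_le_of_ne h1 h2
    simpa using h3
  linarith

/-- The characters of the torus, as a multiplicative submonoid of the continuous functions. -/
def characterSubmonoid (κ : Type*) [Fintype κ] : Submonoid C(UnitAddTorus κ, ℂ) where
  carrier := Set.range mFourier
  one_mem' := ⟨0, mFourier_zero⟩
  mul_mem' := by
    rintro _ _ ⟨k, rfl⟩ ⟨l, rfl⟩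
    exact ⟨k + l, by ext; simp [mFourier_add]⟩

theorem exists_characterSubmonoid_coe_peak :
    ∃ F ∈ (characterSubmonoid κ).subsemiringClosure, ∀ z, F z = (peak z : ℂ) := by
  classical
  have hm : ∀ k : κ → ℤ, mFourier k ∈ (characterSubmonoid κ).subsemiringClosure := fun k => by
    rw [← SetLike.mem_coe, Submonoid.subsemiringClosure_coe]
    exact AddSubmonoid.subset_closure ⟨k, rfl⟩
  refine ⟨((2 * (Fintype.card κ + 1) : ℕ) : C(UnitAddTorus κ, ℂ)) +
    ∑ i : κ, (mFourier (Pi.single i 1) + mFourier (-Pi.single i 1)), ?_, ?_⟩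
  · exact add_mem (natCast_mem _ _) (sum_mem fun i _ => add_mem (hm _) (hm _))
  · intro z
    simp only [ContinuousMap.add_apply, ContinuousMap.sum_apply, ContinuousMap.natCast_apply,
      mFourier_neg, Complex.add_conj, mFourier_single, fourier_one, peak]
    push_cast
    rfl

theorem eventually_le_measureReal_preimage_nhds_zero {𝓕 : Filter ℕ} (z : ℕ → G → κ → Torus)
    (hz : ∀ n, Measurable (z n))
    (hk : ∀ k : κ → ℤ, ∃ l : ℂ, Tendsto (fun n => ∫ x, mFourier k (z n x) ∂μ) 𝓕 (𝓝 l) ∧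
      (∫ w : κ → Torus, mFourier k w).re ≤ l.re)
    {W : Set (κ → Torus)} (hWo : IsOpen W) (hW0 : (0 : κ → Torus) ∈ W) :
    ∃ c : ℝ, 0 < c ∧ ∀ᶠ n in 𝓕, c ≤ μ.real (z n ⁻¹' W) := by
  have hint : ∀ (F : C(κ → Torus, ℂ)) n, Integrable (fun x => F (z n x)) μ := fun F n =>
    Integrable.of_bound (F.continuous.measurable.comp (hz n)).aestronglyMeasurable ‖F‖
      (Eventually.of_forall fun x => F.norm_coe_le_norm _)
  have hint' : ∀ F : C(κ → Torus, ℂ), Integrable F := fun F =>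
    Integrable.of_bound F.continuous.measurable.aestronglyMeasurable ‖F‖
      (Eventually.of_forall fun x => F.norm_coe_le_norm _)
  have hpd : ∀ F ∈ (characterSubmonoid κ).subsemiringClosure, ∃ l : ℂ,
      Tendsto (fun n => ∫ x, F (z n x) ∂μ) 𝓕 (𝓝 l) ∧ (∫ w : κ → Torus, F w).re ≤ l.re := by
    intro F hF
    have hF' : F ∈ AddSubmonoid.closure (characterSubmonoid κ : Set C(UnitAddTorus κ, ℂ)) := by
      rw [← SetLike.mem_coe, ← Submonoid.subsemiringClosure_coe]
      exact hF
    clear hF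
    induction hF' using AddSubmonoid.closure_induction with
    | mem F hF =>
      obtain ⟨k, rfl⟩ := hF
      exact hk k
    | zero => exact ⟨0, by simpa using tendsto_const_nhds, by simp⟩
    | add F F' _ _ ih ih' =>
      obtain ⟨l, hl, hl'⟩ := ih
      obtain ⟨m, hm, hm'⟩ := ih'
      refine ⟨l + m, ?_, ?_⟩
      · refine (hl.add hm).congr fun n => ?_
        simp only [ContinuousMap.add_apply]
        rw [integral_add (hint F n) (hint F' n)]
      · simp only [ContinuousMap.add_apply]
        rw [integral_add (hint' F) (hint' F')]
        simp only [Complex.add_re]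
        linarith
  obtain ⟨F, hF, hFp⟩ := exists_characterSubmonoid_coe_peak (κ := κ)
  obtain ⟨θ, hθ0, hθ, hθW⟩ : ∃ θ : ℝ, 0 < θ ∧ θ < peak (0 : κ → Torus) ∧
      ∀ w ∉ W, peak w ≤ θ := by
    rcases Set.eq_empty_or_nonempty Wᶜ with he | hne
    · exact ⟨peak (0 : κ → Torus) / 2, half_pos (peak_pos _), half_lt_self (peak_pos _),
        fun w hw => absurd (Set.compl_empty_iff.mp he ▸ Set.mem_univ w) hw⟩
    · obtain ⟨w, hw, hmax⟩ := hWo.isClosed_compl.isCompact.exists_isMaxOn hne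
        continuous_peak.continuousOn
      exact ⟨peak w, peak_pos w, peak_lt fun h => hw (h ▸ hW0), fun w' hw' => hmax hw'⟩
  obtain ⟨θ', h1, h2⟩ := exists_between hθ
  have hθ'0 : 0 < θ' := hθ0.trans h1
  set V : Set (κ → Torus) := {w | θ' < peak w} with hV
  have hVo : IsOpen V := isOpen_lt continuous_const continuous_peak
  have hVpos : 0 < (volume : Measure (κ → Torus)).real V :=
    ENNReal.toReal_pos (hVo.measure_pos volume ⟨0, h2⟩).ne' (measure_ne_top _ _)
  set δ := (volume : Measure (κ → Torus)).real V
  obtain ⟨L, hL⟩ := exists_pow_lt_of_lt_one (div_pos hVpos (by norm_num : (0 : ℝ) < 4))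
    ((div_lt_one hθ'0).mpr h1)
  have hL' : θ ^ L ≤ δ / 4 * θ' ^ L := by
    rw [div_pow, div_lt_iff₀ (pow_pos hθ'0 L)] at hL
    exact hL.le
  obtain ⟨l, hl, hl'⟩ := hpd (F ^ L) (pow_mem hF L)
  have hFL : ∀ w, (F ^ L) w = ((peak w ^ L : ℝ) : ℂ) := fun w => by
    rw [ContinuousMap.pow_apply, hFp]
    push_cast
    rfl
  simp only [hFL, integral_complex_ofReal, Complex.ofReal_re] at hl hl'
  have hlre : Tendsto (fun n => ∫ x, peak (z n x) ^ L ∂μ) 𝓕 (𝓝 l.re) :=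
    ((Complex.continuous_re.tendsto l).comp hl).congr fun n => Complex.ofReal_re _
  have hlow : δ * θ' ^ L ≤ l.re := by
    refine le_trans ?_ hl'
    have hi : Integrable (fun w : κ → Torus => peak w ^ L) := by
      refine Integrable.of_bound (continuous_peak.pow L).measurable.aestronglyMeasurable
        (peak (0 : κ → Torus) ^ L) (Eventually.of_forall fun x => ?_)
      rw [Real.norm_of_nonneg (pow_nonneg (peak_pos x).le L)]
      exact pow_le_pow_left₀ (peak_pos x).le (peak_le x) L
    calc δ * θ' ^ L = ∫ w in V, θ' ^ L := by simp [δ]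
      _ ≤ ∫ w in V, peak w ^ L := by
        refine setIntegral_mono_on (integrable_const _).integrableOn hi.integrableOn
          hVo.measurableSet fun w hw => pow_le_pow_left₀ hθ'0.le (le_of_lt hw) L
      _ ≤ ∫ w, peak w ^ L :=
        setIntegral_le_integral hi (Eventually.of_forall fun w => pow_nonneg (peak_pos w).le L)
  have hpow : 0 < δ * θ' ^ L := mul_pos hVpos (pow_pos hθ'0 L)
  set m := peak (0 : κ → Torus) ^ L
  have hm : 0 < m := pow_pos (peak_pos _) L
  refine ⟨δ * θ' ^ L / 4 / m, by positivity, ?_⟩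
  filter_upwards [hlre.eventually (lt_mem_nhds (show δ * θ' ^ L / 2 < l.re by linarith))] with n hn
  have hmeas : MeasurableSet (z n ⁻¹' W) := hz n hWo.measurableSet
  have hup : ∫ x, peak (z n x) ^ L ∂μ ≤ m * μ.real (z n ⁻¹' W) + θ ^ L := by
    calc ∫ x, peak (z n x) ^ L ∂μ
        ≤ ∫ x, ((z n ⁻¹' W).indicator (fun _ => m) x + θ ^ L) ∂μ := by
          refine integral_mono_of_nonneg
            (Eventually.of_forall fun x => pow_nonneg (peak_pos _).le L)
            (((integrable_const m).indicator hmeas).add (integrable_const _))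
            (Eventually.of_forall fun x => ?_)
          by_cases hx : z n x ∈ W
          · have : x ∈ z n ⁻¹' W := hx
            simp only [Set.indicator_of_mem this]
            have := pow_le_pow_left₀ (peak_pos (z n x)).le (peak_le (z n x)) L
            have := pow_pos hθ0 L
            simp only [m]
            linarith
          · have hx' : x ∉ z n ⁻¹' W := hx
            simp only [Set.indicator_of_notMem hx', zero_add]
            exact pow_le_pow_left₀ (peak_pos (z n x)).le (hθW _ hx) L
      _ = m * μ.real (z n ⁻¹' W) + θ ^ L := by
          rw [integral_add ((integrable_const m).indicator hmeas) (integrable_const _),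
            integral_indicator_const _ hmeas]
          simp [mul_comm]
  rw [div_le_iff₀ hm]
  linarith

end

noncomputable section

open Topology UnitAddTorus

variable {ι J : Type*} [Fintype ι]

/-! ### Averaging over simultaneous translations -/

/-- The mean of `F` over the translates of `z` by the diagonal copy of `ι → Torus`. -/
def diagMean (F : C(J × ι → Torus, ℂ)) (z : J × ι → Torus) : ℂ :=
  ∫ y : ι → Torus, F ((fun q => y q.2) + z)

theorem diagMean_smul (c : ℂ) (F : C(J × ι → Torus, ℂ)) (z : J × ι → Torus) :
    diagMean (c • F) z = c * diagMean F z :=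
  integral_const_mul _ _

theorem norm_diagMean_le (F : C(J × ι → Torus, ℂ)) (z : J × ι → Torus) :
    ‖diagMean F z‖ ≤ ‖F‖ := by
  refine (norm_integral_le_of_norm_le_const (C := ‖F‖)
    (Eventually.of_forall fun y => F.norm_coe_le_norm _)).trans_eq ?_
  simp

variable [Fintype J]

theorem continuous_diagMean (F : C(J × ι → Torus, ℂ)) : Continuous (diagMean F) := by
  have h := continuous_parametric_integral_of_continuous
    (μ := (volume : Measure (ι → Torus)))
    (f := fun (z : J × ι → Torus) (y : ι → Torus) => F ((fun q => y q.2) + z))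
    (by unfold Function.uncurry; fun_prop) isCompact_univ
  simp only [Measure.restrict_univ] at h
  exact h

theorem integrable_comp_of_continuous {κ G : Type*} [Fintype κ] [MeasurableSpace G]
    {μ : Measure G} [IsFiniteMeasure μ] (F : C(κ → Torus, ℂ)) {z : G → κ → Torus}
    (hz : Measurable z) : Integrable (fun x => F (z x)) μ :=
  Integrable.of_bound (F.continuous.measurable.comp hz).aestronglyMeasurable ‖F‖
    (Eventually.of_forall fun _ => F.norm_coe_le_norm _)

theorem diagMean_add (F F' : C(J × ι → Torus, ℂ)) (z : J × ι → Torus) :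
    diagMean (F + F') z = diagMean F z + diagMean F' z :=
  integral_add
    (integrable_comp_of_continuous F (Continuous.measurable (by fun_prop)))
    (integrable_comp_of_continuous F' (Continuous.measurable (by fun_prop)))

open Classical in
theorem diagMean_mFourier (k : J × ι → ℤ) (z : J × ι → Torus) :
    diagMean (mFourier k) z =
      (if ∀ i, ∑ m, k (m, i) = 0 then 1 else 0) * mFourier k z := by
  have h : ∀ y : ι → Torus, mFourier k (fun q : J × ι => y q.2) =
      mFourier (fun i => ∑ m, k (m, i)) y := by
    intro y
    rw [mFourier_eq_toCircle, mFourier_eq_toCircle, torusPair_apply, torusPair_apply,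
      Fintype.sum_prod_type_right]
    simp only [Finset.sum_smul]
  unfold diagMean
  simp_rw [mFourier_apply_add, h]
  rw [integral_mul_const, integral_mFourier]
  simp only [funext_iff, Pi.zero_apply]

section

variable {G : Type*} [MeasurableSpace G] {μ : Measure G} [IsProbabilityMeasure μ]

theorem tendsto_integral_sub_diagMean {𝓕 : Filter ℕ} (z : ℕ → G → J × ι → Torus)
    (hz : ∀ n, Measurable (z n))
    (hk : ∀ k : J × ι → ℤ, (∀ i, ∑ m, k (m, i) = 0) ∨
      ∀ᶠ n in 𝓕, ∫ x, mFourier k (z n x) ∂μ = 0) (F : C(J × ι → Torus, ℂ)) :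
    Tendsto (fun n => ∫ x, (F (z n x) - diagMean F (z n x)) ∂μ) 𝓕 (𝓝 0) := by
  classical
  have hi : ∀ (F : C(J × ι → Torus, ℂ)) n,
      Integrable (fun x => F (z n x) - diagMean F (z n x)) μ := fun F n =>
    (integrable_comp_of_continuous F (hz n)).sub
      (integrable_comp_of_continuous ⟨_, continuous_diagMean F⟩ (hz n))
  have hspan : ∀ F ∈ Submodule.span ℂ (Set.range (mFourier (d := J × ι))),
      Tendsto (fun n => ∫ x, (F (z n x) - diagMean F (z n x)) ∂μ) 𝓕 (𝓝 0) := by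
    intro F hF
    induction hF using Submodule.span_induction with
    | mem F hF =>
      obtain ⟨k, rfl⟩ := hF
      simp_rw [diagMean_mFourier]
      split_ifs with h
      · simpa using tendsto_const_nhds
      · rcases hk k with h' | h'
        · exact absurd h' h
        · refine tendsto_const_nhds.congr' ?_
          filter_upwards [h'] with n hn
          simp [hn]
    | zero => simpa [diagMean] using tendsto_const_nhds
    | add F F' _ _ ih ih' =>
      have := ih.add ih'
      rw [add_zero] at this
      refine this.congr fun n => ?_
      rw [← integral_add (hi F n) (hi F' n)]
      refine integral_congr_ae (Eventually.of_forall fun x => ?_)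
      simp only [diagMean_add, ContinuousMap.add_apply]
      ring
    | smul c F _ ih =>
      have := ih.const_mul c
      rw [mul_zero] at this
      refine this.congr fun n => ?_
      rw [← integral_const_mul]
      refine integral_congr_ae (Eventually.of_forall fun x => ?_)
      simp only [diagMean_smul, ContinuousMap.smul_apply, smul_eq_mul]
      ring
  rw [Metric.tendsto_nhds]
  intro ε hε
  have hmem : F ∈ (Submodule.span ℂ (Set.range (mFourier (d := J × ι)))).topologicalClosure := by
    rw [span_mFourier_closure_eq_top]
    trivial
  rw [← SetLike.mem_coe, Submodule.topologicalClosure_coe] at hmem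
  obtain ⟨F', hF', hd⟩ := Metric.mem_closure_iff.mp hmem (ε / 4) (by positivity)
  filter_upwards [Metric.tendsto_nhds.mp (hspan F' hF') (ε / 2) (by positivity)] with n hn
  rw [dist_zero_right] at hn ⊢
  have e : ∫ x, (F (z n x) - diagMean F (z n x)) ∂μ =
      ∫ x, (F' (z n x) - diagMean F' (z n x)) ∂μ +
        ∫ x, ((F - F') (z n x) - diagMean (F - F') (z n x)) ∂μ := by
    rw [← integral_add (hi F' n) (hi _ n)]
    refine integral_congr_ae (Eventually.of_forall fun x => ?_)
    have : diagMean F (z n x) = diagMean F' (z n x) + diagMean (F - F') (z n x) := by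
      rw [← diagMean_add]
      congr 1
      abel
    simp only [this, ContinuousMap.sub_apply]
    ring
  have hb : ‖∫ x, ((F - F') (z n x) - diagMean (F - F') (z n x)) ∂μ‖ ≤ 2 * (ε / 4) := by
    refine (norm_integral_le_of_norm_le_const (C := 2 * (ε / 4))
      (Eventually.of_forall fun x => ?_)).trans_eq (by simp)
    have h1 := (F - F').norm_coe_le_norm (z n x)
    have h2 := norm_diagMean_le (F - F') (z n x)
    have h3 := norm_sub_le ((F - F') (z n x)) (diagMean (F - F') (z n x))
    rw [dist_eq_norm] at hd
    linarith
  rw [e]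
  refine (norm_add_le _ _).trans_lt ?_
  linarith

end

theorem exists_isOpen_translates_measureReal_ge {K : Set (ι → Torus)} (hK : MeasurableSet K)
    (hpos : 0 < (volume : Measure (ι → Torus)).real K) :
    ∃ W : Set (J × ι → Torus), IsOpen W ∧ 0 ∈ W ∧ ∀ z ∈ W,
      (volume : Measure (ι → Torus)).real K / 2 ≤
        (volume : Measure (ι → Torus)).real {y | ∀ m, (fun i => y i + z (m, i)) ∈ K} := by
  set v := (volume : Measure (ι → Torus)).real K
  set η : ℝ := v / 2 / (Fintype.card J + 1)
  have hη : 0 < η := by positivity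
  have hcont : Continuous fun w : ι → Torus => (⟨fun y => y + w, by fun_prop⟩ :
      C(ι → Torus, ι → Torus)) :=
    ContinuousMap.continuous_of_continuous_uncurry _ 
      (continuous_snd.add continuous_fst)
  have hmp : ∀ w : ι → Torus, MeasurePreserving (fun y : ι → Torus => y + w) volume volume :=
    fun w => measurePreserving_add_right volume w
  have ht := tendsto_measure_symmDiff_preimage_nhds_zero (hcont.tendsto 0)
    (Eventually.of_forall hmp) (hmp 0) hK.nullMeasurableSet (measure_ne_top volume K)
  have hev := ht.eventually (gt_mem_nhds (ENNReal.ofReal_pos.mpr hη))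
  have hall : ∀ᶠ z : J × ι → Torus in 𝓝 0, ∀ m,
      (volume : Measure (ι → Torus)).real
        (K \ {y | (fun i => y i + z (m, i)) ∈ K}) ≤ η := by
    rw [eventually_all]
    intro m
    have hc : Tendsto (fun (z : J × ι → Torus) i => z (m, i)) (𝓝 0) (𝓝 0) :=
      Continuous.tendsto (f := fun (z : J × ι → Torus) i => z (m, i)) (by fun_prop) 0
    filter_upwards [hc.eventually hev] with z hz
    refine ENNReal.toReal_le_of_le_ofReal hη.le (le_trans (measure_mono ?_) hz.le)
    intro y hy
    refine Or.inr ⟨?_, hy.2⟩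
    simpa using hy.1
  obtain ⟨W, hW, hWo, hW0⟩ := eventually_nhds_iff.mp hall
  refine ⟨W, hWo, hW0, fun z hz => ?_⟩
  have hsub : K ⊆ {y | ∀ m, (fun i => y i + z (m, i)) ∈ K} ∪
      ⋃ m, (K \ {y | (fun i => y i + z (m, i)) ∈ K}) := by
    intro y hy
    by_cases h : ∀ m, (fun i => y i + z (m, i)) ∈ K
    · exact Or.inl h
    · push Not at h
      obtain ⟨m, hm⟩ := h
      exact Or.inr (Set.mem_iUnion.mpr ⟨m, hy, hm⟩)
  have h1 : v ≤ _ := measureReal_mono (μ := (volume : Measure (ι → Torus))) hsub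
  have h2 := h1.trans (measureReal_union_le _ _)
  have h3 : (volume : Measure (ι → Torus)).real
      (⋃ m, (K \ {y | (fun i => y i + z (m, i)) ∈ K})) ≤ v / 2 := by
    refine (measureReal_iUnion_fintype_le _).trans
      ((Finset.sum_le_sum fun m _ => hW z hz m).trans ?_)
    rw [Finset.sum_const, Finset.card_univ, nsmul_eq_mul]
    have : (Fintype.card J : ℝ) * η ≤ (Fintype.card J + 1) * η := by gcongr; linarith
    refine this.trans_eq ?_
    simp only [η]
    field_simp
  linarith

/-- Equidistribution up to diagonal translation yields multiple recurrence. -/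
theorem eventually_volume_iInter_preimage_pos {𝓕 : Filter ℕ} [NeBot 𝓕]
    (Θ : ℕ → J → (ι → Torus) → ι → Torus)
    (hΘ : ∀ n m, MeasurePreserving (Θ n m) volume volume)
    (hk : ∀ k : J × ι → ℤ,
      ((∀ i, ∑ m, k (m, i) = 0) ∧
        Tendsto (fun n => ∫ x, mFourier k (fun q => Θ n q.1 x q.2)) 𝓕 (𝓝 1)) ∨
      ∀ᶠ n in 𝓕, ∫ x, mFourier k (fun q => Θ n q.1 x q.2) = 0)
    {S : Set (ι → Torus)} (hS : MeasurableSet S) (hpos : 0 < volume S) :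
    ∀ᶠ n in 𝓕, 0 < volume (⋂ m, Θ n m ⁻¹' S) := by
  classical
  obtain ⟨K, hKS, hKc, hK0⟩ := hS.exists_lt_isCompact hpos
  have hKm := hKc.isClosed.measurableSet
  set z : ℕ → (ι → Torus) → J × ι → Torus := fun n x q => Θ n q.1 x q.2 with hz
  have hzm : ∀ n, Measurable (z n) := fun n =>
    measurable_pi_lambda _ fun q => (measurable_pi_apply q.2).comp (hΘ n q.1).measurable
  have hv : 0 < (volume : Measure (ι → Torus)).real K :=
    ENNReal.toReal_pos hK0.ne' (measure_ne_top _ _)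
  obtain ⟨W, hWo, hW0, hW⟩ := exists_isOpen_translates_measureReal_ge (J := J) hKm hv
  obtain ⟨c, hc, hcev⟩ := eventually_le_measureReal_preimage_nhds_zero
    (μ := (volume : Measure (ι → Torus))) z hzm (𝓕 := 𝓕) (fun k => by
      rw [integral_mFourier]
      rcases hk k with ⟨-, h⟩ | h
      · exact ⟨1, h, by split_ifs <;> simp⟩
      · refine ⟨0, tendsto_const_nhds.congr' (h.mono fun n hn => hn.symm), ?_⟩
        rw [if_neg]
        · rintro rfl
          obtain ⟨n, hn⟩ := h.exists
          simp [mFourier_zero] at hn) hWo hW0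
  set v := (volume : Measure (ι → Torus)).real K
  set c₁ := c * (v / 2) with hc₁
  have hc₁0 : 0 < c₁ := by positivity
  set η : ℝ := c₁ / 4 / (Fintype.card J + 1) with hη
  have hη0 : 0 < η := by positivity
  obtain ⟨U, hKU, hUo, -, hUK⟩ := hKm.exists_isOpen_sdiff_lt (measure_ne_top volume K)
    (ENNReal.ofReal_pos.mpr hη0).ne'
  have hUK' : (volume : Measure (ι → Torus)).real (U \ K) ≤ η :=
    ENNReal.toReal_le_of_le_ofReal hη0.le hUK.le
  obtain ⟨f, hf0, hf1, hf⟩ := exists_continuous_zero_one_of_isClosed hUo.isClosed_compl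
    hKc.isClosed (Set.disjoint_left.mpr fun x hx hx' => hx (hKU hx'))
  set Φ : C(J × ι → Torus, ℝ) := ⟨fun w => ∏ m, f (fun i => w (m, i)), by fun_prop⟩
  set F : C(J × ι → Torus, ℂ) := ⟨fun w => (Φ w : ℂ), by fun_prop⟩
  have hΦ0 : ∀ w, 0 ≤ Φ w := fun w => Finset.prod_nonneg fun m _ => (hf _).1
  have hΦ1 : ∀ w, Φ w ≤ 1 := fun w =>
    Finset.prod_le_one (fun m _ => (hf _).1) fun m _ => (hf _).2
  have hint : ∀ (g : (ι → Torus) → J × ι → Torus), Measurable g →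
      Integrable (fun x => Φ (g x)) := fun g hg =>
    Integrable.of_bound (Φ.continuous.measurable.comp hg).aestronglyMeasurable 1
      (Eventually.of_forall fun x => by rw [Real.norm_of_nonneg (hΦ0 _)]; exact hΦ1 _)
  have hF : ∀ w, diagMean F w = ((∫ y : ι → Torus, Φ ((fun q => y q.2) + w) : ℝ) : ℂ) :=
    fun w => integral_complex_ofReal
  have hHc : Continuous fun w => ∫ y : ι → Torus, Φ ((fun q : J × ι => y q.2) + w) := by
    refine (Complex.continuous_re.comp (continuous_diagMean F)).congr fun w => ?_
    rw [Function.comp_apply, hF, Complex.ofReal_re]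
  set H : (J × ι → Torus) → ℝ := fun w => ∫ y : ι → Torus, Φ ((fun q : J × ι => y q.2) + w)
    with hH
  have hH0 : ∀ w, 0 ≤ H w := fun w => integral_nonneg fun y => hΦ0 _
  have hH1 : ∀ w, H w ≤ 1 := fun w => by
    have := norm_integral_le_of_norm_le_const (μ := (volume : Measure (ι → Torus)))
      (f := fun y : ι → Torus => Φ ((fun q : J × ι => y q.2) + w)) (C := 1)
      (Eventually.of_forall fun x => by rw [Real.norm_of_nonneg (hΦ0 _)]; exact hΦ1 _)
    simpa using (le_abs_self _).trans this
  have hHi : ∀ n, Integrable (fun x => H (z n x)) := fun n =>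
    Integrable.of_bound (hHc.measurable.comp (hzm n)).aestronglyMeasurable 1
      (Eventually.of_forall fun x => by rw [Real.norm_of_nonneg (hH0 _)]; exact hH1 _)
  have hHW : ∀ w ∈ W, v / 2 ≤ H w := by
    intro w hw
    have hmeas : MeasurableSet {y : ι → Torus | ∀ m, (fun i => y i + w (m, i)) ∈ K} := by
      rw [Set.ofPred_forall]
      refine MeasurableSet.iInter fun m => ?_
      exact (Continuous.measurable (by fun_prop :
        Continuous fun (y : ι → Torus) i => y i + w (m, i))) hKm
    refine (hW w hw).trans ?_
    rw [← mul_one (Measure.real _ _), ← smul_eq_mul, ← integral_indicator_const (1 : ℝ) hmeas]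
    refine integral_mono ((integrable_const _).indicator hmeas)
      (hint _ (Continuous.measurable (by fun_prop))) fun y => ?_
    by_cases hy : ∀ m, (fun i => y i + w (m, i)) ∈ K
    · have hy' : y ∈ {y : ι → Torus | ∀ m, (fun i => y i + w (m, i)) ∈ K} := hy
      rw [Set.indicator_of_mem hy']
      exact (Finset.prod_eq_one fun m _ => hf1 (hy m)).ge
    · have hy' : y ∉ {y : ι → Torus | ∀ m, (fun i => y i + w (m, i)) ∈ K} := hy
      rw [Set.indicator_of_notMem hy']
      exact hΦ0 _
  have hlim := tendsto_integral_sub_diagMean (μ := (volume : Measure (ι → Torus))) z hzm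
    (fun k => (hk k).imp (fun h => h.1) id) F
  filter_upwards [hcev, Metric.tendsto_nhds.mp hlim (c₁ / 4) (by positivity)] with n hn hn'
  have hdiff : |∫ x, (Φ (z n x) - H (z n x))| < c₁ / 4 := by
    have e : ∫ x, (F (z n x) - diagMean F (z n x)) =
        ((∫ x, (Φ (z n x) - H (z n x)) : ℝ) : ℂ) := by
      rw [← integral_complex_ofReal]
      refine integral_congr_ae (Eventually.of_forall fun x => ?_)
      simp only [hF, Complex.ofReal_sub, hH]
      rfl
    rwa [e, dist_zero_right, Complex.norm_real, Real.norm_eq_abs] at hn'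
  rw [integral_sub (hint _ (hzm n)) (hHi n)] at hdiff
  have hlow : c₁ ≤ ∫ x, H (z n x) := by
    have hmeas : MeasurableSet (z n ⁻¹' W) := hzm n hWo.measurableSet
    calc c₁ ≤ (volume : Measure (ι → Torus)).real (z n ⁻¹' W) * (v / 2) := by
          rw [hc₁]; gcongr
      _ = ∫ x, (z n ⁻¹' W).indicator (fun _ => v / 2) x := by
          rw [integral_indicator_const _ hmeas, smul_eq_mul]
      _ ≤ ∫ x, H (z n x) := by
          refine integral_mono ((integrable_const _).indicator hmeas) (hHi n) fun x => ?_
          by_cases hx : z n x ∈ W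
          · rw [Set.indicator_of_mem (show x ∈ z n ⁻¹' W from hx)]
            exact hHW _ hx
          · rw [Set.indicator_of_notMem (show x ∉ z n ⁻¹' W from hx)]
            exact hH0 _
  have hup : ∫ x, Φ (z n x) ≤
      (volume : Measure (ι → Torus)).real (⋂ m, Θ n m ⁻¹' K) + c₁ / 4 := by
    set E : Set (ι → Torus) := (⋂ m, Θ n m ⁻¹' K) ∪ ⋃ m, Θ n m ⁻¹' (U \ K) with hE
    have hUKm : MeasurableSet (U \ K) := hUo.measurableSet.diff hKm
    have hEm : MeasurableSet E :=
      (MeasurableSet.iInter fun m => (hΘ n m).measurable hKm).union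
        (MeasurableSet.iUnion fun m => (hΘ n m).measurable hUKm)
    have h1 : ∫ x, Φ (z n x) ≤ (volume : Measure (ι → Torus)).real E := by
      rw [← mul_one (Measure.real _ _), ← smul_eq_mul, ← integral_indicator_const (1 : ℝ) hEm]
      refine integral_mono (hint _ (hzm n)) ((integrable_const _).indicator hEm) fun x => ?_
      by_cases hx : x ∈ E
      · rw [Set.indicator_of_mem hx]
        exact hΦ1 _
      · rw [Set.indicator_of_notMem hx]
        simp only [hE, Set.mem_union, not_or, Set.mem_iInter, Set.mem_iUnion, not_forall,
          not_exists] at hx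
        obtain ⟨⟨m, hm⟩, hx⟩ := hx
        have : Θ n m x ∉ U := fun h => hx m ⟨h, hm⟩
        exact (Finset.prod_eq_zero (Finset.mem_univ m) (hf0 this)).le
    refine h1.trans ((measureReal_union_le _ _).trans (add_le_add le_rfl ?_))
    refine (measureReal_iUnion_fintype_le _).trans ((Finset.sum_le_sum fun m _ =>
      (((hΘ n m).measureReal_preimage hUKm.nullMeasurableSet).trans_le hUK')).trans ?_)
    rw [Finset.sum_const, Finset.card_univ, nsmul_eq_mul]
    have : (Fintype.card J : ℝ) * η ≤ (Fintype.card J + 1) * η := by gcongr; linarith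
    refine this.trans_eq ?_
    simp only [hη]
    field_simp
  have hres : 0 < (volume : Measure (ι → Torus)).real (⋂ m, Θ n m ⁻¹' K) := by
    have := (abs_lt.mp hdiff).1
    linarith
  refine (ENNReal.toReal_pos_iff.mp hres).1.trans_le (measure_mono ?_)
  exact Set.iInter_mono fun m => Set.preimage_mono hKS

end

noncomputable section

open Topology UnitAddTorus

variable {ι J : Type*} [Fintype ι] [DecidableEq ι] [Fintype J]

/-! ### Integer powers of unipotent affine maps of the torus -/

/-- The binomial series of `(1 + ν) ^ e` truncated at order `s`. -/
def binomPow (ν : Matrix ι ι ℤ) (s : ℕ) (e : ℤ) : Matrix ι ι ℤ :=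
  ∑ j ∈ Finset.range (s + 1), Ring.choose e j • ν ^ j

/-- The binomial series of `((1 + ν) ^ e - 1) / ν` truncated at order `s`. -/
def binomQuot (ν : Matrix ι ι ℤ) (s : ℕ) (e : ℤ) : Matrix ι ι ℤ :=
  ∑ j ∈ Finset.range (s + 1), Ring.choose e (j + 1) • ν ^ j

/-- The `e`-th power of `x ↦ (1 + ν) x + a` when `ν ^ (s + 1) = 0`. -/
def affPow (ν : Matrix ι ι ℤ) (s : ℕ) (a : ι → Torus) (e : ℤ) (x : ι → Torus) : ι → Torus :=
  torusEnd (binomPow ν s e) x + torusEnd (binomQuot ν s e) a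

theorem commute_binomQuot (ν : Matrix ι ι ℤ) (s : ℕ) (e : ℤ) : Commute ν (binomQuot ν s e) :=
  Commute.sum_right _ _ _ fun j _ =>
    Commute.smul_right (Commute.pow_right (Commute.refl ν) j) _

section

variable {ν : Matrix ι ι ℤ} {s : ℕ}

theorem binomPow_eq (hν : ν ^ (s + 1) = 0) (e : ℤ) :
    binomPow ν s e = 1 + ν * binomQuot ν s e := by
  rw [binomPow, binomQuot, Finset.sum_range_succ', Finset.sum_range_succ, mul_add,
    mul_smul_comm, ← pow_succ', hν, smul_zero, add_zero, Ring.choose_zero_right, pow_zero,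
    one_smul, add_comm, Finset.mul_sum]
  simp only [mul_smul_comm, pow_succ']

theorem binomQuot_add_one (hν : ν ^ (s + 1) = 0) (e : ℤ) :
    binomQuot ν s (e + 1) = 1 + (1 + ν) * binomQuot ν s e := by
  have : binomQuot ν s (e + 1) = binomPow ν s e + binomQuot ν s e := by
    simp only [binomPow, binomQuot, ← Finset.sum_add_distrib, ← add_smul, Ring.choose_succ_succ]
  rw [this, binomPow_eq hν, add_mul, one_mul]
  abel

theorem binomPow_add_one (hν : ν ^ (s + 1) = 0) (e : ℤ) :
    binomPow ν s (e + 1) = (1 + ν) * binomPow ν s e := by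
  rw [binomPow_eq hν, binomPow_eq hν, binomQuot_add_one hν]
  have := (commute_binomQuot ν s e).eq
  noncomm_ring

theorem binomPow_zero : binomPow ν s 0 = 1 := by
  rw [binomPow, Finset.sum_range_succ']
  simp

theorem binomQuot_zero : binomQuot ν s 0 = 0 := by
  simp [binomQuot]

theorem isUnit_binomPow (hν : ν ^ (s + 1) = 0) (e : ℤ) : IsUnit (binomPow ν s e) := by
  rw [binomPow_eq hν]
  exact ((commute_binomQuot ν s e).isNilpotent_mul_right ⟨_, hν⟩).isUnit_one_add

theorem measurePreserving_affPow (hν : ν ^ (s + 1) = 0) (a : ι → Torus) (e : ℤ) :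
    MeasurePreserving (affPow ν s a e) volume volume :=
  measurePreserving_torusEnd_add (isUnit_binomPow hν e) _

theorem affPow_zero (a x : ι → Torus) : affPow ν s a 0 x = x := by
  rw [affPow, binomPow_zero, binomQuot_zero, map_zero, torusEnd_one_apply]
  simp

theorem affPow_add_one (hν : ν ^ (s + 1) = 0) (a : ι → Torus) (e : ℤ) (x : ι → Torus) :
    affPow ν s a (e + 1) x = torusEnd (1 + ν) (affPow ν s a e x) + a := by
  rw [affPow, affPow, binomPow_add_one hν, binomQuot_add_one hν, torusEnd_mul_apply,
    torusEnd_add_apply 1 ((1 + ν) * _), torusEnd_mul_apply, torusEnd_one_apply,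
    map_add (torusEnd (1 + ν))]
  abel

theorem binomPow_natCast (hν : ν ^ (s + 1) = 0) (n : ℕ) : binomPow ν s n = (1 + ν) ^ n := by
  induction n with
  | zero => simp [binomPow_zero]
  | succ n ih => rw [Nat.cast_succ, binomPow_add_one hν, ih, pow_succ']

theorem affPow_natCast (hν : ν ^ (s + 1) = 0) (a : ι → Torus) (n : ℕ) (x : ι → Torus) :
    affPow ν s a n x = torusEnd ((1 + ν) ^ n) x + torusEnd (binomQuot ν s n) a := by
  rw [affPow, binomPow_natCast hν]

theorem affPow_add_natCast (hν : ν ^ (s + 1) = 0) (a : ι → Torus) (e : ℤ) (n : ℕ)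
    (x : ι → Torus) : affPow ν s a (e + n) x = affPow ν s a n (affPow ν s a e x) := by
  induction n with
  | zero => simp [affPow_zero]
  | succ n ih =>
    rw [Nat.cast_succ, ← add_assoc, affPow_add_one hν, affPow_add_one hν, ih]

theorem exists_mul_binomQuot_eq (hν : ν ^ (s + 1) = 0) (n : ℕ) :
    ∃ D K, binomQuot ν s n * D = ((n ^ K : ℕ) : Matrix ι ι ℤ) := by
  set E : Matrix ι ι ℤ := ∑ j ∈ Finset.range s, Ring.choose (n : ℤ) (j + 1 + 1) • ν ^ j
  have hE : Commute ν E := Commute.sum_right _ _ _ fun j _ =>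
    Commute.smul_right (Commute.pow_right (Commute.refl ν) j) _
  have h : binomQuot ν s n = (n : Matrix ι ι ℤ) - -(ν * E) := by
    rw [binomQuot, Finset.sum_range_succ', Finset.mul_sum, sub_neg_eq_add, add_comm]
    simp only [mul_smul_comm, pow_succ', zero_add, Ring.choose_one_right, pow_zero]
    simp
  have hc : Commute (n : Matrix ι ι ℤ) (-(ν * E)) := Nat.cast_commute _ _
  refine ⟨∑ i ∈ Finset.range (s + 1), (n : Matrix ι ι ℤ) ^ i * (-(ν * E)) ^ (s + 1 - 1 - i),
    s + 1, ?_⟩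
  rw [h, hc.mul_geom_sum₂ (s + 1), neg_pow, hE.mul_pow, hν]
  simp

theorem surjective_torusEnd_binomQuot (hν : ν ^ (s + 1) = 0) {n : ℕ} (hn : 0 < n) :
    Function.Surjective (torusEnd (binomQuot ν s n)) := by
  obtain ⟨D, K, hD⟩ := exists_mul_binomQuot_eq hν n
  intro y
  have hne : ((n ^ K : ℕ) : ℤ) ≠ 0 := by positivity
  refine ⟨torusEnd D (DivisibleBy.div y ((n ^ K : ℕ) : ℤ)), ?_⟩
  rw [← torusEnd_mul_apply, hD]
  have h := DivisibleBy.div_cancel y hne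
  rw [map_natCast, AddMonoid.End.natCast_apply, ← natCast_zsmul]
  exact h

end

open Classical in
theorem integral_mFourier_affPow (ν : Matrix ι ι ℤ) (s : ℕ) (a : ι → Torus) (k : J × ι → ℤ)
    (e : J → ℤ) :
    ∫ x, mFourier k (fun q => affPow ν s a (e q.1) x q.2) =
      (if ∑ m, Matrix.vecMul (fun i => k (m, i)) (binomPow ν s (e m)) = 0 then 1 else 0) *
        (AddCircle.toCircle
          (∑ m, torusPair (Matrix.vecMul (fun i => k (m, i)) (binomQuot ν s (e m))) a) : ℂ) := by
  have h : ∀ x, mFourier k (fun q => affPow ν s a (e q.1) x q.2) =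
      mFourier (∑ m, Matrix.vecMul (fun i => k (m, i)) (binomPow ν s (e m))) x *
        (AddCircle.toCircle
          (∑ m, torusPair (Matrix.vecMul (fun i => k (m, i)) (binomQuot ν s (e m))) a) : ℂ) := by
    intro x
    rw [mFourier_eq_toCircle, mFourier_eq_toCircle, ← Circle.coe_mul, ← AddCircle.toCircle_add]
    congr 2
    have h1 : ∀ m, ∑ i, k (m, i) • affPow ν s a (e m) x i =
        torusPair (Matrix.vecMul (fun i => k (m, i)) (binomPow ν s (e m))) x +
          torusPair (Matrix.vecMul (fun i => k (m, i)) (binomQuot ν s (e m))) a := by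
      intro m
      rw [← torusPair_torusEnd, ← torusPair_torusEnd, ← map_add]
      rfl
    rw [torusPair_apply, Fintype.sum_prod_type]
    simp only [h1, Finset.sum_add_distrib]
    congr 1
    simp only [torusPair_apply, Finset.sum_apply, Finset.sum_smul]
    exact Finset.sum_comm
  simp_rw [h]
  rw [integral_mul_const, integral_mFourier]

end

noncomputable section

/-! ### Powers of Weyl transformations on a fiber -/

theorem weylMeasure_apply {N : ℕ} {F : Type} [Fintype F] [MeasurableSpace F]
    [MeasurableSingletonClass F] {S : Set ((Fin N → Torus) × F)} (hS : MeasurableSet S) :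
    weylMeasure N F S = (Fintype.card F : ENNReal)⁻¹ * ∑ f, volume {x | (x, f) ∈ S} := by
  have : SFinite ((Fintype.card F : ENNReal)⁻¹ • (Measure.count : Measure F)) := inferInstance
  rw [weylMeasure, Measure.prod_apply_symm hS, lintegral_smul_measure, lintegral_count,
    tsum_fintype, smul_eq_mul]
  rfl

theorem weylMeasure_pos_iff {N : ℕ} {F : Type} [Fintype F] [MeasurableSpace F]
    [MeasurableSingletonClass F] {S : Set ((Fin N → Torus) × F)} (hS : MeasurableSet S) :
    0 < weylMeasure N F S ↔ ∃ f : F, 0 < volume {x | (x, f) ∈ S} := by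
  have hc : (Fintype.card F : ENNReal)⁻¹ ≠ 0 := ENNReal.inv_ne_zero.mpr (ENNReal.natCast_ne_top _)
  rw [weylMeasure_apply hS, pos_iff_ne_zero, mul_ne_zero_iff, and_iff_right hc, ne_eq,
    Finset.sum_eq_zero_iff]
  simp [pos_iff_ne_zero]

theorem exists_weylT_zpow_eq_affPow {N s : ℕ} {F : Type} [AddCommGroup F] [Fintype F]
    (a : (Fin N → Torus) × F)
    (U : ((Fin N → Torus) × F) ≃+ ((Fin N → Torus) × F))
    (A : Matrix (Fin N) (Fin N) ℤ)
    (hU : ∀ x : Fin N → Torus, U (x, (0 : F)) = (fun j => ∑ i, A j i • x i, (0 : F)))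
    (hA : (A - 1) ^ (s + 1) = 0) (f : F) :
    ∃ (M : ℕ) (b : Fin N → Torus), 0 < M ∧ ∀ (e : ℤ) (x : Fin N → Torus), (M : ℤ) ∣ e →
      (weylT a U ^ e) (x, f) = (affPow (A - 1) s b e x, f) := by
  set σ : F → F := fun g => a.2 + (U (0, g)).2 with hσ
  have hT : ∀ x g, weylT a U (x, g) = (torusEnd A x + (a.1 + (U (0, g)).1), σ g) := by
    intro x g
    have h1 : U (x, g) = U (x, 0) + U (0, g) := by
      rw [← map_add]
      simp
    change a + U (x, g) = _
    rw [h1, hU]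
    ext
    · simp only [Prod.fst_add, Pi.add_apply, torusEnd_apply]
      abel
    · simp [hσ]
  have hσs : Function.Surjective σ := by
    intro g
    refine ⟨((weylT a U).symm (0, g)).2, ?_⟩
    have h := hT ((weylT a U).symm (0, g)).1 ((weylT a U).symm (0, g)).2
    rw [Prod.mk.eta, Equiv.apply_symm_apply] at h
    exact (congrArg Prod.snd h).symm
  obtain ⟨M, hM, hper⟩ := Function.mem_periodicPts.mp
    ((Finite.injective_iff_surjective.mpr hσs).mem_periodicPts f)
  have hpow : ∀ n : ℕ, ∃ c, ∀ x, (weylT a U ^ n) (x, f) = (torusEnd (A ^ n) x + c, σ^[n] f) := by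
    intro n
    induction n with
    | zero => exact ⟨0, fun x => by simp⟩
    | succ n ih =>
      obtain ⟨c, hc⟩ := ih
      refine ⟨torusEnd A c + (a.1 + (U (0, σ^[n] f)).1), fun x => ?_⟩
      rw [pow_succ', Equiv.Perm.mul_apply, hc, hT, map_add (torusEnd A), pow_succ',
        torusEnd_mul_apply, Function.iterate_succ_apply', add_assoc]
  obtain ⟨c, hc⟩ := hpow M
  obtain ⟨b, hb⟩ := surjective_torusEnd_binomQuot hA hM c
  have hM' : ∀ x, (weylT a U ^ M) (x, f) = (affPow (A - 1) s b M x, f) := by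
    intro x
    rw [hc, affPow_natCast hA, hb, add_sub_cancel, hper]
  refine ⟨M, b, hM, ?_⟩
  rintro _ x ⟨e, rfl⟩
  have hstep : ∀ e : ℤ, (weylT a U ^ ((M : ℤ) * (e + 1))) (x, f) =
      (weylT a U ^ M) ((weylT a U ^ ((M : ℤ) * e)) (x, f)) := by
    intro e
    rw [← Equiv.Perm.mul_apply, ← zpow_natCast, ← zpow_add]
    ring_nf
  have hstep' : ∀ e : ℤ, affPow (A - 1) s b ((M : ℤ) * (e + 1)) x =
      affPow (A - 1) s b M (affPow (A - 1) s b ((M : ℤ) * e) x) := by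
    intro e
    rw [← affPow_add_natCast hA, mul_add, mul_one]
  induction e using Int.induction_on with
  | zero => simp [affPow_zero]
  | succ n ih => rw [hstep, ih, hM', hstep']
  | pred n ih =>
    have h1 := hstep (-(n : ℤ) - 1)
    have h2 := hstep' (-(n : ℤ) - 1)
    rw [sub_add_cancel] at h1 h2
    apply (weylT a U ^ M).injective
    rw [← h1, ih, hM', ← h2]

end

noncomputable section

open Topology UnitAddTorus

section

variable {ι : Type*} [Fintype ι]

/-- Parseval's identity for the indicator function of a set. -/
theorem hasSum_sq_norm_setIntegral_mFourier {S : Set (ι → Torus)} (hS : MeasurableSet S) :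
    HasSum (fun k : ι → ℤ => ‖∫ x in S, mFourier k x‖ ^ 2)
      ((volume : Measure (ι → Torus)).real S) := by
  rw [volume_torus_pi_eq]
  set μ : Measure (ι → Torus) := Measure.pi fun _ => AddCircle.haarAddCircle with hμ
  have hL : MemLp (S.indicator fun _ => (1 : ℂ)) 2 μ :=
    memLp_indicator_const 2 hS 1 (Or.inr (measure_ne_top _ _))
  have hae := hL.coeFn_toLp
  have h : HasSum (fun k : ι → ℤ => ‖mFourierCoeff (hL.toLp _) k‖ ^ 2)
      (∫ x, ‖hL.toLp _ x‖ ^ 2 ∂μ) := hasSum_sq_mFourierCoeff _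
  have h1 : ∫ x, ‖hL.toLp _ x‖ ^ 2 ∂μ = μ.real S := by
    rw [← mul_one (μ.real S), ← smul_eq_mul, ← integral_indicator_const (1 : ℝ) hS]
    refine integral_congr_ae (hae.mono fun x hx => ?_)
    beta_reduce
    rw [hx]
    by_cases h : x ∈ S <;> simp [h]
  have h2 : ∀ k, mFourierCoeff (hL.toLp _) (-k) = ∫ x in S, mFourier k x ∂μ := by
    intro k
    have : mFourierCoeff (hL.toLp _) (-k) = ∫ x, mFourier (- -k) x • hL.toLp _ x ∂μ := rfl
    rw [this, ← integral_indicator hS]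
    refine integral_congr_ae (hae.mono fun x hx => ?_)
    beta_reduce
    rw [hx, neg_neg]
    by_cases h : x ∈ S <;> simp [h]
  rw [h1] at h
  simp only [← h2]
  exact (Equiv.neg (ι → ℤ)).hasSum_iff.mpr h

theorem measureReal_eq_zero_or_one_of_setIntegral_mFourier {S : Set (ι → Torus)}
    (hS : MeasurableSet S) (h : ∀ k : ι → ℤ, k ≠ 0 → ∫ x in S, mFourier k x = 0) :
    (volume : Measure (ι → Torus)).real S = 0 ∨ (volume : Measure (ι → Torus)).real S = 1 := by
  have h1 := hasSum_sq_norm_setIntegral_mFourier hS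
  have h2 := h1.unique (hasSum_single 0 fun k hk => by simp [h k hk])
  simp only [mFourier_zero, ContinuousMap.one_apply, setIntegral_const, mul_one,
    Complex.real_smul, Complex.norm_real, Real.norm_eq_abs, sq_abs] at h2
  have h3 : (volume : Measure (ι → Torus)).real S *
      ((volume : Measure (ι → Torus)).real S - 1) = 0 := by linarith
  exact (mul_eq_zero.mp h3).imp id sub_eq_zero.mp

variable [DecidableEq ι]

theorem vecMul_eq_of_vecMul_pow_eq {A : Matrix ι ι ℤ} {s : ℕ} (hA : (A - 1) ^ (s + 1) = 0) {n : ℕ}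
    (hn : 0 < n) {k : ι → ℤ} (hk : Matrix.vecMul k (A ^ n) = k) : Matrix.vecMul k A = k := by
  obtain ⟨D, K, hD⟩ := exists_mul_binomQuot_eq hA n
  have h1 : A ^ n = 1 + (A - 1) * binomQuot (A - 1) s n := by
    rw [← binomPow_eq hA, binomPow_natCast hA, add_sub_cancel]
  have h2 : Matrix.vecMul (Matrix.vecMul k (A - 1)) (binomQuot (A - 1) s n) = 0 := by
    rw [h1, Matrix.vecMul_add, Matrix.vecMul_one, ← Matrix.vecMul_vecMul] at hk
    simpa using hk
  have h3 : ((n ^ K : ℕ) : ℤ) • Matrix.vecMul k (A - 1) = 0 := by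
    have hcast : ∀ m : ℕ, (m : Matrix ι ι ℤ) = m • 1 := fun m => (nsmul_one m).symm
    have h := Matrix.vecMul_vecMul (Matrix.vecMul k (A - 1)) (binomQuot (A - 1) s n) D
    rw [h2, Matrix.zero_vecMul, hD, hcast, Matrix.vecMul_smul, Matrix.vecMul_one] at h
    rw [natCast_zsmul, ← h]
  have h4 : Matrix.vecMul k (A - 1) = 0 :=
    (smul_eq_zero.mp h3).resolve_left (by positivity)
  rw [Matrix.vecMul_sub, Matrix.vecMul_one, sub_eq_zero] at h4
  exact h4

end

/-! ### Ergodicity of unipotent affine maps with a cyclic factor -/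

theorem torusPair_injective_toCircle {x y : Torus}
    (h : (AddCircle.toCircle x : ℂ) = AddCircle.toCircle y) : x = y :=
  AddCircle.injective_toCircle one_ne_zero (Circle.ext h)

/-- The map `(x, f) ↦ (A x + a, f + 1)` is ergodic provided no character fixed by `A` takes a
torsion value at `a`. -/
theorem ergodic_affine_cyclic {N M K : ℕ} [NeZero M] {A : Matrix (Fin N) (Fin N) ℤ}
    (hA : (A - 1) ^ (K + 1) = 0) (a : Fin N → Torus)
    (ha : ∀ k : Fin N → ℤ, k ≠ 0 → Matrix.vecMul k A = k → ∀ j : ℕ, 0 < j →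
      j • torusPair k a ≠ 0)
    (T : (Fin N → Torus) × ZMod M → (Fin N → Torus) × ZMod M)
    (hT : ∀ x f, T (x, f) = (torusEnd A x + a, f + 1)) :
    Ergodic T (weylMeasure N (ZMod M)) := by
  have hAu : IsUnit A := by
    have h : IsNilpotent (A - 1) := ⟨_, hA⟩
    simpa using h.isUnit_one_add
  have hT' : T = fun p => (torusEnd A p.1 + a, p.2 + 1) := funext fun p => hT p.1 p.2
  have hTm : Measurable T := by
    rw [hT']
    exact (((continuous_torusEnd A).measurable.comp measurable_fst).add_const a).prodMk
      ((measurable_from_top (f := fun f : ZMod M => f + 1)).comp measurable_snd)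
  have hstep := measurePreserving_torusEnd_add hAu a
  have hmp : MeasurePreserving T (weylMeasure N (ZMod M)) (weylMeasure N (ZMod M)) := by
    refine ⟨hTm, Measure.ext fun S hS => ?_⟩
    rw [Measure.map_apply hTm hS, weylMeasure_apply (hTm hS), weylMeasure_apply hS]
    congr 1
    refine Fintype.sum_equiv (Equiv.addRight (1 : ZMod M)) _ _ fun f => ?_
    have hm : MeasurableSet {x | (x, f + 1) ∈ S} := measurable_prodMk_right hS
    change _ = volume {x | (x, f + 1) ∈ S}
    rw [← hstep.measure_preimage hm.nullMeasurableSet]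
    congr 1
    ext x
    simp [hT]
  refine ⟨hmp, ⟨fun {S} hS hinv => ?_⟩⟩
  have hSf : ∀ f, MeasurableSet {x | (x, f) ∈ S} := fun f => measurable_prodMk_right hS
  have hmem : ∀ x f, (torusEnd A x + a, f + 1) ∈ S ↔ (x, f) ∈ S := by
    intro x f
    rw [← hT]
    exact Set.ext_iff.mp hinv (x, f)
  set c : ZMod M → (Fin N → ℤ) → ℂ := fun f k => ∫ x in {x | (x, f) ∈ S}, mFourier k x with hc
  have hcstep : ∀ f k, c (f + 1) k =
      AddCircle.toCircle (torusPair k a) * c f (Matrix.vecMul k A) := by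
    intro f k
    have hpre : (fun x => torusEnd A x + a) ⁻¹' {x | (x, f + 1) ∈ S} = {x | (x, f) ∈ S} := by
      ext x
      exact hmem x f
    simp only [hc]
    have hc' : Measurable fun y : Fin N → Torus => mFourier k y := (mFourier k).continuous.measurable
    rw [← hstep.map_eq, setIntegral_map (hSf _) hc'.aestronglyMeasurable hstep.measurable.aemeasurable,
      hpre, ← integral_const_mul, hstep.map_eq]
    refine integral_congr_ae (Eventually.of_forall fun x => ?_)
    change mFourier k (torusEnd A x + a) = _ * mFourier _ x
    rw [mFourier_apply_add, mFourier_eq_toCircle k (torusEnd A x), torusPair_torusEnd,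
      ← mFourier_eq_toCircle, mFourier_eq_toCircle k a, mul_comm]
  have hnorm : ∀ f k, ‖c (f + 1) k‖ = ‖c f (Matrix.vecMul k A)‖ := by
    intro f k
    rw [hcstep, norm_mul, Circle.norm_coe, one_mul]
  have hiter : ∀ (n : ℕ) f k, ‖c (f + n) k‖ = ‖c f (Matrix.vecMul k (A ^ n))‖ := by
    intro n
    induction n with
    | zero => simp
    | succ n ih =>
      intro f k
      rw [Nat.cast_succ, ← add_assoc, hnorm, ih, Matrix.vecMul_vecMul, ← pow_succ']
  have hper : ∀ (j : ℕ) f k, ‖c f k‖ = ‖c f (Matrix.vecMul k (A ^ (M * j)))‖ := by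
    intro j f k
    rw [← hiter]
    simp
  have hzero : ∀ f k, k ≠ 0 → c f k = 0 := by
    intro f k hk
    by_contra hne
    have hfix : Matrix.vecMul k A = k := by
      have hninj : ¬ Function.Injective fun j : ℕ => Matrix.vecMul k (A ^ (M * j)) := by
        intro hinj
        have h1 := (hasSum_sq_norm_setIntegral_mFourier (hSf f)).summable.tendsto_cofinite_zero
        have h2 := h1.comp hinj.tendsto_cofinite
        have h3 : Tendsto (fun _ : ℕ => ‖c f k‖ ^ 2) cofinite (𝓝 0) := by
          refine h2.congr fun j => ?_
          rw [hper j f k]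
          rfl
        have h4 := tendsto_nhds_unique h3 tendsto_const_nhds
        exact hne (by simpa using h4.symm)
      simp only [Function.Injective, not_forall] at hninj
      obtain ⟨i, j, hij, hne'⟩ := hninj
      wlog hlt : i < j generalizing i j
      · exact this j i hij.symm (Ne.symm hne') (lt_of_le_of_ne (not_lt.mp hlt) (Ne.symm hne'))
      obtain ⟨B, hB⟩ := hAu.pow (M * i)
      have hpos : 0 < M * j - M * i := by
        have := Nat.mul_lt_mul_of_pos_left hlt (Nat.pos_of_ne_zero (NeZero.ne M))
        omega
      refine vecMul_eq_of_vecMul_pow_eq hA hpos ?_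
      have hsplit : A ^ (M * j) = A ^ (M * j - M * i) * A ^ (M * i) := by
        rw [← pow_add]
        congr 1
        omega
      rw [hsplit, ← hB, ← Matrix.vecMul_vecMul] at hij
      have h5 := congrArg (fun v => Matrix.vecMul v (↑B⁻¹ : Matrix (Fin N) (Fin N) ℤ)) hij
      simpa [Matrix.vecMul_vecMul] using h5.symm
    have hn : ∀ n : ℕ, c (f + n) k = AddCircle.toCircle (n • torusPair k a) * c f k := by
      intro n
      induction n with
      | zero => simp
      | succ n ih =>
        rw [Nat.cast_succ, ← add_assoc, hcstep, hfix, ih, succ_nsmul', AddCircle.toCircle_add,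
          Circle.coe_mul, mul_assoc]
    have hM := hn M
    rw [ZMod.natCast_self, add_zero] at hM
    have h1 : (AddCircle.toCircle (M • torusPair k a) : ℂ) = AddCircle.toCircle (0 : Torus) := by
      rw [AddCircle.toCircle_zero, Circle.coe_one]
      exact mul_right_cancel₀ hne (by rw [← hM, one_mul])
    exact ha k hk hfix M (Nat.pos_of_ne_zero (NeZero.ne M)) (torusPair_injective_toCircle h1)
  have hvol : ∀ f, (volume : Measure (Fin N → Torus)) {x | (x, f) ∈ S} =
      volume {x | (x, (0 : ZMod M)) ∈ S} := by
    have h1 : ∀ n : ℕ, (volume : Measure (Fin N → Torus)) {x | (x, (n : ZMod M)) ∈ S} =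
        volume {x | (x, (0 : ZMod M)) ∈ S} := by
      intro n
      induction n with
      | zero => simp
      | succ n ih =>
        rw [← ih, ← hstep.measure_preimage (hSf _).nullMeasurableSet]
        congr 1
        ext x
        simpa using hmem x n
    intro f
    have := h1 f.val
    rwa [ZMod.natCast_zmod_val] at this
  rw [eventuallyConst_set']
  rcases measureReal_eq_zero_or_one_of_setIntegral_mFourier (hSf 0) (hzero 0) with h | h
  · left
    rw [ae_eq_empty, weylMeasure_apply hS]
    have h0 : (volume : Measure (Fin N → Torus)) {x | (x, (0 : ZMod M)) ∈ S} = 0 :=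
      (measureReal_eq_zero_iff).mp h
    simp [hvol, h0]
  · right
    rw [ae_eq_univ, weylMeasure_apply hS.compl]
    have h0 : (volume : Measure (Fin N → Torus)) {x | (x, (0 : ZMod M)) ∈ S}ᶜ = 0 := by
      rw [prob_compl_eq_zero_iff (hSf 0), ← ENNReal.toReal_eq_one_iff]
      exact h
    have h1 : ∀ f, (volume : Measure (Fin N → Torus)) {x | (x, f) ∈ Sᶜ} = 0 := by
      intro f
      change volume {x | (x, f) ∈ S}ᶜ = 0
      rw [prob_compl_eq_zero_iff (hSf f), hvol, ← prob_compl_eq_zero_iff (hSf 0), h0]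
    rw [Finset.sum_eq_zero fun f _ => h1 f, mul_zero]

end

noncomputable section

/-! ### Rational independence -/

/-- Finitely many real numbers are integral combinations, modulo `D⁻¹ ℤ`, of finitely many reals
which together with `1` are rationally independent. -/
theorem exists_rationally_independent (E : Finset ℝ) :
    ∃ (d : ℕ) (β : Fin d → ℝ) (D : ℤ), D ≠ 0 ∧
      (∀ (c₀ : ℤ) (c : Fin d → ℤ), (c₀ : ℝ) + ∑ b, c b * β b = 0 → c = 0) ∧
      ∀ e ∈ E, ∃ (c₀ : ℤ) (c : Fin d → ℤ), e = c₀ / D + ∑ b, c b * β b := by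
  classical
  induction E using Finset.induction_on with
  | empty => exact ⟨0, Fin.elim0, 1, one_ne_zero, fun _ _ _ => Subsingleton.elim _ _, by simp⟩
  | insert e E _ ih =>
    obtain ⟨d, β, D, hD, hind, hE⟩ := ih
    have hD' : (D : ℝ) ≠ 0 := Int.cast_ne_zero.mpr hD
    by_cases h : ∃ (n c₀ : ℤ) (c : Fin d → ℤ), n ≠ 0 ∧ n * e = c₀ + ∑ b, c b * β b
    · obtain ⟨n, c₀, c, hn, he⟩ := h
      have hn' : (n : ℝ) ≠ 0 := Int.cast_ne_zero.mpr hn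
      refine ⟨d, fun b => β b / n, D * n, mul_ne_zero hD hn, fun c₁ c' hc => ?_, fun e' he' => ?_⟩
      · refine hind (n * c₁) c' ?_
        have := congrArg (fun t => (n : ℝ) * t) hc
        simp only [mul_zero, mul_add, Finset.mul_sum] at this
        rw [← this]
        push_cast
        congr 1
        refine Finset.sum_congr rfl fun b _ => ?_
        field_simp
      · rcases Finset.mem_insert.mp he' with rfl | he'
        · refine ⟨c₀ * D, c, ?_⟩
          have h1 : ∑ b, (c b : ℝ) * (β b / n) = (∑ b, (c b : ℝ) * β b) / n := by
            rw [Finset.sum_div]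
            exact Finset.sum_congr rfl fun b _ => by ring
          rw [h1]
          push_cast
          field_simp
          linarith
        · obtain ⟨c₁, c', hc'⟩ := hE e' he'
          refine ⟨c₁ * n, fun b => n * c' b, ?_⟩
          rw [hc']
          push_cast
          congr 1
          · field_simp
          · exact Finset.sum_congr rfl fun b _ => by field_simp
    · push Not at h
      refine ⟨d + 1, Fin.cons e β, D, hD, fun c₀ c hc => ?_, fun e' he' => ?_⟩
      · rw [Fin.sum_univ_succ] at hc
        simp only [Fin.cons_zero, Fin.cons_succ] at hc
        have h0 : c 0 = 0 := by
          by_contra h0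
          refine h (c 0) (-c₀) (fun b => -c b.succ) h0 ?_
          push_cast
          simp only [neg_mul, Finset.sum_neg_distrib]
          linarith
        have h1 := hind c₀ (fun b => c b.succ) (by rw [h0] at hc; simpa using hc)
        ext b
        refine Fin.cases h0 (fun b => congrFun h1 b) b
      · rcases Finset.mem_insert.mp he' with rfl | he'
        · exact ⟨0, Pi.single 0 1, by simp [Fin.sum_univ_succ]⟩
        · obtain ⟨c₁, c', hc'⟩ := hE e' he'
          exact ⟨c₁, Fin.cons 0 c', by simp [Fin.sum_univ_succ, hc']⟩

/-! ### Weyl polynomials -/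

theorem cast_ieval {p : Polynomial ℝ} (hp : IsIntegralPoly p) (n : ℤ) :
    (ieval p n : ℝ) = p.eval (n : ℝ) := by
  obtain ⟨m, hm⟩ := hp n
  rw [ieval, hm, Int.floor_intCast]

theorem eval_pbr (p : Polynomial ℝ) (j : ℕ) (x : ℝ) :
    (pbr p j).eval x = (j.factorial : ℝ)⁻¹ * ∏ i ∈ Finset.range j, (p.eval x - i) := by
  simp [pbr, eval_prod]

theorem pbr_one (p : Polynomial ℝ) : pbr p 1 = p := by
  simp [pbr]

theorem eval_pbr_eq_choose {p : Polynomial ℝ} (hp : IsIntegralPoly p) (j : ℕ) (n : ℤ) :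
    (pbr p j).eval (n : ℝ) = ((Ring.choose (ieval p n) j : ℤ) : ℝ) := by
  have h : ((j.factorial : ℕ) : ℤ) * Ring.choose (ieval p n) j =
      ∏ i ∈ Finset.range j, (ieval p n - i) := by
    have := Ring.descPochhammer_eq_factorial_smul_choose (ieval p n) j
    rw [nsmul_eq_mul] at this
    rw [← this, ← Polynomial.eval_eq_smeval, descPochhammer_eval_eq_prod_range]
  have h' := congrArg (Int.cast : ℤ → ℝ) h
  push_cast at h'
  rw [eval_pbr, ← cast_ieval hp, ← h', ← mul_assoc, inv_mul_cancel₀ (by positivity), one_mul]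

theorem sum_ite_le_sub_eq {r : ℕ} (P : Fin r → Polynomial ℝ) (n c : ℕ) (u : ℕ → Fin r → ℝ)
    (hu : ∀ i, n ≤ i → u i = 0) (x : ℝ) :
    ∑ ρ : Fin n × Fin r, u ρ.1 ρ.2 *
        (if c ≤ (ρ.1 : ℕ) then (pbr (P ρ.2) ((ρ.1 : ℕ) - c + 1)).eval x else 0) =
      ∑ j ∈ Finset.range n, ∑ m, u (c + j) m * (pbr (P m) (j + 1)).eval x := by
  rw [Fintype.sum_prod_type, ← Fin.sum_univ_eq_sum_range
    (fun i => ∑ m, u (c + i) m * (pbr (P m) (i + 1)).eval x),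
    Fin.sum_univ_eq_sum_range (fun i => ∑ m, u i m *
      (if c ≤ i then (pbr (P m) (i - c + 1)).eval x else 0)),
    Fin.sum_univ_eq_sum_range (fun i => ∑ m, u (c + i) m * (pbr (P m) (i + 1)).eval x)]
  have h : ∑ i ∈ Finset.range (c + n), ∑ m, u i m *
      (if c ≤ i then (pbr (P m) (i - c + 1)).eval x else 0) =
      ∑ i ∈ Finset.range n, ∑ m, u i m *
      (if c ≤ i then (pbr (P m) (i - c + 1)).eval x else 0) := by
    refine (Finset.sum_subset (Finset.range_mono (by omega)) fun i _ hi => ?_).symm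
    simp [hu i (by simpa using hi)]
  rw [← h, Finset.sum_range_add, Finset.sum_eq_zero fun i hi => ?_, zero_add]
  · simp
  · have : ¬ c ≤ i := by simpa using hi
    simp [this]

/-- A uniform description of the Weyl polynomials. -/
theorem mem_WP_succ_iff {r : ℕ} (P : Fin r → Polynomial ℝ) (k : ℕ) (q : Polynomial ℝ) :
    q ∈ WP P (k + 1) ↔ ∃ u : ℕ → Fin r → ℝ, (∀ i, k < i → u i = 0) ∧
      (∀ c, ∀ x : ℝ, ∑ j ∈ Finset.range (k + 1), ∑ m,
        u (c + 1 + j) m * (pbr (P m) (j + 1)).eval x = 0) ∧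
      ∀ x : ℝ, q.eval x = ∑ j ∈ Finset.range (k + 1), ∑ m,
        u j m * (pbr (P m) (j + 1)).eval x := by
  cases k with
  | zero =>
    change q ∈ Submodule.span ℝ (Set.range P) ↔ _
    rw [Submodule.mem_span_range_iff_exists_fun]
    constructor
    · rintro ⟨c, rfl⟩
      refine ⟨fun i => if i = 0 then c else 0, fun i hi => if_neg hi.ne', ?_, ?_⟩
      · intro c x
        simp
      · intro x
        simp [pbr_one, eval_finsetSum]
    · rintro ⟨u, -, -, h⟩
      refine ⟨u 0, Polynomial.funext fun x => ?_⟩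
      rw [h]
      simp [pbr_one, eval_finsetSum]
  | succ k =>
    constructor
    · rintro ⟨v, h1, h2⟩
      set u : ℕ → Fin r → ℝ := fun i m => if h : i < k + 2 then v (⟨i, h⟩, m) else 0 with hu
      have hv : ∀ ρ : Fin (k + 2) × Fin r, v ρ = u ρ.1 ρ.2 := fun ρ => by
        simp [hu, ρ.1.isLt]
      have hu0 : ∀ i, k + 1 < i → u i = 0 := fun i hi => by
        ext m
        simp only [hu, Pi.zero_apply]
        rw [dif_neg (by omega)]
      refine ⟨u, hu0, fun c x => ?_, fun x => ?_⟩
      · rw [Finset.sum_range_succ]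
        have hlast : ∑ m, u (c + 1 + (k + 1)) m * (pbr (P m) (k + 1 + 1)).eval x = 0 := by
          simp [hu0 (c + 1 + (k + 1)) (by omega)]
        rw [hlast, add_zero]
        by_cases hc : c < k + 1
        · have := congrFun (h1 x) ⟨c, hc⟩
          have h3 := sum_ite_le_sub_eq P (k + 1) c (fun i => u (i + 1))
            (fun i hi => hu0 _ (by omega)) x
          simp only [Matrix.vecMul, dotProduct, Lam, hv, Fin.val_succ] at this
          rw [h3, Pi.zero_apply] at this
          simpa only [add_right_comm] using this
        · refine Finset.sum_eq_zero fun j _ => ?_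
          simp [hu0 (c + 1 + j) (by omega)]
      · rw [h2]
        have h3 := sum_ite_le_sub_eq P (k + 2) 0 u (fun i hi => hu0 _ (by omega)) x
        simp only [zero_add] at h3
        rw [← h3]
        simp only [Matrix.vecMul, dotProduct, Lam, hv]
        rfl
    · rintro ⟨u, hu0, h1, h2⟩
      refine ⟨fun ρ => u ρ.1 ρ.2, fun x => ?_, fun x => ?_⟩
      · ext c
        have h3 := sum_ite_le_sub_eq P (k + 1) c (fun i => u (i + 1))
            (fun i hi => hu0 _ (by omega)) x
        have h4 := h1 c x
        rw [Finset.sum_range_succ] at h4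
        have hlast : ∑ m, u (c + 1 + (k + 1)) m * (pbr (P m) (k + 1 + 1)).eval x = 0 := by
          simp [hu0 (c + 1 + (k + 1)) (by omega)]
        rw [hlast, add_zero] at h4
        simp only [Matrix.vecMul, dotProduct, Lam, Fin.val_succ, Pi.zero_apply]
        rw [h3, ← h4]
        simp only [add_right_comm]
      · have h3 := sum_ite_le_sub_eq P (k + 2) 0 u (fun i hi => hu0 _ (by omega)) x
        simp only [zero_add] at h3
        rw [h2, ← h3]
        simp only [Matrix.vecMul, dotProduct, Lam]
        rfl

end

noncomputable section

open Topology

/-! ### Direct sums of unipotent Jordan blocks -/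

section

variable (d k : ℕ)

/-- The nilpotent matrix consisting of `d` Jordan blocks of size `k + 1`. -/
def shiftMatrix : Matrix (Fin (d * (k + 1))) (Fin (d * (k + 1))) ℤ := fun i j =>
  if (finProdFinEquiv.symm i).1 = (finProdFinEquiv.symm j).1 ∧
    ((finProdFinEquiv.symm i).2 : ℕ) = (finProdFinEquiv.symm j).2 + 1 then 1 else 0

variable {d}

/-- The character of the torus of dimension `d * (k + 1)` whose `i`-th coordinate in the `b`-th
block is `C i b`. -/
def shiftVec (C : ℕ → Fin d → ℤ) : Fin (d * (k + 1)) → ℤ := fun c =>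
  C (finProdFinEquiv.symm c).2 (finProdFinEquiv.symm c).1

variable {k}

theorem vecMul_shiftVec {C : ℕ → Fin d → ℤ} (hC : ∀ i, k < i → C i = 0) :
    Matrix.vecMul (shiftVec k C) (shiftMatrix d k) = shiftVec k fun i => C (i + 1) := by
  ext c
  simp only [Matrix.vecMul, dotProduct, shiftVec, shiftMatrix, mul_ite, mul_one, mul_zero]
  obtain ⟨⟨b, i⟩, rfl⟩ := finProdFinEquiv.surjective c
  rw [← finProdFinEquiv.sum_comp, Fintype.sum_prod_type]
  simp only [Equiv.symm_apply_apply]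
  rw [Finset.sum_eq_single b (fun b' _ hb' => by simp [hb']) (by simp)]
  simp only [true_and]
  by_cases hi : (i : ℕ) + 1 < k + 1
  · rw [Finset.sum_eq_single ⟨i + 1, hi⟩ (fun j _ hj => ?_) (by simp)]
    · simp
    · rw [if_neg]
      exact fun h => hj (Fin.ext h)
  · rw [hC (i + 1) (by omega)]
    refine Finset.sum_eq_zero fun j _ => ?_
    rw [if_neg (by omega)]

theorem vecMul_shiftVec_pow {C : ℕ → Fin d → ℤ} (hC : ∀ i, k < i → C i = 0) (j : ℕ) :
    Matrix.vecMul (shiftVec k C) (shiftMatrix d k ^ j) = shiftVec k fun i => C (i + j) := by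
  induction j with
  | zero => simp
  | succ j ih =>
    rw [pow_succ, ← Matrix.vecMul_vecMul, ih, vecMul_shiftVec fun i hi => hC _ (by omega)]
    simp only [add_assoc, add_comm 1]

theorem exists_eq_shiftVec (v : Fin (d * (k + 1)) → ℤ) :
    ∃ C : ℕ → Fin d → ℤ, (∀ i, k < i → C i = 0) ∧ v = shiftVec k C := by
  refine ⟨fun i b => if h : i < k + 1 then v (finProdFinEquiv (b, ⟨i, h⟩)) else 0,
    fun i hi => ?_, ?_⟩
  · ext b
    simp [show ¬ i < k + 1 by omega]
  · ext c
    obtain ⟨⟨b, i⟩, rfl⟩ := finProdFinEquiv.surjective c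
    simp only [shiftVec, Equiv.symm_apply_apply]
    rw [dif_pos i.isLt]

theorem shiftMatrix_pow : shiftMatrix d k ^ (k + 1) = 0 := by
  ext i j
  obtain ⟨C, hC, h⟩ := exists_eq_shiftVec (k := k) (d := d) (Pi.single i 1)
  have h1 := vecMul_shiftVec_pow hC (k + 1)
  rw [← h, Matrix.single_one_vecMul] at h1
  have h2 := congrFun h1 j
  simp only [shiftVec] at h2
  rw [hC _ (by omega)] at h2
  exact h2

/-- The translation vector `β` placed in the first coordinates of the Jordan blocks. -/
def shiftTranslation (k : ℕ) (β : Fin d → ℝ) : Fin (d * (k + 1)) → Torus := fun c =>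
  if (finProdFinEquiv.symm c).2 = 0 then ((β (finProdFinEquiv.symm c).1 : ℝ) : Torus) else 0

theorem torusPair_shiftVec (C : ℕ → Fin d → ℤ) (β : Fin d → ℝ) :
    torusPair (shiftVec k C) (shiftTranslation k β) =
      ((∑ b, (C 0 b : ℝ) * β b : ℝ) : Torus) := by
  rw [torusPair_apply, ← finProdFinEquiv.sum_comp, Fintype.sum_prod_type]
  simp only [shiftVec, shiftTranslation, Equiv.symm_apply_apply, smul_ite, smul_zero,
    Finset.sum_ite_eq', Finset.mem_univ, if_true, Fin.val_zero]
  rw [← QuotientAddGroup.mk'_apply, map_sum]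
  refine Finset.sum_congr rfl fun b _ => ?_
  rw [← zsmul_eq_mul, map_zsmul]
  rfl

end

section

variable {r d k : ℕ}

theorem vecMul_binomQuot_shiftMatrix {C : ℕ → Fin d → ℤ} (hC : ∀ i, k < i → C i = 0) (e : ℤ) :
    Matrix.vecMul (shiftVec k C) (binomQuot (shiftMatrix d k) k e) =
      shiftVec k fun i b => ∑ j ∈ Finset.range (k + 1), C (i + j) b * Ring.choose e (j + 1) := by
  rw [binomQuot, Matrix.vecMul_sum]
  simp only [Matrix.vecMul_smul, vecMul_shiftVec_pow hC]
  ext c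
  simp [shiftVec, mul_comm]

/-- A family of characters satisfying the relations in the definition of a Weyl polynomial detects
the corresponding Weyl polynomial along orbits. -/
theorem sum_torusPair_affPow_sub {C : Fin r → ℕ → Fin d → ℤ} (hC : ∀ m i, k < i → C m i = 0)
    (β : Fin d → ℝ) (e : Fin r → ℤ)
    (hrel : ∀ c b, ∑ j ∈ Finset.range (k + 1), ∑ m,
      C m (c + 1 + j) b * Ring.choose (e m) (j + 1) = 0) (x : Fin (d * (k + 1)) → Torus) :
    ∑ m, torusPair (shiftVec k (C m))
        (affPow (shiftMatrix d k) k (shiftTranslation k β) (e m) x - x) =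
      ((∑ b, ((∑ j ∈ Finset.range (k + 1), ∑ m,
        C m j b * Ring.choose (e m) (j + 1) : ℤ) : ℝ) * β b : ℝ) : Torus) := by
  set ν := shiftMatrix d k with hν
  have h1 : ∀ m, torusPair (shiftVec k (C m))
      (affPow ν k (shiftTranslation k β) (e m) x - x) =
      torusPair (Matrix.vecMul (Matrix.vecMul (shiftVec k (C m)) ν) (binomQuot ν k (e m))) x +
      torusPair (Matrix.vecMul (shiftVec k (C m)) (binomQuot ν k (e m)))
        (shiftTranslation k β) := by
    intro m
    rw [affPow, binomPow_eq shiftMatrix_pow, torusEnd_add_apply, torusEnd_one_apply, map_sub,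
      map_add, map_add, torusPair_torusEnd, torusPair_torusEnd, Matrix.vecMul_vecMul]
    abel
  have h2 : ∑ m, torusPair
      (Matrix.vecMul (Matrix.vecMul (shiftVec k (C m)) ν) (binomQuot ν k (e m))) x = 0 := by
    simp only [torusPair_apply]
    rw [Finset.sum_comm]
    refine Finset.sum_eq_zero fun c _ => ?_
    rw [← Finset.sum_smul]
    convert zero_smul ℤ (x c)
    rw [← hrel (finProdFinEquiv.symm c).2 (finProdFinEquiv.symm c).1, Finset.sum_comm]
    refine Finset.sum_congr rfl fun m _ => ?_
    rw [vecMul_shiftVec (hC m), vecMul_binomQuot_shiftMatrix fun i hi => hC m _ (by omega)]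
    simp only [shiftVec, add_right_comm]
  simp only [h1]
  rw [Finset.sum_add_distrib, h2, zero_add]
  have h3 : ∀ m, torusPair (Matrix.vecMul (shiftVec k (C m)) (binomQuot ν k (e m)))
      (shiftTranslation k β) = ((∑ b, ((∑ j ∈ Finset.range (k + 1),
        C m j b * Ring.choose (e m) (j + 1) : ℤ) : ℝ) * β b : ℝ) : Torus) := by
    intro m
    rw [vecMul_binomQuot_shiftMatrix (hC m), torusPair_shiftVec]
    simp only [zero_add]
  simp only [h3]
  rw [← QuotientAddGroup.mk'_apply]
  refine (map_sum (QuotientAddGroup.mk' (AddSubgroup.zmultiples (1 : ℝ))) _ _).symm.trans ?_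
  congr 1
  rw [Finset.sum_comm]
  refine Finset.sum_congr rfl fun b _ => ?_
  rw [← Finset.sum_mul, Finset.sum_comm]
  push_cast
  simp

end

/-! ### The recurrence hypothesis -/

/-- Measurable recurrence along `P` and `R` for all Weyl systems whose unipotent matrix has step
at most `s`. -/
def IsWeylRecurrent {r : ℕ} (P : Fin r → Polynomial ℝ) (s : ℕ) (R : Set ℕ) : Prop :=
  ∀ (N : ℕ) (F : Type) [AddCommGroup F] [Fintype F]
      [TopologicalSpace F] [DiscreteTopology F]
      [MeasurableSpace F] [MeasurableSingletonClass F]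
      (a : (Fin N → Torus) × F)
      (U : ((Fin N → Torus) × F) ≃+ ((Fin N → Torus) × F))
      (A : Matrix (Fin N) (Fin N) ℤ), IsWeylSystemWith a U A →
      (A - 1) ^ s = 0 →
      ∀ S : Set ((Fin N → Torus) × F), MeasurableSet S → 0 < weylMeasure N F S →
        ∃ n ∈ R, 0 < weylMeasure N F
          (S ∩ ⋂ k : Fin r, (weylT a U ^ (ieval (P k) (n : ℤ))) ⁻¹' S)

/-- The automorphism of `𝕋 ^ N × F` induced by an invertible integer matrix. -/
def torusProdAut {N : ℕ} (F : Type) [AddCommGroup F] (A : (Matrix (Fin N) (Fin N) ℤ)ˣ) :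
    ((Fin N → Torus) × F) ≃+ ((Fin N → Torus) × F) :=
  AddEquiv.prodCongr
    { toFun := torusEnd (A : Matrix (Fin N) (Fin N) ℤ)
      invFun := torusEnd (↑A⁻¹ : Matrix (Fin N) (Fin N) ℤ)
      left_inv := fun x => by rw [← torusEnd_mul_apply, A.inv_mul, torusEnd_one_apply]
      right_inv := fun x => by rw [← torusEnd_mul_apply, A.mul_inv, torusEnd_one_apply]
      map_add' := map_add _ } (AddEquiv.refl F)

theorem weylT_torusProdAut_zpow {N : ℕ} {F : Type} [AddCommGroup F] {s : ℕ}
    {ν : Matrix (Fin N) (Fin N) ℤ} (hν : ν ^ (s + 1) = 0) {A : (Matrix (Fin N) (Fin N) ℤ)ˣ}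
    (hA : (A : Matrix (Fin N) (Fin N) ℤ) = 1 + ν) (a : Fin N → Torus) (g : F) (e : ℤ)
    (x : Fin N → Torus) (f : F) :
    (weylT (a, g) (torusProdAut F A) ^ e) (x, f) = (affPow ν s a e x, f + e • g) := by
  set T := weylT (a, g) (torusProdAut F A) with hT
  have hstep : ∀ e : ℤ, T (affPow ν s a e x, f + e • g) =
      (affPow ν s a (e + 1) x, f + (e + 1) • g) := by
    intro e
    rw [affPow_add_one hν]
    change (a + torusEnd (A : Matrix (Fin N) (Fin N) ℤ) _, g + (f + e • g)) = _
    rw [hA, add_smul, one_smul]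
    ext : 1
    · exact add_comm _ _
    · simp only
      abel
  induction e using Int.induction_on with
  | zero => simp [affPow_zero]
  | succ n ih => rw [add_comm, zpow_one_add, Equiv.Perm.mul_apply, ih, hstep, add_comm]
  | pred n ih =>
    apply T.injective
    rw [hstep, sub_add_cancel, ← ih, ← Equiv.Perm.mul_apply, ← zpow_one_add, add_sub_cancel]

end

noncomputable section

open Topology

variable {r d k : ℕ}

theorem isWeylSystemWith_shift {M : ℕ} [NeZero M] {β : Fin d → ℝ}
    (hβ : ∀ (c₀ : ℤ) (c : Fin d → ℤ), (c₀ : ℝ) + ∑ b, c b * β b = 0 → c = 0)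
    {A : (Matrix (Fin (d * (k + 1))) (Fin (d * (k + 1))) ℤ)ˣ}
    (hA : (A : Matrix _ _ ℤ) = 1 + shiftMatrix d k) :
    IsWeylSystemWith (shiftTranslation k β, (1 : ZMod M)) (torusProdAut (ZMod M) A)
      (A : Matrix _ _ ℤ) := by
  have hA1 : (A : Matrix _ _ ℤ) - 1 = shiftMatrix d k := by rw [hA, add_sub_cancel_left]
  refine ⟨?_, ?_, fun x => rfl, ?_⟩
  · rw [hA1]
    rcases Nat.eq_zero_or_pos d with rfl | hd
    · ext i
      exact absurd i.isLt (by simp)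
    · exact pow_eq_zero_of_le (Nat.le_mul_of_pos_left _ hd) shiftMatrix_pow
  · change Continuous fun p : (Fin (d * (k + 1)) → Torus) × ZMod M =>
      (torusEnd (A : Matrix _ _ ℤ) p.1, p.2)
    exact ((continuous_torusEnd _).comp continuous_fst).prodMk continuous_snd
  · refine ergodic_affine_cyclic (K := k) (A := (A : Matrix _ _ ℤ))
      (by rw [hA1]; exact shiftMatrix_pow) (shiftTranslation k β) ?_ _ fun x f => ?_
    · intro v hv hvA j hj h
      obtain ⟨C, hC, rfl⟩ := exists_eq_shiftVec v
      rw [hA, Matrix.vecMul_add, Matrix.vecMul_one, add_eq_left, vecMul_shiftVec hC] at hvA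
      rw [torusPair_shiftVec, ← AddCircle.coe_nsmul, AddCircle.coe_eq_zero_iff] at h
      obtain ⟨n, hn⟩ := h
      have h1 := hβ (-n) (fun b => j * C 0 b) (by
        push_cast
        simp only [mul_assoc, ← Finset.mul_sum]
        simp only [zsmul_eq_mul, mul_one, nsmul_eq_mul] at hn
        linarith)
      apply hv
      ext c
      obtain ⟨⟨b, i⟩, rfl⟩ := finProdFinEquiv.surjective c
      have h0 : C 0 b = 0 := by
        have := congrFun h1 b
        simp only [Pi.zero_apply, mul_eq_zero] at this
        exact this.resolve_left (by positivity)
      obtain ⟨i, hi⟩ := i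
      cases i with
      | zero => simpa [shiftVec] using h0
      | succ i =>
        have := congrFun hvA (finProdFinEquiv (b, ⟨i, by omega⟩))
        simp only [shiftVec, Equiv.symm_apply_apply, Pi.zero_apply] at this ⊢
        exact this
    · change (_ + torusEnd _ x, 1 + f) = _
      exact Prod.ext (add_comm _ _) (add_comm _ _)

theorem sum_mul_coeff_eq_zero {β : Fin d → ℝ} {D : ℤ} (hD : D ≠ 0)
    (hβ : ∀ (c₀ : ℤ) (c : Fin d → ℤ), (c₀ : ℝ) + ∑ b, c b * β b = 0 → c = 0)
    {κ : Type*} (S : Finset κ) (t c₀ : κ → ℤ) (c : κ → Fin d → ℤ)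
    (h : ∑ l ∈ S, ((c₀ l : ℝ) / D + ∑ b, c l b * β b) * (t l : ℝ) = 0) (b : Fin d) :
    ∑ l ∈ S, c l b * t l = 0 := by
  have hD' : (D : ℝ) ≠ 0 := Int.cast_ne_zero.mpr hD
  have h1 := hβ (∑ l ∈ S, c₀ l * t l) (fun b => D * ∑ l ∈ S, c l b * t l) (by
    rw [← mul_zero (D : ℝ), ← h, Finset.mul_sum]
    push_cast
    simp only [Finset.mul_sum, Finset.sum_mul]
    rw [Finset.sum_comm, ← Finset.sum_add_distrib]
    refine Finset.sum_congr rfl fun l _ => ?_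
    rw [← mul_assoc, mul_add, mul_div_cancel₀ _ hD', add_mul, Finset.mul_sum, Finset.sum_mul]
    congr 1
    exact Finset.sum_congr rfl fun b _ => by ring)
  have h2 := congrFun h1 b
  simp only [Pi.zero_apply, mul_eq_zero] at h2
  exact h2.resolve_left hD

theorem dvd_choose_of_mul_factorial_dvd {D e : ℤ} {n j : ℕ} (hj : j < n)
    (h : D * (n.factorial : ℤ) ∣ e) : D ∣ Ring.choose e (j + 1) := by
  have h1 := Ring.choose_smul_choose e (Nat.le_add_left 1 j)
  rw [Nat.choose_one_right, Ring.choose_one_right, nsmul_eq_mul, Nat.add_sub_cancel] at h1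
  have h2 : D * ((j + 1 : ℕ) : ℤ) ∣ e :=
    (mul_dvd_mul_left D (Int.natCast_dvd_natCast.mpr (Nat.dvd_factorial (by omega) hj))).trans h
  obtain ⟨t, ht⟩ := h2
  have h3 : ((j + 1 : ℕ) : ℤ) ≠ 0 := by positivity
  refine ⟨t * Ring.choose (e - (1 : ℕ)) j, mul_left_cancel₀ h3 ?_⟩
  rw [h1]
  nth_rewrite 1 [ht]
  ring

/-- Along a set of recurrence for Weyl systems of step `k + 1`, finitely many Weyl polynomials of
order `k + 1` can be brought close to the integers simultaneously. -/
theorem IsWeylRecurrent.exists_norm_lt {P : Fin r → Polynomial ℝ}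
    (hint : ∀ m, IsIntegralPoly (P m)) {R : Set ℕ} (hR : IsWeylRecurrent P (k + 1) R)
    (Q : Finset (Polynomial ℝ)) (hQ : ∀ q ∈ Q, q ∈ WP P (k + 1)) {ε : ℝ} (hε : 0 < ε)
    {M : ℕ} (hM : 0 < M) :
    ∃ n ∈ R, (∀ m, (M : ℤ) ∣ ieval (P m) n) ∧ ∀ q ∈ Q, ‖((q.eval (n : ℝ) : ℝ) : Torus)‖ < ε := by
  classical
  have hQ' : ∀ q : Polynomial ℝ, ∃ u : ℕ → Fin r → ℝ, q ∈ Q → (∀ i, k < i → u i = 0) ∧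
      (∀ c, ∀ x : ℝ, ∑ j ∈ Finset.range (k + 1), ∑ m,
        u (c + 1 + j) m * (pbr (P m) (j + 1)).eval x = 0) ∧
      ∀ x : ℝ, q.eval x = ∑ j ∈ Finset.range (k + 1), ∑ m,
        u j m * (pbr (P m) (j + 1)).eval x := by
    intro q
    by_cases hq : q ∈ Q
    · obtain ⟨u, hu⟩ := (mem_WP_succ_iff P k q).mp (hQ q hq)
      exact ⟨u, fun _ => hu⟩
    · exact ⟨0, fun h => absurd h hq⟩
  choose u hu using hQ'
  obtain ⟨d, β, D, hD, hβ, hE⟩ := exists_rationally_independent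
    (insert 0 ((Q ×ˢ (Finset.range (k + 1) ×ˢ Finset.univ)).image fun t => u t.1 t.2.1 t.2.2))
  have hD' : (D : ℝ) ≠ 0 := Int.cast_ne_zero.mpr hD
  have hE' : ∀ q m i, ∃ (c₀ : ℤ) (c : Fin d → ℤ),
      q ∈ Q → u q i m = c₀ / D + ∑ b, c b * β b := by
    intro q m i
    by_cases hq : q ∈ Q
    · obtain ⟨c₀, c, h⟩ := hE (u q i m) (by
        by_cases hi : i < k + 1
        · exact Finset.mem_insert_of_mem (Finset.mem_image.mpr ⟨(q, i, m), by simp [hq, hi], rfl⟩)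
        · rw [(hu q hq).1 i (by omega)]
          exact Finset.mem_insert_self _ _)
      exact ⟨c₀, c, fun _ => h⟩
    · exact ⟨0, 0, fun h => absurd h hq⟩
  choose C₀ C hC using hE'
  have hCz : ∀ q ∈ Q, ∀ m i, k < i → C q m i = 0 := by
    intro q hq m i hi
    have h1 := hC q m i hq
    rw [(hu q hq).1 i hi, Pi.zero_apply] at h1
    ext b
    have := sum_mul_coeff_eq_zero hD hβ {()} (fun _ => 1) (fun _ => C₀ q m i)
      (fun _ => C q m i) (by simpa using h1.symm) b
    simpa using this
  have hrel : ∀ q ∈ Q, ∀ n : ℤ, ∀ c b, ∑ j ∈ Finset.range (k + 1), ∑ m,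
      C q m (c + 1 + j) b * Ring.choose (ieval (P m) n) (j + 1) = 0 := by
    intro q hq n c b
    have h1 := (hu q hq).2.1 c n
    rw [← Finset.sum_product'] at h1 ⊢
    refine sum_mul_coeff_eq_zero hD hβ _ (fun l : ℕ × Fin r => Ring.choose (ieval (P l.2) n) (l.1 + 1))
      (fun l : ℕ × Fin r => C₀ q l.2 (c + 1 + l.1)) (fun l : ℕ × Fin r => C q l.2 (c + 1 + l.1)) ?_ b
    rw [← h1]
    refine Finset.sum_congr rfl fun l _ => ?_
    rw [eval_pbr_eq_choose (hint _), hC q l.2 _ hq]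
  have hcont : ∀ q ∈ Q, ∀ᶠ z : Fin r → Fin (d * (k + 1)) → Torus in 𝓝 0,
      ‖∑ m, torusPair (shiftVec k (C q m)) (z m)‖ < ε := by
    intro q _
    have h1 : Continuous fun z : Fin r → Fin (d * (k + 1)) → Torus =>
        ‖∑ m, torusPair (shiftVec k (C q m)) (z m)‖ := by
      simp only [torusPair_apply]
      fun_prop
    have h2 := h1.tendsto 0
    simp only [Pi.zero_apply, map_zero, Finset.sum_const_zero, norm_zero] at h2
    exact h2.eventually (gt_mem_nhds hε)
  obtain ⟨δ, hδ, hball⟩ := Metric.eventually_nhds_iff.mp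
    ((Filter.eventually_all_finset Q).mpr hcont)
  set M' : ℕ := M * (D.natAbs * (k + 1).factorial) with hM'
  have hM'pos : 0 < M' := Nat.mul_pos hM
    (Nat.mul_pos (Int.natAbs_pos.mpr hD) (Nat.factorial_pos _))
  have : NeZero M' := ⟨hM'pos.ne'⟩
  have hunit : IsUnit (1 + shiftMatrix d k) :=
    IsNilpotent.isUnit_one_add ⟨_, shiftMatrix_pow⟩
  obtain ⟨A, hA⟩ := hunit
  have hsys := isWeylSystemWith_shift (M := M') hβ hA
  have hB : IsOpen (Metric.ball (0 : Fin (d * (k + 1)) → Torus) (δ / 2)) := Metric.isOpen_ball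
  have hS : MeasurableSet (Metric.ball (0 : Fin (d * (k + 1)) → Torus) (δ / 2) ×ˢ
      ({0} : Set (ZMod M'))) := hB.measurableSet.prod (measurableSet_singleton _)
  obtain ⟨n, hn, hpos⟩ := hR _ (ZMod M') _ _ _ hsys
    (by rw [hA, add_sub_cancel_left, shiftMatrix_pow]) _ hS ((weylMeasure_pos_iff hS).mpr ⟨0, by
      have hslice : {x | (x, (0 : ZMod M')) ∈ Metric.ball (0 : Fin (d * (k + 1)) → Torus) (δ / 2) ×ˢ
          ({0} : Set (ZMod M'))} = Metric.ball 0 (δ / 2) := Set.ext fun x => and_iff_left rfl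
      rw [hslice]
      exact hB.measure_pos volume ⟨0, Metric.mem_ball_self (half_pos hδ)⟩⟩)
  obtain ⟨⟨x, f⟩, hx⟩ := nonempty_of_measure_ne_zero hpos.ne'
  simp only [Set.mem_inter_iff, Set.mem_iInter, Set.mem_preimage, Set.mem_prod,
    Set.mem_singleton_iff, weylT_torusProdAut_zpow shiftMatrix_pow hA] at hx
  obtain ⟨⟨hx0, rfl⟩, hx1⟩ := hx
  have hdvd : ∀ m, (M' : ℤ) ∣ ieval (P m) n := by
    intro m
    have := (hx1 m).2
    rw [zero_add, zsmul_one] at this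
    exact (ZMod.intCast_zmod_eq_zero_iff_dvd _ _).mp this
  refine ⟨n, hn, fun m => (Int.natCast_dvd_natCast.mpr (dvd_mul_right M _)).trans (hdvd m),
    fun q hq => ?_⟩
  have hz := hball (y := fun m => affPow (shiftMatrix d k) k (shiftTranslation k β)
    (ieval (P m) n) x - x) (by
      rw [dist_pi_lt_iff hδ]
      intro m
      rw [Pi.zero_apply, dist_zero_right]
      have h1 := mem_ball_zero_iff.mp hx0
      have h2 := mem_ball_zero_iff.mp (hx1 m).1
      calc _ ≤ _ := norm_sub_le _ _
        _ < δ / 2 + δ / 2 := add_lt_add h2 h1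
        _ = δ := add_halves δ) q hq
  rw [sum_torusPair_affPow_sub (hCz q hq) β _ (hrel q hq n)] at hz
  convert hz using 2
  have hchoose : ∀ m, ∀ j ∈ Finset.range (k + 1), ∃ t : ℤ,
      Ring.choose (ieval (P m) n) (j + 1) = D * t := by
    intro m j hj
    refine dvd_choose_of_mul_factorial_dvd (Finset.mem_range.mp hj) (Dvd.dvd.trans ?_ (hdvd m))
    rw [hM']
    push_cast
    refine Dvd.dvd.mul_left (mul_dvd_mul_right ?_ _) _
    exact (dvd_abs _ _).mpr dvd_rfl
  have hint' : ∃ t : ℤ, ∑ j ∈ Finset.range (k + 1), ∑ m,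
      (C₀ q m j : ℝ) / D * ((Ring.choose (ieval (P m) n) (j + 1) : ℤ) : ℝ) = t := by
    choose t ht using fun m j => (show ∃ t : ℤ, j ∈ Finset.range (k + 1) →
      Ring.choose (ieval (P m) n) (j + 1) = D * t from
        if h : j ∈ Finset.range (k + 1) then (hchoose m j h).imp fun t ht _ => ht
        else ⟨0, fun h' => absurd h' h⟩)
    refine ⟨∑ j ∈ Finset.range (k + 1), ∑ m, C₀ q m j * t m j, ?_⟩
    push_cast
    refine Finset.sum_congr rfl fun j hj => Finset.sum_congr rfl fun m _ => ?_
    rw [ht m j hj]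
    push_cast
    field_simp
  obtain ⟨t, ht⟩ := hint'
  rw [← sub_eq_zero, ← AddCircle.coe_sub, AddCircle.coe_eq_zero_iff]
  refine ⟨t, ?_⟩
  rw [zsmul_one, ← ht, eq_sub_iff_add_eq]
  have hq' := (hu q hq).2.2 ((n : ℤ) : ℝ)
  simp only [eval_pbr_eq_choose (hint _), hC q _ _ hq] at hq'
  rw [Int.cast_natCast] at hq'
  rw [hq']
  push_cast
  simp only [add_mul, Finset.sum_add_distrib]
  congr 1
  simp only [Finset.sum_mul]
  rw [Finset.sum_comm]
  refine Finset.sum_congr rfl fun j _ => ?_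
  rw [Finset.sum_comm]
  exact Finset.sum_congr rfl fun m _ => Finset.sum_congr rfl fun b _ => by ring

end

noncomputable section

open Topology UnitAddTorus

/-! ### Characters along polynomial orbits -/

section

variable {ι : Type*} [Fintype ι]

theorem map_add_sum_mul_eq_zero {κ : Type*} (S : Finset κ) (t : κ → ℝ) (v₀ : ι → ℤ)
    (v : κ → ι → ℤ) (h : ∀ i, (v₀ i : ℝ) + ∑ l ∈ S, (v l i : ℝ) * t l = 0)
    (φ : (ι → ℤ) →+ ℝ) : φ v₀ + ∑ l ∈ S, φ (v l) * t l = 0 := by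
  classical
  have hφ : ∀ w : ι → ℤ, φ w = ∑ i, (w i : ℝ) * φ (Pi.single i 1) := by
    intro w
    conv_lhs => rw [pi_eq_sum_univ' w, map_sum]
    refine Finset.sum_congr rfl fun i _ => ?_
    rw [map_zsmul, zsmul_eq_mul]
  simp only [hφ v₀, hφ (v _), Finset.sum_mul]
  rw [Finset.sum_comm, ← Finset.sum_add_distrib]
  refine Finset.sum_eq_zero fun i _ => ?_
  rw [← zero_mul (φ (Pi.single i 1)), ← h i, add_mul, Finset.sum_mul]
  congr 1
  exact Finset.sum_congr rfl fun l _ => by ring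

variable [DecidableEq ι]

/-- The pairing of an integer vector `v` with `ν ^ c` applied to the real vector `y`. -/
def powPair (ν : Matrix ι ι ℤ) (y : ι → ℝ) (c : ℕ) : (ι → ℤ) →+ ℝ where
  toFun v := ∑ i, ((Matrix.vecMul v (ν ^ c) i : ℤ) : ℝ) * y i
  map_zero' := by simp
  map_add' v w := by simp [Matrix.add_vecMul, add_mul, Finset.sum_add_distrib]

theorem powPair_apply (ν : Matrix ι ι ℤ) (y : ι → ℝ) (c : ℕ) (v : ι → ℤ) :
    powPair ν y c v = ∑ i, ((Matrix.vecMul v (ν ^ c) i : ℤ) : ℝ) * y i := rfl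

theorem powPair_vecMul_pow (ν : Matrix ι ι ℤ) (y : ι → ℝ) (c j : ℕ) (v : ι → ℤ) :
    powPair ν y c (Matrix.vecMul v (ν ^ j)) = powPair ν y (c + j) v := by
  rw [powPair_apply, powPair_apply, Matrix.vecMul_vecMul, ← pow_add, add_comm]

theorem torusPair_vecMul_pow (ν : Matrix ι ι ℤ) (y : ι → ℝ) (j : ℕ) (v : ι → ℤ) :
    torusPair (Matrix.vecMul v (ν ^ j)) (fun i => ((y i : ℝ) : Torus)) =
      ((powPair ν y j v : ℝ) : Torus) := by
  rw [torusPair_apply, powPair_apply]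
  refine Eq.trans ?_
    (map_sum (QuotientAddGroup.mk' (AddSubgroup.zmultiples (1 : ℝ))) _ _).symm
  refine Finset.sum_congr rfl fun i _ => ?_
  rw [← zsmul_eq_mul, map_zsmul]
  rfl

variable {r s : ℕ} {P : Fin r → Polynomial ℝ} {ν : Matrix ι ι ℤ}

/-- The values at `n` of the family `P` extended by the zero polynomial. -/
def optionValues (P : Fin r → Polynomial ℝ) (n : ℤ) : Option (Fin r) → ℤ :=
  fun m => m.elim 0 fun m => ieval (P m) n

theorem ieval_zero {p : Polynomial ℝ} (hp : p.eval 0 = 0) : ieval p 0 = 0 := by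
  simp [ieval, hp]

/-- The frequency of a character along the orbit, as a polynomial in each coordinate. -/
def frequencyPoly (P : Fin r → Polynomial ℝ) (ν : Matrix ι ι ℤ) (s : ℕ)
    (K : Option (Fin r) → ι → ℤ) (i : ι) : Polynomial ℝ :=
  C (K none i : ℝ) + ∑ l ∈ Finset.univ ×ˢ Finset.range (s + 1),
    C ((Matrix.vecMul (K (some l.1)) (ν ^ l.2) i : ℤ) : ℝ) * pbr (P l.1) l.2

theorem eval_frequencyPoly (hint : ∀ m, IsIntegralPoly (P m)) (K : Option (Fin r) → ι → ℤ)
    (i : ι) (n : ℤ) : (frequencyPoly P ν s K i).eval (n : ℝ) =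
      (((∑ m, Matrix.vecMul (K m) (binomPow ν s (optionValues P n m))) i : ℤ) : ℝ) := by
  rw [Fintype.sum_option, frequencyPoly, Finset.sum_product]
  have h0 : binomPow ν s (optionValues P n none) = 1 := binomPow_zero
  rw [h0, Matrix.vecMul_one]
  simp only [eval_add, eval_C, eval_finsetSum, eval_mul, eval_pbr_eq_choose (hint _),
    Pi.add_apply, Finset.sum_apply, Int.cast_add, Int.cast_sum]
  congr 1
  refine Finset.sum_congr rfl fun m _ => ?_
  rw [binomPow, Matrix.vecMul_sum, Finset.sum_apply, Int.cast_sum]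
  refine Finset.sum_congr rfl fun j _ => ?_
  rw [Matrix.vecMul_smul, Pi.smul_apply, smul_eq_mul, Int.cast_mul, mul_comm]
  rfl

theorem sum_eq_zero_of_frequencyPoly_eq_zero (hint : ∀ m, IsIntegralPoly (P m))
    (hz : ∀ m, (P m).eval 0 = 0) {K : Option (Fin r) → ι → ℤ}
    (hK : ∀ i, frequencyPoly P ν s K i = 0) : ∑ m, K m = 0 := by
  ext i
  have h1 := eval_frequencyPoly (ν := ν) (s := s) hint K i 0
  rw [hK i, eval_zero] at h1
  have h2 : ∀ m, optionValues P 0 m = 0 := by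
    intro m
    cases m with
    | none => rfl
    | some m => exact ieval_zero (hz m)
  simp only [h2, binomPow_zero, Matrix.vecMul_one] at h1
  exact_mod_cast h1.symm

/-- The phase of a character along the orbit. -/
def phasePoly (P : Fin r → Polynomial ℝ) (ν : Matrix ι ι ℤ) (s : ℕ) (y : ι → ℝ)
    (K : Option (Fin r) → ι → ℤ) : Polynomial ℝ :=
  ∑ j ∈ Finset.range (s + 1), ∑ m, C (powPair ν y j (K (some m))) * pbr (P m) (j + 1)

theorem eval_phasePoly (y : ι → ℝ) (K : Option (Fin r) → ι → ℤ) (x : ℝ) :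
    (phasePoly P ν s y K).eval x = ∑ j ∈ Finset.range (s + 1), ∑ m,
      powPair ν y j (K (some m)) * (pbr (P m) (j + 1)).eval x := by
  simp [phasePoly, eval_finsetSum]

theorem coe_eval_phasePoly (hint : ∀ m, IsIntegralPoly (P m)) (y : ι → ℝ)
    (K : Option (Fin r) → ι → ℤ) (n : ℤ) :
    (((phasePoly P ν s y K).eval (n : ℝ) : ℝ) : Torus) =
      ∑ m, torusPair (Matrix.vecMul (K m) (binomQuot ν s (optionValues P n m)))
        (fun i => ((y i : ℝ) : Torus)) := by
  rw [Fintype.sum_option]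
  have h0 : binomQuot ν s (optionValues P n none) = 0 := binomQuot_zero
  have h1 : torusPair (0 : ι → ℤ) (fun i => ((y i : ℝ) : Torus)) = 0 := by
    simp [torusPair_apply]
  rw [h0, Matrix.vecMul_zero, h1, zero_add, eval_phasePoly, Finset.sum_comm]
  refine (map_sum (QuotientAddGroup.mk' (AddSubgroup.zmultiples (1 : ℝ))) _ _).trans ?_
  refine Finset.sum_congr rfl fun m _ => ?_
  rw [map_sum, binomQuot, Matrix.vecMul_sum, torusPair_apply]
  simp only [Finset.sum_apply, Finset.sum_smul]
  rw [Finset.sum_comm]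
  refine Finset.sum_congr rfl fun j _ => ?_
  rw [← torusPair_apply, Matrix.vecMul_smul, eval_pbr_eq_choose (hint m)]
  have h2 : ∀ (c : ℤ) (v : ι → ℤ) (z : ι → Torus), torusPair (c • v) z = c • torusPair v z := by
    intro c v z
    simp [torusPair_apply, mul_smul, Finset.smul_sum]
  rw [h2, torusPair_vecMul_pow, mul_comm, ← zsmul_eq_mul, map_zsmul]
  rfl

theorem phasePoly_mem_WP (hν : ν ^ (s + 1) = 0) (hint : ∀ m, IsIntegralPoly (P m))
    (hz : ∀ m, (P m).eval 0 = 0) {K : Option (Fin r) → ι → ℤ}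
    (hK : ∀ i, frequencyPoly P ν s K i = 0) (y : ι → ℝ) :
    phasePoly P ν s y K ∈ WP P (s + 1) := by
  have hpow : ∀ j, s < j → ∀ v, powPair ν y j v = 0 := by
    intro j hj v
    simp [powPair_apply, pow_eq_zero_of_le hj hν]
  rw [mem_WP_succ_iff]
  refine ⟨fun j m => powPair ν y j (K (some m)), fun j hj => ?_, fun c x => ?_,
    eval_phasePoly y K⟩
  · ext m
    exact hpow j hj _
  · have h1 := map_add_sum_mul_eq_zero (Finset.univ ×ˢ Finset.range (s + 1))
      (fun l : Fin r × ℕ => (pbr (P l.1) l.2).eval x) (K none)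
      (fun l => Matrix.vecMul (K (some l.1)) (ν ^ l.2)) (fun i => by
        have := congrArg (Polynomial.eval x) (hK i)
        simpa [frequencyPoly, eval_finsetSum] using this) (powPair ν y c)
    have h2 := congrArg (powPair ν y c) (sum_eq_zero_of_frequencyPoly_eq_zero hint hz hK)
    rw [Fintype.sum_option, map_add, map_sum, map_zero] at h2
    rw [Finset.sum_product_right, Finset.sum_range_succ'] at h1
    simp only [powPair_vecMul_pow] at h1
    have h3 : ∀ m, (pbr (P m) 0).eval x = 1 := fun m => by simp [eval_pbr]
    simp only [h3, add_zero, mul_one] at h1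
    rw [Finset.sum_range_succ]
    simp only [hpow (c + 1 + s) (by omega), zero_mul, Finset.sum_const_zero, add_zero]
    simp only [add_assoc, add_comm 1] at h1 ⊢
    linarith

theorem integral_mFourier_dichotomy (hν : ν ^ (s + 1) = 0) (hint : ∀ m, IsIntegralPoly (P m))
    (hz : ∀ m, (P m).eval 0 = 0) {𝓕 : Filter ℕ} (hcof : 𝓕 ≤ cofinite)
    (hWP : ∀ q ∈ WP P (s + 1), Tendsto (fun n : ℕ => ((q.eval (n : ℝ) : ℝ) : Torus)) 𝓕 (𝓝 0))
    (a : ι → Torus) (k : Option (Fin r) × ι → ℤ) :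
    ((∀ i, ∑ m, k (m, i) = 0) ∧ Tendsto (fun n : ℕ => ∫ x, mFourier k
      (fun q => affPow ν s a (optionValues P n q.1) x q.2)) 𝓕 (𝓝 1)) ∨
    ∀ᶠ n : ℕ in 𝓕, ∫ x, mFourier k
      (fun q => affPow ν s a (optionValues P n q.1) x q.2) = 0 := by
  have hlift : ∀ i, ∃ y : ℝ, (y : Torus) = a i := fun i => QuotientAddGroup.mk_surjective (a i)
  choose y hy using hlift
  obtain rfl : (fun i => ((y i : ℝ) : Torus)) = a := funext hy
  set K : Option (Fin r) → ι → ℤ := fun m i => k (m, i) with hKdef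
  simp only [integral_mFourier_affPow]
  by_cases hK : ∀ i, frequencyPoly P ν s K i = 0
  · left
    refine ⟨fun i => ?_, ?_⟩
    · have := congrFun (sum_eq_zero_of_frequencyPoly_eq_zero hint hz hK) i
      simpa [hKdef] using this
    · have h1 : ∀ n : ℕ, ∑ m, Matrix.vecMul (K m) (binomPow ν s (optionValues P n m)) = 0 := by
        intro n
        ext i
        have := eval_frequencyPoly (ν := ν) (s := s) hint K i n
        rw [hK i, eval_zero] at this
        exact_mod_cast this.symm
      have h2 := hWP _ (phasePoly_mem_WP hν hint hz hK y)
      have h3 : Continuous fun t : Torus => (AddCircle.toCircle t : ℂ) :=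
        continuous_subtype_val.comp (AddCircle.continuous_toCircle)
      have h4 := (h3.tendsto 0).comp h2
      rw [AddCircle.toCircle_zero, Circle.coe_one] at h4
      refine h4.congr fun n => ?_
      have h5 := coe_eval_phasePoly (ν := ν) (s := s) hint y K n
      rw [Int.cast_natCast] at h5
      rw [if_pos (h1 n), one_mul, ← h5]
      rfl
  · right
    push Not at hK
    obtain ⟨i, hi⟩ := hK
    have h1 : ∀ᶠ n : ℕ in cofinite, (frequencyPoly P ν s K i).eval (n : ℝ) ≠ 0 := by
      rw [eventually_cofinite]
      simp only [not_not]
      exact (Polynomial.finite_setOfPred_isRoot hi).preimage (Nat.cast_injective.injOn)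
    filter_upwards [hcof h1] with n hn
    rw [if_neg, zero_mul]
    intro h
    have := eval_frequencyPoly (ν := ν) (s := s) hint K i n
    rw [Int.cast_natCast] at this
    refine hn (this.trans ?_)
    rw [show ∑ m, Matrix.vecMul (K m) (binomPow ν s (optionValues P n m)) = 0 from h]
    simp

end

end

noncomputable section

open Topology UnitAddTorus

theorem eq_zero_of_factorial_dvd {e : ℤ} {t : ℕ} (ht : e.natAbs < t)
    (h : (t.factorial : ℤ) ∣ e) : e = 0 :=
  Int.eq_zero_of_dvd_of_natAbs_lt_natAbs h
    (by simpa using ht.trans_le (Nat.self_le_factorial t))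

/-- A filter on `R` along which the polynomials in `P` are eventually divisible by any given
integer and all Weyl polynomials of order `s + 1` tend to zero modulo one. -/
theorem IsWeylRecurrent.exists_filter {r s : ℕ} {P : Fin r → Polynomial ℝ}
    (hint : ∀ m, IsIntegralPoly (P m)) {R : Set ℕ} (hR : IsWeylRecurrent P (s + 1) R)
    (hne : ∀ n ∈ R, ∃ m, ieval (P m) n ≠ 0) :
    ∃ 𝓕 : Filter ℕ, NeBot 𝓕 ∧ 𝓕 ≤ cofinite ∧ (∀ᶠ n in 𝓕, n ∈ R) ∧
      (∀ M : ℕ, 0 < M → ∀ᶠ n : ℕ in 𝓕, ∀ m, (M : ℤ) ∣ ieval (P m) n) ∧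
      ∀ q ∈ WP P (s + 1), Tendsto (fun n : ℕ => ((q.eval (n : ℝ) : ℝ) : Torus)) 𝓕 (𝓝 0) := by
  classical
  set V : Finset {q // q ∈ WP P (s + 1)} × ℕ → Set ℕ := fun i =>
    {n | n ∈ R ∧ (∀ m, (i.2.factorial : ℤ) ∣ ieval (P m) n) ∧
      ∀ q ∈ i.1, ‖((q.1.eval (n : ℝ) : ℝ) : Torus)‖ < 1 / ((i.2 : ℝ) + 1)} with hV
  have hanti : Antitone V := by
    rintro ⟨Q, t⟩ ⟨Q', t'⟩ ⟨hQ, ht⟩ n ⟨h1, h2, h3⟩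
    refine ⟨h1, fun m => (Int.natCast_dvd_natCast.mpr (Nat.factorial_dvd_factorial ht)).trans
      (h2 m), fun q hq => (h3 q (hQ hq)).trans_le ?_⟩
    exact one_div_le_one_div_of_le (by positivity) (by simpa using ht)
  have hVne : ∀ i, (V i).Nonempty := by
    rintro ⟨Q, t⟩
    obtain ⟨n, hn, h1, h2⟩ := hR.exists_norm_lt hint (Q.image Subtype.val) (fun q hq => by
      obtain ⟨q', -, rfl⟩ := Finset.mem_image.mp hq
      exact q'.2) (ε := 1 / ((t : ℝ) + 1)) (by positivity) (Nat.factorial_pos t)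
    exact ⟨n, hn, h1, fun q hq => h2 q (Finset.mem_image_of_mem _ hq)⟩
  have hmem : ∀ i, V i ∈ ⨅ i, 𝓟 (V i) := fun i => mem_iInf_of_mem i (mem_principal_self _)
  have hR' : ∀ᶠ n in ⨅ i, 𝓟 (V i), n ∈ R := mem_of_superset (hmem (∅, 0)) fun n hn => hn.1
  have hdvd : ∀ M : ℕ, 0 < M → ∀ᶠ n : ℕ in ⨅ i, 𝓟 (V i), ∀ m, (M : ℤ) ∣ ieval (P m) n :=
    fun M hM => mem_of_superset (hmem (∅, M)) fun n hn m =>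
      (Int.natCast_dvd_natCast.mpr (Nat.dvd_factorial hM le_rfl)).trans (hn.2.1 m)
  refine ⟨⨅ i, 𝓟 (V i), ?_, ?_, hR', hdvd, fun q hq => ?_⟩
  · refine iInf_neBot_of_directed' ?_ fun i => principal_neBot_iff.mpr (hVne i)
    exact Antitone.directed_ge fun i j hij => principal_mono.mpr (hanti hij)
  · rw [le_cofinite_iff_eventually_ne]
    intro n₀
    by_cases hn₀ : n₀ ∈ R
    · obtain ⟨m, hm⟩ := hne n₀ hn₀
      refine mem_of_superset (hmem (∅, (ieval (P m) n₀).natAbs + 1)) ?_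
      rintro n hn rfl
      exact hm (eq_zero_of_factorial_dvd (Nat.lt_succ_self _) (hn.2.1 m))
    · filter_upwards [hR'] with n hn h
      exact hn₀ (h ▸ hn)
  · rw [tendsto_zero_iff_norm_tendsto_zero, Metric.tendsto_nhds]
    intro ε hε
    obtain ⟨t, ht⟩ := exists_nat_one_div_lt hε
    refine mem_of_superset (hmem ({⟨q, hq⟩}, t)) fun n hn => ?_
    have := (hn.2.2 ⟨q, hq⟩ (Finset.mem_singleton_self _)).trans ht
    simpa using this

theorem IsWeylRecurrent.succ {r s : ℕ} {P : Fin r → Polynomial ℝ}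
    (hint : ∀ m, IsIntegralPoly (P m)) (hz : ∀ m, (P m).eval 0 = 0)
    (hstab : WP P (s + 1 + 1) = WP P (s + 1)) {R : Set ℕ}
    (hR : IsWeylRecurrent P (s + 1) R) : IsWeylRecurrent P (s + 1 + 1) R := by
  intro N F _ _ _ _ _ _ a U A hsys hA S hS hpos
  by_cases hne : ∃ n ∈ R, ∀ m, ieval (P m) n = 0
  · obtain ⟨n, hn, h0⟩ := hne
    refine ⟨n, hn, ?_⟩
    convert hpos using 2
    simp [h0]
  · push Not at hne
    obtain ⟨𝓕, hbot, hcof, hmem, hdvd, hWP⟩ := hR.exists_filter hint hne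
    obtain ⟨f, hf⟩ := (weylMeasure_pos_iff hS).mp hpos
    obtain ⟨M, b, hM, hb⟩ := exists_weylT_zpow_eq_affPow a U A hsys.2.2.1 hA f
    have hSf : MeasurableSet {x | (x, f) ∈ S} := measurable_prodMk_right hS
    have hev := eventually_volume_iInter_preimage_pos (𝓕 := 𝓕)
      (fun n m => affPow (A - 1) (s + 1) b (optionValues P n m))
      (fun n m => measurePreserving_affPow hA b _)
      (fun k => integral_mFourier_dichotomy hA hint hz hcof (fun q hq => hWP q (hstab ▸ hq)) b k)
      hSf hf
    obtain ⟨n, ⟨hn, hdn⟩, hnR⟩ := ((hev.and (hdvd M hM)).and hmem).exists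
    refine ⟨n, hnR, ?_⟩
    set B := ⋂ m, affPow (A - 1) (s + 1) b (optionValues P n m) ⁻¹' {x | (x, f) ∈ S} with hB
    have hBm : MeasurableSet B := MeasurableSet.iInter fun m =>
      (measurePreserving_affPow hA b _).measurable hSf
    have hBf : MeasurableSet (B ×ˢ ({f} : Set F)) := hBm.prod (measurableSet_singleton f)
    refine ((weylMeasure_pos_iff hBf).mpr ⟨f, ?_⟩).trans_le (measure_mono ?_)
    · rwa [show {x | (x, f) ∈ B ×ˢ ({f} : Set F)} = B from Set.ext fun x => and_iff_left rfl]
    · rintro ⟨x, g⟩ ⟨hx, rfl : g = f⟩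
      have hx' := Set.mem_iInter.mp hx
      refine ⟨?_, Set.mem_iInter.mpr fun m => ?_⟩
      · have h0 := hx' none
        rw [Set.mem_preimage, show optionValues P n none = 0 from rfl, affPow_zero] at h0
        exact h0
      · rw [Set.mem_preimage, hb _ x (hdn m)]
        exact hx' (some m)

end

noncomputable section

/-- If `s` is at least the Weyl complexity of `P` (in the sense that the Weyl
polynomials have stabilized at step `s`), then `P`-measurable recurrence for `s`-step
Weyl systems implies `P`-measurable recurrence for `(s+1)`-step Weyl systems. -/
theorem stmt16 (r s : ℕ) (hr : 1 ≤ r) (hs : 1 ≤ s)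
    (P : Fin r → Polynomial ℝ)
    (hint : ∀ k, IsIntegralPoly (P k)) (hz : ∀ k, (P k).eval 0 = 0)
    (hstab : ∀ i : ℕ, s ≤ i → WP P i = WP P s)
    (R : Set ℕ)
    (hrec : ∀ (N : ℕ) (F : Type) [AddCommGroup F] [Fintype F]
      [TopologicalSpace F] [DiscreteTopology F]
      [MeasurableSpace F] [MeasurableSingletonClass F]
      (a : (Fin N → Torus) × F)
      (U : ((Fin N → Torus) × F) ≃+ ((Fin N → Torus) × F))
      (A : Matrix (Fin N) (Fin N) ℤ), IsWeylSystemWith a U A →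
      (A - 1) ^ s = 0 →
      ∀ S : Set ((Fin N → Torus) × F), MeasurableSet S → 0 < weylMeasure N F S →
        ∃ n ∈ R, 0 < weylMeasure N F
          (S ∩ ⋂ k : Fin r, (weylT a U ^ (ieval (P k) (n : ℤ))) ⁻¹' S)) :
    ∀ (N : ℕ) (F : Type) [AddCommGroup F] [Fintype F]
      [TopologicalSpace F] [DiscreteTopology F]
      [MeasurableSpace F] [MeasurableSingletonClass F]
      (a : (Fin N → Torus) × F)
      (U : ((Fin N → Torus) × F) ≃+ ((Fin N → Torus) × F))
      (A : Matrix (Fin N) (Fin N) ℤ), IsWeylSystemWith a U A →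
      (A - 1) ^ (s + 1) = 0 →
      ∀ S : Set ((Fin N → Torus) × F), MeasurableSet S → 0 < weylMeasure N F S →
        ∃ n ∈ R, 0 < weylMeasure N F
          (S ∩ ⋂ k : Fin r, (weylT a U ^ (ieval (P k) (n : ℤ))) ⁻¹' S) := by
  obtain ⟨s, rfl⟩ := Nat.exists_eq_add_of_le' hs
  exact IsWeylRecurrent.succ hint hz (hstab _ (Nat.le_succ _)) hrec

end
end

section
/- Every R ⊆ ℕ that is a set of {n, 2n}-measurable recurrence for every Weyl system (i.e., for every Weyl system (X,μ,T) and every Borel A ⊆ X with μ(A) > 0 there exists n ∈ R with μ(A ∩ T^{−n}A ∩ T^{−2n}A) > 0) is also a set of {n²}-measurable recurrence for every Weyl system (i.e., for every Weyl system (X,μ,T) and every Borel A ⊆ X with μ(A) > 0 there exists n ∈ R with μ(A ∩ T^{−n²}A) > 0). -/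
open MeasureTheory Polynomial

noncomputable section

namespace WeylRecurrence

open Filter

section Hilbert

variable {ι H : Type*} [NormedAddCommGroup H] [InnerProductSpace ℂ H]

/-- If a sequence of isometries acts monomially on a Hilbert basis, then the self-correlations of a
vector with nonzero component along a fixed basis vector are eventually nonzero, provided that
finitely many eigenvalues have nonnegative real part. -/
theorem exists_forall_inner_ne_zero (e : HilbertBasis ι ℂ H) (W : ℕ → H →ₗᵢ[ℂ] H)
    (φ : ℕ → ι → ι) (c : ℕ → ι → ℂ) (hW : ∀ j k, W j (e k) = c j k • e (φ j k))
    (Λ : Set ι) (hΛ : ∀ k ∈ Λ, ∀ j, φ j k = k)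
    (hΛc : ∀ k ∉ Λ, ∀ l, ∀ᶠ j in atTop, φ j k ≠ l)
    (k₀ : ι) (hk₀ : k₀ ∈ Λ) (hc₀ : ∀ j, c j k₀ = 1) (f : H) (hf : inner ℂ (e k₀) f ≠ 0) :
    ∃ (K : Finset ι) (J : ℕ), ∀ j ≥ J, (∀ k ∈ K, k ∈ Λ → 0 ≤ (c j k).re) →
      inner ℂ f (W j f) ≠ 0 := by
  classical
  set v : ℝ := ‖inner ℂ (e k₀) f‖ ^ 2 with hv
  have hvpos : 0 < v := by positivity
  set ε : ℝ := min 1 (v / (4 * (‖f‖ + 1))) with hε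
  have hεpos : 0 < ε := by positivity
  have hε1 : ε ≤ 1 := min_le_left _ _
  have hε2 : ε * (4 * (‖f‖ + 1)) ≤ v := by
    have : ε ≤ v / (4 * (‖f‖ + 1)) := min_le_right _ _
    rwa [le_div_iff₀ (by positivity)] at this
  have hrepr : HasSum (fun k => inner ℂ (e k) f • e k) f := by
    simpa only [e.repr_apply_apply] using e.hasSum_repr f
  have hsum : Tendsto (fun K : Finset ι => ∑ k ∈ K, inner ℂ (e k) f • e k) atTop (nhds f) := hrepr
  obtain ⟨K, hKε, hK₀⟩ := ((Metric.tendsto_nhds.1 hsum ε hεpos).and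
    (eventually_ge_atTop ({k₀} : Finset ι))).exists
  have hK₀ : k₀ ∈ K := by simpa using hK₀
  have hev : ∀ᶠ j in atTop, ∀ k ∈ K, k ∉ Λ → ∀ l ∈ K, φ j k ≠ l := by
    rw [eventually_all_finset]
    intro k _
    by_cases hk : k ∈ Λ
    · exact Eventually.of_forall fun j h => absurd hk h
    · have : ∀ᶠ j in atTop, ∀ l ∈ K, φ j k ≠ l := by
        rw [eventually_all_finset]
        exact fun l _ => hΛc k hk l
      exact this.mono fun j hj _ => hj
  obtain ⟨J, hJ⟩ := eventually_atTop.1 hev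
  refine ⟨K, J, fun j hj hre => ?_⟩
  set p : H := ∑ k ∈ K, inner ℂ (e k) f • e k with hp
  have hfp : ‖f - p‖ < ε := by rwa [dist_comm, dist_eq_norm] at hKε
  have hpn : ‖p‖ ≤ ‖f‖ + 1 := by
    calc ‖p‖ = ‖f - (f - p)‖ := by congr 1; abel
      _ ≤ ‖f‖ + ‖f - p‖ := norm_sub_le _ _
      _ ≤ _ := by linarith
  have horth := orthonormal_iff_ite.1 e.orthonormal
  have hWp : inner ℂ p (W j p) =
      ∑ k ∈ K, if k ∈ Λ then (‖inner ℂ (e k) f‖ ^ 2 : ℝ) * c j k else 0 := by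
    conv_lhs => rw [hp]
    simp only [map_sum, map_smul, hW, sum_inner, inner_sum, inner_smul_left, inner_smul_right,
      horth]
    refine Finset.sum_congr rfl fun k hk => ?_
    split_ifs with h
    · rw [Finset.sum_eq_single k]
      · rw [hΛ k h, if_pos rfl, mul_one, Complex.ofReal_pow, ← Complex.conj_mul']
        ring
      · intro l _ hl
        rw [hΛ k h, if_neg hl]; simp
      · exact fun h => absurd hk h
    · rw [Finset.sum_eq_zero fun l hl => ?_]
      · simp
      rw [if_neg (fun h' => hJ j hj k hk h l hl h'.symm)]; simp
  have hmain : v ≤ (inner ℂ p (W j p)).re := by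
    rw [hWp, Complex.re_sum]
    have hnn : ∀ k ∈ K,
        0 ≤ (if k ∈ Λ then ((‖inner ℂ (e k) f‖ ^ 2 : ℝ) : ℂ) * c j k else 0).re := by
      intro k hk
      split_ifs with h
      · rw [Complex.re_ofReal_mul]
        exact mul_nonneg (by positivity) (hre k hk h)
      · simp
    refine le_trans (le_of_eq ?_) (Finset.single_le_sum hnn hK₀)
    rw [if_pos hk₀, hc₀, mul_one, Complex.ofReal_re, hv]
  intro h0
  have hdecomp : inner ℂ p (W j p) =
      inner ℂ f (W j f) - inner ℂ f (W j (f - p)) - inner ℂ (f - p) (W j p) := by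
    simp only [map_sub, inner_sub_left, inner_sub_right]; ring
  have h1 : ‖inner ℂ f (W j (f - p))‖ ≤ ‖f‖ * ε := by
    refine (norm_inner_le_norm _ _).trans ?_
    rw [LinearIsometry.norm_map]
    gcongr
  have h2 : ‖inner ℂ (f - p) (W j p)‖ ≤ ε * (‖f‖ + 1) := by
    refine (norm_inner_le_norm _ _).trans ?_
    rw [LinearIsometry.norm_map]
    gcongr
  have h3 : v ≤ ‖inner ℂ f (W j (f - p))‖ + ‖inner ℂ (f - p) (W j p)‖ := by
    rw [h0, zero_sub] at hdecomp
    calc v ≤ (inner ℂ p (W j p)).re := hmain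
      _ ≤ ‖inner ℂ p (W j p)‖ := Complex.re_le_norm _
      _ ≤ _ := by rw [hdecomp]; exact (norm_sub_le _ _).trans (by rw [norm_neg])
  nlinarith [norm_nonneg f]

/-- A vector invariant under isometries acting monomially on an orthonormal family has no component
along basis vectors with an injective orbit. -/
theorem inner_eq_zero_of_forall_apply_eq {e : ι → H} (he : Orthonormal ℂ e)
    (W : ℕ → H →ₗᵢ[ℂ] H) (φ : ℕ → ι) (c : ℕ → ℂ) (k : ι)
    (hW : ∀ j, W j (e k) = c j • e (φ j)) (hc : ∀ j, ‖c j‖ = 1) (hφ : φ.Injective)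
    (f : H) (hf : ∀ j, W j f = f) : inner ℂ (e k) f = 0 := by
  have hnorm : ∀ j, ‖inner ℂ (e (φ j)) f‖ = ‖inner ℂ (e k) f‖ := by
    intro j
    rw [← (W j).inner_map_map (e k), hf j, hW j, inner_smul_left, norm_mul, RCLike.norm_conj,
      hc, one_mul]
  have hs := (he.comp φ hφ).inner_products_summable f
  have h0 := hs.tendsto_atTop_zero
  simp only [Function.comp_apply, hnorm] at h0
  have := tendsto_nhds_unique h0 tendsto_const_nhds
  simpa using this.symm

end Hilbert

section Lattice

variable {N : ℕ}

open Matrix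

/-- The integer row orbits of a unipotent matrix are either constant or injective. -/
theorem injective_vecMul_pow {M : Matrix (Fin N) (Fin N) ℤ} (hM : IsNilpotent (M - 1))
    {k : Fin N → ℤ} (hk : k ᵥ* M ≠ k) : Function.Injective fun j : ℕ => k ᵥ* M ^ j := by
  have hunit : IsUnit M := by
    simpa using hM.isUnit_add_one
  have key : ∀ s : ℕ, s ≠ 0 → k ᵥ* M ^ s ≠ k := by
    intro s hs h
    apply hk
    set v := k ᵥ* (M - 1) with hv
    have hvP : v ᵥ* (∑ i ∈ Finset.range s, M ^ i) = 0 := by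
      rw [hv, vecMul_vecMul, mul_geom_sum, vecMul_sub, h, vecMul_one, sub_self]
    suffices hv0 : v = 0 by
      rw [hv, vecMul_sub, vecMul_one, sub_eq_zero] at hv0
      exact hv0
    obtain ⟨n, hn⟩ := hM
    have hdesc : ∀ n, v ᵥ* (M - 1) ^ n = 0 → v = 0 := by
      intro n
      induction n with
      | zero => intro h; simpa using h
      | succ n ih =>
        intro hn
        apply ih
        set w := v ᵥ* (M - 1) ^ n with hw
        have hwM : w ᵥ* M = w := by
          rw [pow_succ, ← vecMul_vecMul, vecMul_sub, vecMul_one, sub_eq_zero] at hn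
          exact hn
        have hwpow : ∀ i, w ᵥ* M ^ i = w := by
          intro i
          induction i with
          | zero => simp
          | succ i ih => rw [pow_succ, ← vecMul_vecMul, ih, hwM]
        have hcomm : Commute ((M - 1) ^ n) (∑ i ∈ Finset.range s, M ^ i) := by
          refine Commute.sum_right _ _ _ fun i _ => ?_
          exact (((Commute.refl M).sub_left (Commute.one_left M)).pow_pow n i)
        have hws : w ᵥ* (∑ i ∈ Finset.range s, M ^ i) = 0 := by
          rw [hw, vecMul_vecMul, hcomm.eq, ← vecMul_vecMul, hvP, zero_vecMul]
        rw [vecMul_sum] at hws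
        simp only [hwpow, Finset.sum_const, Finset.card_range] at hws
        exact (smul_eq_zero.1 hws).resolve_left hs
    exact hdesc n (by rw [hn, vecMul_zero])
  intro i j hij
  wlog hlt : i ≤ j generalizing i j
  · exact (this hij.symm (le_of_not_ge hlt)).symm
  obtain ⟨s, rfl⟩ := Nat.exists_eq_add_of_le hlt
  by_contra hne
  have hs : s ≠ 0 := by rintro rfl; simp at hne
  apply key s hs
  have hinj := Matrix.vecMul_injective_of_isUnit (hunit.pow i)
  apply hinj
  simp only at hij ⊢
  rw [vecMul_vecMul, ← pow_add, add_comm s i]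
  exact hij.symm

theorem isNilpotent_pow_sub_one {M : Matrix (Fin N) (Fin N) ℤ} (hM : IsNilpotent (M - 1)) (q : ℕ) :
    IsNilpotent (M ^ q - 1) := by
  rw [← mul_geom_sum]
  refine Commute.isNilpotent_mul_right ?_ hM
  exact Commute.sum_right _ _ _ fun i _ =>
    (((Commute.refl M).sub_left (Commute.one_left M)).pow_right i)

end Lattice
section Torus

variable {N : ℕ}

open Matrix UnitAddTorus

/-- The endomorphism of the torus given by an integer matrix. -/
def matAct (M : Matrix (Fin N) (Fin N) ℤ) : (Fin N → Torus) →+ (Fin N → Torus) where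
  toFun x := fun j => ∑ i, M j i • x i
  map_zero' := by ext; simp
  map_add' x y := by ext; simp [Finset.sum_add_distrib]

theorem matAct_apply (M : Matrix (Fin N) (Fin N) ℤ) (x : Fin N → Torus) (j : Fin N) :
    matAct M x j = ∑ i, M j i • x i := rfl

theorem matAct_one (x : Fin N → Torus) : matAct 1 x = x := by
  ext j
  simp [matAct_apply, Matrix.one_apply]

theorem matAct_mul (M M' : Matrix (Fin N) (Fin N) ℤ) (x : Fin N → Torus) :
    matAct (M * M') x = matAct M (matAct M' x) := by
  ext j
  simp only [matAct_apply, Matrix.mul_apply, Finset.sum_smul, Finset.smul_sum, mul_smul]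
  exact Finset.sum_comm

theorem continuous_matAct (M : Matrix (Fin N) (Fin N) ℤ) : Continuous (matAct M) := by
  refine continuous_pi fun j => ?_
  simp only [matAct_apply]
  fun_prop

theorem surjective_matAct {M : Matrix (Fin N) (Fin N) ℤ} (hM : IsUnit M) :
    Function.Surjective (matAct M) := by
  obtain ⟨u, rfl⟩ := hM
  exact fun y => ⟨matAct (↑u⁻¹ : Matrix (Fin N) (Fin N) ℤ) y, by
    rw [← matAct_mul, Units.mul_inv, matAct_one]⟩

/-- The pairing of the torus with its dual lattice. -/
def latticePair (k : Fin N → ℤ) : (Fin N → Torus) →+ Torus where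
  toFun x := ∑ i, k i • x i
  map_zero' := by simp
  map_add' x y := by simp [Finset.sum_add_distrib]

theorem latticePair_apply (k : Fin N → ℤ) (x : Fin N → Torus) :
    latticePair k x = ∑ i, k i • x i := rfl

theorem latticePair_matAct (k : Fin N → ℤ) (M : Matrix (Fin N) (Fin N) ℤ) (x : Fin N → Torus) :
    latticePair k (matAct M x) = latticePair (k ᵥ* M) x := by
  simp only [latticePair_apply, matAct_apply, vecMul, dotProduct, Finset.sum_smul,
    Finset.smul_sum, mul_smul]
  exact Finset.sum_comm

theorem mFourier_eq_toCircle (k : Fin N → ℤ) (x : Fin N → Torus) :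
    mFourier k x = (AddCircle.toCircle (latticePair k x) : ℂ) := by
  simp only [mFourier, ContinuousMap.coe_mk, fourier_apply, latticePair_apply]
  induction (Finset.univ : Finset (Fin N)) using Finset.cons_induction with
  | empty => simp
  | cons i s hi ih =>
    rw [Finset.prod_cons, Finset.sum_cons, AddCircle.toCircle_add, Circle.coe_mul, ih]

/-- The affine self-map of the torus with linear part `M` and translation `b`. -/
def affMap (M : Matrix (Fin N) (Fin N) ℤ) (b : Fin N → Torus) (x : Fin N → Torus) :
    Fin N → Torus :=
  matAct M x + b

theorem affMap_iterate (M : Matrix (Fin N) (Fin N) ℤ) (b : Fin N → Torus) (j : ℕ)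
    (x : Fin N → Torus) : (affMap M b)^[j] x = matAct (M ^ j) x + (affMap M b)^[j] 0 := by
  induction j with
  | zero => simp [matAct_one]
  | succ j ih =>
    rw [Function.iterate_succ_apply', Function.iterate_succ_apply', ih, affMap, affMap, map_add,
      pow_succ', matAct_mul, add_assoc]

theorem latticePair_affMap_iterate {M : Matrix (Fin N) (Fin N) ℤ} {k : Fin N → ℤ}
    (hk : k ᵥ* M = k) (b : Fin N → Torus) (j : ℕ) :
    latticePair k ((affMap M b)^[j] 0) = j • latticePair k b := by
  induction j with
  | zero => simp
  | succ j ih =>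
    rw [Function.iterate_succ_apply', affMap, map_add, latticePair_matAct, hk, ih, succ_nsmul]

theorem measurePreserving_affMap {M : Matrix (Fin N) (Fin N) ℤ} (hM : IsUnit M)
    (b : Fin N → Torus) : MeasurePreserving (affMap M b) volume volume :=
  (measurePreserving_add_right volume b).comp
    (AddMonoidHom.measurePreserving (continuous_matAct M) (surjective_matAct hM) rfl)

theorem volume_torus_eq (N : ℕ) : (volume : Measure (Fin N → Torus)) =
    Measure.pi fun _ => AddCircle.haarAddCircle := by
  rw [volume_pi, AddCircle.volume_eq_smul_haarAddCircle]
  simp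

theorem exists_hilbertBasis_of_eq (μ : Measure (Fin N → Torus)) [IsFiniteMeasure μ]
    (hμ : μ = Measure.pi fun _ => AddCircle.haarAddCircle) :
    ∃ e : HilbertBasis (Fin N → ℤ) ℂ (Lp ℂ 2 μ),
      ∀ k, e k = ContinuousMap.toLp (E := ℂ) 2 μ ℂ (mFourier k) := by
  subst hμ
  exact ⟨mFourierBasis, fun k => by rw [coe_mFourierBasis]; rfl⟩

/-- The characters form a Hilbert basis of `L²` of the torus. -/
theorem exists_hilbertBasis_mFourier (N : ℕ) :
    ∃ e : HilbertBasis (Fin N → ℤ) ℂ (Lp ℂ 2 (volume : Measure (Fin N → Torus))),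
      ∀ k, e k = ContinuousMap.toLp (E := ℂ) 2 volume ℂ (mFourier k) :=
  exists_hilbertBasis_of_eq _ (volume_torus_eq N)

theorem compMeasurePreserving_mFourier {M : Matrix (Fin N) (Fin N) ℤ} {b : Fin N → Torus}
    (j : ℕ) (h : MeasurePreserving (affMap M b)^[j] volume volume) (k : Fin N → ℤ) :
    Lp.compMeasurePreservingₗᵢ ℂ (affMap M b)^[j] h
      (ContinuousMap.toLp (E := ℂ) 2 volume ℂ (mFourier k)) =
    mFourier k ((affMap M b)^[j] 0) •
      ContinuousMap.toLp (E := ℂ) 2 volume ℂ (mFourier (k ᵥ* M ^ j)) := by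
  rw [← map_smul]
  refine Lp.ext ?_
  refine (Lp.coeFn_compMeasurePreserving _ h).trans ?_
  refine (h.quasiMeasurePreserving.ae_eq_comp (ContinuousMap.coeFn_toLp volume _)).trans ?_
  refine EventuallyEq.trans (Eventually.of_forall fun x => ?_)
    (ContinuousMap.coeFn_toLp volume _).symm
  simp only [Function.comp_apply, ContinuousMap.coe_smul, Pi.smul_apply, smul_eq_mul]
  rw [affMap_iterate, mFourier_eq_toCircle, mFourier_eq_toCircle, mFourier_eq_toCircle, map_add,
    latticePair_matAct, AddCircle.toCircle_add, Circle.coe_mul, mul_comm]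

/-- Single recurrence of unipotent affine maps of the torus is controlled by finitely many
eigenvalues. -/
theorem exists_forall_volume_inter_pos {M : Matrix (Fin N) (Fin N) ℤ} (hM : IsNilpotent (M - 1))
    (b : Fin N → Torus) {E : Set (Fin N → Torus)} (hE : MeasurableSet E) (hE₀ : 0 < volume E) :
    ∃ (K : Finset (Fin N → ℤ)) (J : ℕ), ∀ j ≥ J,
      (∀ k ∈ K, 0 ≤ (AddCircle.toCircle (j • latticePair k b) : ℂ).re) →
      0 < volume (E ∩ (affMap M b)^[j] ⁻¹' E) := by
  have hunit : IsUnit M := by simpa using hM.isUnit_add_one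
  have hmp := measurePreserving_affMap hunit b
  obtain ⟨e, he⟩ := exists_hilbertBasis_mFourier N
  set f := indicatorConstLp (μ := volume) 2 hE (measure_ne_top _ _) (1 : ℂ) with hf
  have hfe : inner ℂ (e 0) f ≠ 0 := by
    have h0 : e 0 = indicatorConstLp (μ := volume) 2 MeasurableSet.univ (measure_ne_top _ _)
        (1 : ℂ) := by
      rw [he, mFourier_zero]
      refine Lp.ext ?_
      refine (ContinuousMap.coeFn_toLp volume _).trans ?_
      refine EventuallyEq.trans (Eventually.of_forall fun x => ?_) indicatorConstLp_coeFn.symm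
      simp
    rw [h0, hf, L2.inner_indicatorConstLp_one_indicatorConstLp_one, Set.univ_inter]
    simpa [measureReal_def, ENNReal.toReal_eq_zero_iff] using hE₀.ne'
  obtain ⟨K, J, hKJ⟩ := exists_forall_inner_ne_zero e
    (fun j => Lp.compMeasurePreservingₗᵢ ℂ (affMap M b)^[j] (hmp.iterate j))
    (fun j k => k ᵥ* M ^ j) (fun j k => mFourier k ((affMap M b)^[j] 0))
    (fun j k => by rw [he, he]; exact compMeasurePreserving_mFourier j (hmp.iterate j) k)
    {k | k ᵥ* M = k}
    (fun k (hk : k ᵥ* M = k) j => by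
      induction j with
      | zero => simp
      | succ j ih => rw [pow_succ, ← vecMul_vecMul, ih, hk])
    (fun k (hk : k ᵥ* M ≠ k) l => by
      have hfin : {j : ℕ | k ᵥ* M ^ j = l}.Finite :=
        Set.Subsingleton.finite fun i hi j hj =>
          injective_vecMul_pow hM hk (Eq.trans hi (Eq.symm hj))
      rw [← Nat.cofinite_eq_atTop]
      exact hfin.eventually_cofinite_notMem)
    0 (by simp) (fun j => by simp [mFourier_zero]) f hfe
  refine ⟨K, J, fun j hj hK => pos_iff_ne_zero.2 fun h0 => hKJ j hj (fun k hk hkM => ?_) ?_⟩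
  · rw [mFourier_eq_toCircle, latticePair_affMap_iterate hkM]
    exact hK k hk
  · rw [hf]
    change inner ℂ _ (Lp.compMeasurePreserving _ (hmp.iterate j) _) = _
    rw [Lp.indicatorConstLp_compMeasurePreserving,
      L2.inner_indicatorConstLp_one_indicatorConstLp_one]
    simp [measureReal_def, h0]

/-- Ergodicity of the powers of a unipotent affine map of the torus whose translation is
independent of the invariant characters. -/
theorem eventuallyConst_of_preimage_iterate_eq {M : Matrix (Fin N) (Fin N) ℤ}
    (hM : IsNilpotent (M - 1)) (b : Fin N → Torus) {Q : ℕ} (hQ : Q ≠ 0)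
    (hb : ∀ k : Fin N → ℤ, k ᵥ* M = k → Q • latticePair k b = 0 → k = 0)
    {E : Set (Fin N → Torus)} (hE : MeasurableSet E) (hEinv : (affMap M b)^[Q] ⁻¹' E = E) :
    volume E = 0 ∨ volume Eᶜ = 0 := by
  have hunit : IsUnit M := by simpa using hM.isUnit_add_one
  have hmp := measurePreserving_affMap hunit b
  obtain ⟨e, he⟩ := exists_hilbertBasis_mFourier N
  set f := indicatorConstLp (μ := volume) 2 hE (measure_ne_top _ _) (1 : ℂ) with hf
  set W := fun j : ℕ => Lp.compMeasurePreservingₗᵢ (p := 2) (E := ℂ) ℂ (affMap M b)^[Q * j]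
    (hmp.iterate (Q * j)) with hWdef
  have hpre : ∀ j, (affMap M b)^[Q * j] ⁻¹' E = E := by
    intro j
    rw [Function.iterate_mul]
    induction j with
    | zero => rfl
    | succ j ih => rw [Function.iterate_succ, Set.preimage_comp, ih, hEinv]
  have hWf : ∀ j, W j f = f := by
    intro j
    change Lp.compMeasurePreserving _ (hmp.iterate (Q * j)) _ = _
    rw [hf, Lp.indicatorConstLp_compMeasurePreserving]
    simp only [hpre]
  have hWe : ∀ j k, W j (e k) = mFourier k ((affMap M b)^[Q * j] 0) • e (k ᵥ* M ^ (Q * j)) := by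
    intro j k
    rw [he, he]
    exact compMeasurePreserving_mFourier (Q * j) (hmp.iterate (Q * j)) k
  have hcoef : ∀ k, k ≠ 0 → inner ℂ (e k) f = 0 := by
    intro k hk0
    by_cases hk : k ᵥ* M = k
    · have hkQ : k ᵥ* M ^ Q = k := by
        clear * - hk
        induction Q with
        | zero => simp
        | succ j ih => rw [pow_succ, ← vecMul_vecMul, ih, hk]
      have h1 := hWe 1 k
      rw [mul_one, mFourier_eq_toCircle, latticePair_affMap_iterate hk, hkQ] at h1
      have h2 : inner ℂ (W 1 (e k)) (W 1 f) = inner ℂ (e k) f := (W 1).inner_map_map _ _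
      rw [h1, hWf, inner_smul_left] at h2
      by_contra hne
      have h3 := mul_right_cancel₀ hne (h2.trans (one_mul _).symm)
      have h4 : AddCircle.toCircle (Q • latticePair k b) = 1 := by
        apply Circle.ext
        have := congrArg (starRingEnd ℂ) h3
        simpa using this
      refine hk0 (hb k hk ?_)
      rw [← AddCircle.toCircle_zero] at h4
      exact AddCircle.injective_toCircle one_ne_zero h4
    · refine inner_eq_zero_of_forall_apply_eq e.orthonormal W (fun j => k ᵥ* M ^ (Q * j))
        (fun j => mFourier k ((affMap M b)^[Q * j] 0)) k (fun j => hWe j k)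
        (fun j => by rw [mFourier_eq_toCircle]; exact Circle.norm_coe _) ?_ f hWf
      exact (injective_vecMul_pow hM hk).comp (mul_right_injective₀ hQ)
  have hrepr : HasSum (fun k => inner ℂ (e k) f • e k) f := by
    simpa only [e.repr_apply_apply] using e.hasSum_repr f
  have hfc : f = inner ℂ (e 0) f • e 0 :=
    hrepr.unique (hasSum_single 0 fun k hk => by rw [hcoef k hk, zero_smul])
  set c := inner ℂ (e 0) f
  have hae : ∀ᵐ x ∂(volume : Measure (Fin N → Torus)), E.indicator (fun _ => (1 : ℂ)) x = c := by
    have h1 : (f : (Fin N → Torus) → ℂ) =ᵐ[volume] E.indicator fun _ => (1 : ℂ) :=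
      indicatorConstLp_coeFn
    have h2 : (f : (Fin N → Torus) → ℂ) =ᵐ[volume] fun _ => c := by
      rw [hfc, he, mFourier_zero, ← map_smul]
      refine (ContinuousMap.coeFn_toLp volume _).trans (Eventually.of_forall fun x => ?_)
      simp
    filter_upwards [h1, h2] with x hx1 hx2
    rw [← hx1, hx2]
  by_cases hc : c = 0
  · left
    refine measure_mono_null ?_ (ae_iff.1 hae)
    intro x hx
    simp [hx, hc]
  · right
    refine measure_mono_null ?_ (ae_iff.1 hae)
    intro x hx
    have : x ∉ E := hx
    simp [this, Ne.symm hc]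

end Torus
section Product

variable {N : ℕ} {F : Type}

theorem weylMeasure_apply [Fintype F] [MeasurableSpace F] [MeasurableSingletonClass F]
    {S : Set ((Fin N → Torus) × F)} (hS : MeasurableSet S) :
    weylMeasure N F S = (Fintype.card F : ENNReal)⁻¹ * ∑ f, volume {z | (z, f) ∈ S} := by
  rw [weylMeasure, Measure.prod_apply_symm hS, lintegral_smul_measure, lintegral_count,
    tsum_fintype, smul_eq_mul]
  rfl

theorem measurableSet_fiber [MeasurableSpace F] {S : Set ((Fin N → Torus) × F)}
    (hS : MeasurableSet S) (f : F) : MeasurableSet {z | (z, f) ∈ S} :=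
  hS.preimage (measurable_id.prodMk measurable_const)

theorem weylMeasure_pos_iff [Fintype F] [MeasurableSpace F] [MeasurableSingletonClass F]
    {S : Set ((Fin N → Torus) × F)} (hS : MeasurableSet S) :
    0 < weylMeasure N F S ↔ ∃ f, 0 < volume {z | (z, f) ∈ S} := by
  simp [weylMeasure_apply hS, pos_iff_ne_zero]

/-- The product of an integer automorphism of the torus with the identity of a finite group. -/
def torusProdEquiv (M : (Matrix (Fin N) (Fin N) ℤ)ˣ) (F : Type) [AddCommGroup F] :
    ((Fin N → Torus) × F) ≃+ ((Fin N → Torus) × F) where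
  toFun x := (matAct (M : Matrix (Fin N) (Fin N) ℤ) x.1, x.2)
  invFun x := (matAct (↑M⁻¹ : Matrix (Fin N) (Fin N) ℤ) x.1, x.2)
  left_inv x := by simp [← matAct_mul, matAct_one]
  right_inv x := by simp [← matAct_mul, matAct_one]
  map_add' x y := by simp

theorem weylT_torusProdEquiv [AddCommGroup F] (M : (Matrix (Fin N) (Fin N) ℤ)ˣ) (b : Fin N → Torus)
    (g : F) (z : Fin N → Torus) (f : F) :
    weylT (b, g) (torusProdEquiv M F) (z, f) = (affMap M b z, f + g) := by
  change (b, g) + (matAct (M : Matrix (Fin N) (Fin N) ℤ) z, f) = _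
  rw [Prod.mk_add_mk, affMap, add_comm b, add_comm g]

theorem measurePreserving_weylT_torusProdEquiv [AddCommGroup F] [Fintype F] [MeasurableSpace F]
    [MeasurableSingletonClass F] (M : (Matrix (Fin N) (Fin N) ℤ)ˣ) (b : Fin N → Torus) (g : F) :
    MeasurePreserving (weylT (b, g) (torusProdEquiv M F)) (weylMeasure N F)
      (weylMeasure N F) := by
  have hmp := measurePreserving_affMap M.isUnit b
  have hmeas : Measurable (weylT (b, g) (torusProdEquiv M F)) := by
    have : ⇑(weylT (b, g) (torusProdEquiv M F)) =
        fun x => (affMap (M : Matrix (Fin N) (Fin N) ℤ) b x.1, x.2 + g) :=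
      funext fun x => weylT_torusProdEquiv M b g x.1 x.2
    rw [this]
    exact (hmp.measurable.comp measurable_fst).prodMk
      ((measurable_of_finite fun f : F => f + g).comp measurable_snd)
  refine ⟨hmeas, Measure.ext fun s hs => ?_⟩
  rw [Measure.map_apply hmeas hs, weylMeasure_apply hs, weylMeasure_apply (hmeas hs)]
  congr 1
  rw [← Equiv.sum_comp (Equiv.addRight g) fun f => volume {z | (z, f) ∈ s}]
  refine Finset.sum_congr rfl fun f _ => ?_
  rw [← hmp.measure_preimage (measurableSet_fiber hs _).nullMeasurableSet]
  simp only [Set.mem_preimage, weylT_torusProdEquiv, Set.preimage_ofPred_eq, Equiv.coe_addRight]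

theorem isWeylSystemWith_torusProdEquiv {Q : ℕ} [NeZero Q] [TopologicalSpace (ZMod Q)]
    [MeasurableSpace (ZMod Q)] [MeasurableSingletonClass (ZMod Q)]
    (M : (Matrix (Fin N) (Fin N) ℤ)ˣ) (hM : ((M : Matrix (Fin N) (Fin N) ℤ) - 1) ^ N = 0)
    (b : Fin N → Torus)
    (hb : ∀ k : Fin N → ℤ, Matrix.vecMul k (M : Matrix (Fin N) (Fin N) ℤ) = k →
      Q • latticePair k b = 0 → k = 0) :
    IsWeylSystemWith (b, (1 : ZMod Q)) (torusProdEquiv M (ZMod Q)) M := by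
  have hmp := measurePreserving_affMap M.isUnit b
  have hT := measurePreserving_weylT_torusProdEquiv M b (1 : ZMod Q)
  refine ⟨hM, ?_, fun x => rfl, hT, ⟨fun s hs hinv => ?_⟩⟩
  · exact ((continuous_matAct _).comp continuous_fst).prodMk continuous_snd
  have hfib : ∀ t : Set ((Fin N → Torus) × ZMod Q),
      weylT (b, (1 : ZMod Q)) (torusProdEquiv M (ZMod Q)) ⁻¹' t = t → ∀ n : ℕ,
      (affMap (M : Matrix (Fin N) (Fin N) ℤ) b)^[n] ⁻¹' {z | (z, (n : ZMod Q)) ∈ t} =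
        {z | (z, 0) ∈ t} := by
    intro t ht n
    induction n with
    | zero => simp
    | succ n ih =>
      rw [← ih, Function.iterate_succ', Set.preimage_comp]
      congr 1
      ext z
      simp only [Set.mem_preimage, Set.mem_ofPred_eq, Nat.cast_succ]
      rw [← weylT_torusProdEquiv M b (1 : ZMod Q), ← Set.mem_preimage, ht]
  have hzero : ∀ t : Set ((Fin N → Torus) × ZMod Q), MeasurableSet t →
      weylT (b, (1 : ZMod Q)) (torusProdEquiv M (ZMod Q)) ⁻¹' t = t →
      volume {z | (z, (0 : ZMod Q)) ∈ t} = 0 → weylMeasure N (ZMod Q) t = 0 := by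
    intro t ht htinv h0
    rw [weylMeasure_apply ht, Finset.sum_eq_zero, mul_zero]
    intro f _
    rw [← ZMod.natCast_zmod_val f, ← (hmp.iterate f.val).measure_preimage
      (measurableSet_fiber ht _).nullMeasurableSet, hfib t htinv, h0]
  rw [eventuallyConst_set', ae_eq_empty, ae_eq_univ]
  refine (eventuallyConst_of_preimage_iterate_eq ⟨N, hM⟩ b (NeZero.ne Q) hb
    (measurableSet_fiber hs 0) ?_).imp (hzero s hs hinv) fun h => ?_
  · simpa using hfib s hinv Q
  · exact hzero sᶜ hs.compl (by rw [Set.preimage_compl, hinv]) h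

end Product

section Skew

open Matrix

/-- The nilpotent matrix copying the first `d` coordinates to the last `d` coordinates. -/
def shearNilpotent (d : ℕ) : Matrix (Fin (d + d)) (Fin (d + d)) ℤ :=
  Matrix.of fun j i => Fin.addCases (fun _ => 0) (fun j' => if i = Fin.castAdd d j' then 1 else 0) j

theorem shearNilpotent_castAdd {d : ℕ} (j : Fin d) (i : Fin (d + d)) :
    shearNilpotent d (Fin.castAdd d j) i = 0 := by
  simp [shearNilpotent]

theorem shearNilpotent_natAdd {d : ℕ} (j : Fin d) (i : Fin (d + d)) :
    shearNilpotent d (Fin.natAdd d j) i = if i = Fin.castAdd d j then 1 else 0 := by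
  simp [shearNilpotent, -Fin.natAdd_eq_addNat]

theorem shearNilpotent_mul_self (d : ℕ) : shearNilpotent d * shearNilpotent d = 0 := by
  ext j i
  refine Fin.addCases (fun j => ?_) (fun j => ?_) j
  · simp [mul_apply, shearNilpotent_castAdd]
  · simp [mul_apply, shearNilpotent_castAdd, shearNilpotent_natAdd, -Fin.natAdd_eq_addNat]

/-- The matrix of the shear `(x, y) ↦ (x, y + x)`. -/
def shear (d : ℕ) : (Matrix (Fin (d + d)) (Fin (d + d)) ℤ)ˣ where
  val := 1 + shearNilpotent d
  inv := 1 - shearNilpotent d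
  val_inv := by rw [add_mul, mul_sub, mul_sub, shearNilpotent_mul_self]; simp
  inv_val := by rw [sub_mul, mul_add, mul_add, shearNilpotent_mul_self]; simp

theorem shear_sub_one_pow (d : ℕ) :
    ((shear d : Matrix (Fin (d + d)) (Fin (d + d)) ℤ) - 1) ^ (d + d) = 0 := by
  rcases Nat.eq_zero_or_pos d with rfl | hd
  · exact Matrix.ext fun j => j.elim0
  · refine pow_eq_zero_of_le (show 2 ≤ d + d by omega) ?_
    rw [show (shear d : Matrix (Fin (d + d)) (Fin (d + d)) ℤ) - 1 = shearNilpotent d from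
      add_sub_cancel_left _ _, sq, shearNilpotent_mul_self]

theorem matAct_shear_castAdd {d : ℕ} (z : Fin (d + d) → Torus) (j : Fin d) :
    matAct (shear d : Matrix (Fin (d + d)) (Fin (d + d)) ℤ) z (Fin.castAdd d j) =
      z (Fin.castAdd d j) := by
  simp [matAct_apply, shear, shearNilpotent_castAdd, Matrix.one_apply]

theorem matAct_shear_natAdd {d : ℕ} (z : Fin (d + d) → Torus) (j : Fin d) :
    matAct (shear d : Matrix (Fin (d + d)) (Fin (d + d)) ℤ) z (Fin.natAdd d j) =
      z (Fin.natAdd d j) + z (Fin.castAdd d j) := by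
  simp [matAct_apply, shear, shearNilpotent_natAdd, Matrix.one_apply, add_smul,
    Finset.sum_add_distrib, -Fin.natAdd_eq_addNat]

theorem vecMul_shear_eq_self {d : ℕ} {k : Fin (d + d) → ℤ}
    (hk : k ᵥ* (shear d : Matrix (Fin (d + d)) (Fin (d + d)) ℤ) = k) (j : Fin d) :
    k (Fin.natAdd d j) = 0 := by
  have h : k ᵥ* shearNilpotent d = 0 := by
    change k ᵥ* (1 + shearNilpotent d) = k at hk
    rwa [vecMul_add, vecMul_one, add_eq_left] at hk
  have hj := congrFun h (Fin.castAdd d j)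
  simpa [vecMul, dotProduct, Fin.sum_univ_add, shearNilpotent_castAdd, shearNilpotent_natAdd,
    -Fin.natAdd_eq_addNat] using hj

theorem weylT_shear_pow {d Q : ℕ} (β : Fin d → Torus) (z : Fin (d + d) → Torus) (f : ZMod Q)
    (n : ℕ) :
    ((weylT (Fin.append β 0, (1 : ZMod Q)) (torusProdEquiv (shear d) (ZMod Q)) ^ n) (z, f)).2 =
        f + n ∧
      ∀ i, ((weylT (Fin.append β 0, (1 : ZMod Q)) (torusProdEquiv (shear d) (ZMod Q)) ^ n)
          (z, f)).1 (Fin.castAdd d i) = z (Fin.castAdd d i) + n • β i ∧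
        ((weylT (Fin.append β 0, (1 : ZMod Q)) (torusProdEquiv (shear d) (ZMod Q)) ^ n)
          (z, f)).1 (Fin.natAdd d i) =
          z (Fin.natAdd d i) + n • z (Fin.castAdd d i) + n.choose 2 • β i := by
  induction n with
  | zero => simp
  | succ n ih =>
    rw [pow_succ', Equiv.Perm.mul_apply]
    set x := (weylT (Fin.append β 0, (1 : ZMod Q)) (torusProdEquiv (shear d) (ZMod Q)) ^ n) (z, f)
    obtain ⟨x₁, x₂⟩ := x
    dsimp only at ih
    rw [weylT_torusProdEquiv]
    refine ⟨by simp [ih.1, add_assoc], fun i => ⟨?_, ?_⟩⟩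
    · simp only [affMap, Pi.add_apply, matAct_shear_castAdd, (ih.2 i).1, Fin.append_left,
        succ_nsmul, add_assoc]
    · simp only [affMap, Pi.add_apply, matAct_shear_natAdd, (ih.2 i).1, (ih.2 i).2,
        Fin.append_right, Pi.zero_apply, Nat.choose_succ_succ' n 1, Nat.choose_one_right, add_smul,
        one_smul, Nat.reduceAdd]
      abel

theorem choose_two_mul_two (n : ℕ) : (2 * n).choose 2 = 2 * n.choose 2 + n ^ 2 := by
  induction n with
  | zero => rfl
  | succ n ih =>
    rw [show 2 * (n + 1) = 2 * n + 1 + 1 by ring, Nat.choose_succ_succ' (2 * n + 1) 1,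
      Nat.choose_succ_succ' (2 * n) 1, Nat.choose_succ_succ' n 1, ih]
    simp only [Nat.choose_one_right]
    ring

end Skew

section Bohr

/-- Sets of `{n, 2n}`-measurable recurrence for all Weyl systems. -/
def IsDoubleRecurrent (R : Set ℕ) : Prop :=
  ∀ (N : ℕ) (F : Type) [AddCommGroup F] [Fintype F]
    [TopologicalSpace F] [DiscreteTopology F]
    [MeasurableSpace F] [MeasurableSingletonClass F]
    (a : (Fin N → Torus) × F)
    (U : ((Fin N → Torus) × F) ≃+ ((Fin N → Torus) × F))
    (A : Matrix (Fin N) (Fin N) ℤ), IsWeylSystemWith a U A →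
    ∀ S : Set ((Fin N → Torus) × F), MeasurableSet S → 0 < weylMeasure N F S →
      ∃ n ∈ R, 0 < weylMeasure N F
        (S ∩ (weylT a U ^ n) ⁻¹' S ∩ (weylT a U ^ (2 * n)) ⁻¹' S)

theorem IsDoubleRecurrent.exists_sq_nsmul_norm_lt {R : Set ℕ} (hR : IsDoubleRecurrent R) {d Q : ℕ}
    (hQ : Q ≠ 0) (β : Fin d → Torus)
    (hβ : ∀ k : Fin d → ℤ, Q • ∑ i, k i • β i = 0 → k = 0) {η : ℝ} (hη : 0 < η) :
    ∃ n ∈ R, Q ∣ n ∧ ∀ i, ‖n ^ 2 • β i‖ < η := by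
  have : NeZero Q := ⟨hQ⟩
  let : TopologicalSpace (ZMod Q) := ⊥
  have : DiscreteTopology (ZMod Q) := ⟨rfl⟩
  let : MeasurableSpace (ZMod Q) := ⊤
  have hsys := isWeylSystemWith_torusProdEquiv (Q := Q) (shear d) (shear_sub_one_pow d)
    (Fin.append β 0) (fun k hk h => by
      have hk₂ := vecMul_shear_eq_self hk
      have hk₁ : (fun i => k (Fin.castAdd d i)) = 0 := by
        apply hβ
        simpa [latticePair_apply, Fin.sum_univ_add, hk₂, -Fin.natAdd_eq_addNat] using h
      ext j
      exact Fin.addCases (fun i => congrFun hk₁ i) hk₂ j)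
  set V : Set (Fin (d + d) → Torus) := {z | ∀ i : Fin d, ‖z (Fin.natAdd d i)‖ < η / 4}
  have hV : IsOpen V := by
    simp only [V, Set.ofPred_forall]
    exact isOpen_iInter_of_finite fun i => isOpen_lt (by fun_prop) continuous_const
  have hS : MeasurableSet (V ×ˢ ({0} : Set (ZMod Q))) :=
    hV.measurableSet.prod (measurableSet_singleton _)
  obtain ⟨n, hn, hpos⟩ := hR _ _ _ _ _ hsys (V ×ˢ {0}) hS <| by
    refine (weylMeasure_pos_iff hS).2 ⟨0, ?_⟩
    refine (hV.measure_pos volume ⟨0, by simp [V, hη]⟩).trans_le (measure_mono fun z hz => ?_)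
    exact ⟨hz, rfl⟩
  obtain ⟨⟨z, f⟩, ⟨⟨hz₀, hf₀⟩, hz₁, hf₁⟩, hz₂, -⟩ := nonempty_of_measure_ne_zero hpos.ne'
  obtain rfl : f = 0 := hf₀
  obtain ⟨hsnd, hn₁⟩ := weylT_shear_pow β z (0 : ZMod Q) n
  have hn₂ := (weylT_shear_pow β z (0 : ZMod Q) (2 * n)).2
  refine ⟨n, hn, ?_, fun i => ?_⟩
  · rw [← ZMod.natCast_eq_zero_iff, ← zero_add (n : ZMod Q), ← hsnd]
    exact hf₁
  · have h₀ := hz₀ i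
    have h₁ := hz₁ i
    have h₂ := hz₂ i
    rw [(hn₁ i).2] at h₁
    rw [(hn₂ i).2] at h₂
    simp only at h₀
    set x := z (Fin.castAdd d i)
    set y := z (Fin.natAdd d i)
    have hid : n ^ 2 • β i = (y + (2 * n) • x + (2 * n).choose 2 • β i) -
        ((y + n • x + n.choose 2 • β i) + (y + n • x + n.choose 2 • β i)) + y := by
      rw [choose_two_mul_two, add_smul, two_mul n, two_mul (n.choose 2), add_smul, add_smul]
      abel
    rw [hid]
    refine (norm_add_le _ _).trans_lt ?_
    have e₁ := norm_sub_le (y + (2 * n) • x + (2 * n).choose 2 • β i)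
      ((y + n • x + n.choose 2 • β i) + (y + n • x + n.choose 2 • β i))
    have e₂ := norm_add_le (y + n • x + n.choose 2 • β i) (y + n • x + n.choose 2 • β i)
    linarith

/-- Finitely many reals are integer combinations, up to rationals with bounded denominator, of reals
that are rationally independent modulo one. -/
theorem exists_independent_generators (Γ : Finset ℝ) :
    ∃ (d D : ℕ) (β : Fin d → ℝ), D ≠ 0 ∧
      (∀ (k : Fin d → ℤ) (m : ℤ), ∑ i, k i * β i = m → k = 0) ∧
      ∀ γ ∈ Γ, ∃ (c : Fin d → ℤ) (m : ℤ), γ = m / D + ∑ i, c i * β i := by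
  classical
  obtain ⟨b, hbt, hsb, hspan, hli⟩ := exists_linearIndepOn_id_extension (K := ℚ)
    (s := ({1} : Set ℝ)) (t := ((insert 1 Γ : Finset ℝ) : Set ℝ))
    (LinearIndepOn.singleton (by simp)) (by simp)
  lift b to Finset ℝ using (Finset.finite_toSet _).subset hbt
  have h1b : (1 : ℝ) ∈ b := by simpa using hsb
  have hcoef : ∀ γ : Γ, ∃ q : ℝ → ℚ, ∑ a ∈ b, q a • a = (γ : ℝ) := by
    intro γ
    obtain ⟨q, -, hq⟩ := Submodule.mem_span_finset.1 (hspan (Finset.mem_insert_of_mem γ.2))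
    exact ⟨q, hq⟩
  choose q hq using hcoef
  set D : ℕ := ∏ γ : Γ, ∏ a ∈ b, (q γ a).den with hD
  have hD0 : D ≠ 0 :=
    Finset.prod_ne_zero_iff.2 fun γ _ => Finset.prod_ne_zero_iff.2 fun a _ => (q γ a).den_nz
  have hD0' : (D : ℝ) ≠ 0 := by exact_mod_cast hD0
  have hint : ∀ γ : Γ, ∀ a ∈ b, ∃ c : ℤ, (q γ a : ℝ) = c / D := by
    intro γ a ha
    obtain ⟨r, hr⟩ : (q γ a).den ∣ D :=
      (Finset.dvd_prod_of_mem (fun a => (q γ a).den) ha).trans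
        (Finset.dvd_prod_of_mem (fun γ : Γ => ∏ a ∈ b, (q γ a).den) (Finset.mem_univ γ))
    refine ⟨(q γ a).num * r, ?_⟩
    have hr0 : (r : ℝ) ≠ 0 := by
      rintro h
      rw [Nat.cast_eq_zero] at h
      rw [h, mul_zero] at hr
      exact hD0 hr
    rw [hr, Rat.cast_def]
    push_cast
    rw [mul_div_mul_right _ _ hr0]
  set B := b.erase 1 with hB
  have hsum : ∀ g : ℝ → ℝ, ∑ i, g (B.equivFin.symm i) = ∑ a ∈ B, g a := fun g => by
    rw [← Finset.sum_coe_sort B, Equiv.sum_comp B.equivFin.symm fun a : B => g a]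
  refine ⟨B.card, D, fun i => (B.equivFin.symm i : ℝ) / D, hD0, fun k m hkm => ?_, fun γ hγ => ?_⟩
  · rw [linearIndepOn_finset_iff] at hli
    set k' : ℝ → ℤ := fun a => if h : a ∈ B then k (B.equivFin ⟨a, h⟩) else 0 with hk'
    have hkk' : ∀ i, k i = k' (B.equivFin.symm i) := fun i => by
      simp [hk', (B.equivFin.symm i).2]
    have h := hli (fun a => if a = 1 then -(m * D : ℚ) else k' a) (by
      rw [← Finset.add_sum_erase _ _ h1b, if_pos rfl, ← hB,
        Finset.sum_congr rfl fun a ha => by rw [if_neg (Finset.ne_of_mem_erase ha)]]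
      simp only [hkk'] at hkm
      rw [hsum fun a => k' a * (a / D)] at hkm
      simp only [id, Rat.smul_def, mul_one]
      push_cast
      rw [← hkm, Finset.sum_mul, ← Finset.sum_neg_distrib, ← Finset.sum_add_distrib]
      refine Finset.sum_eq_zero fun a _ => ?_
      field_simp
      ring)
    ext i
    have hi := (B.equivFin.symm i).2
    have := h _ (Finset.mem_of_mem_erase hi)
    rw [if_neg (Finset.ne_of_mem_erase hi), ← hkk'] at this
    exact_mod_cast this
  · choose! c hc using hint ⟨γ, hγ⟩
    refine ⟨fun i => c (B.equivFin.symm i), c 1, ?_⟩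
    rw [hsum fun a => c a * (a / D), ← hc 1 h1b]
    have hγq := hq ⟨γ, hγ⟩
    rw [← Finset.add_sum_erase _ _ h1b] at hγq
    refine hγq.symm.trans ?_
    congr 1
    · simp [Rat.smul_def]
    · refine Finset.sum_congr rfl fun a ha => ?_
      rw [Rat.smul_def, hc a (Finset.mem_of_mem_erase ha)]
      ring

/-- The squares of a set of double recurrence return to every Bohr neighbourhood of zero. -/
theorem IsDoubleRecurrent.exists_sq_nsmul_coe_norm_lt {R : Set ℕ} (hR : IsDoubleRecurrent R)
    (Γ : Finset ℝ) {Q : ℕ} (hQ : Q ≠ 0) {ε : ℝ} (hε : 0 < ε) :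
    ∃ n ∈ R, Q ∣ n ∧ ∀ γ ∈ Γ, ‖n ^ 2 • (γ : Torus)‖ < ε := by
  obtain ⟨d, D, β, hD, hβ, hΓ⟩ := exists_independent_generators Γ
  choose! c m hcm using hΓ
  set C : ℝ := ∑ γ ∈ Γ, ∑ i, |(c γ i : ℝ)| with hC
  have hC0 : 0 ≤ C := by positivity
  obtain ⟨n, hn, hdvd, hlt⟩ := hR.exists_sq_nsmul_norm_lt (mul_ne_zero hQ hD)
    (fun i => (β i : Torus)) (fun k hk => by
      have hk' : (((Q * D : ℕ) : ℝ) * ∑ i, k i * β i : ℝ) = (0 : Torus) := by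
        rw [← hk, ← nsmul_eq_mul, AddCircle.coe_nsmul]
        congr 1
        rw [← QuotientAddGroup.mk'_apply, map_sum]
        refine Finset.sum_congr rfl fun i _ => ?_
        rw [← zsmul_eq_mul, map_zsmul]
        rfl
      obtain ⟨m, hm⟩ := (AddCircle.coe_eq_zero_iff (1 : ℝ)).1 hk'
      have := hβ (fun i => (Q * D : ℕ) * k i) m (by
        rw [zsmul_eq_mul, mul_one] at hm
        rw [hm, Finset.mul_sum]
        refine Finset.sum_congr rfl fun i _ => ?_
        push_cast
        ring)
      ext i
      have hi := congrFun this i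
      simpa [hQ, hD] using hi)
    (show 0 < ε / (C + 1) by positivity)
  refine ⟨n, hn, (dvd_mul_right Q D).trans hdvd, fun γ hγ => ?_⟩
  obtain ⟨r, hr⟩ := (dvd_mul_left D Q).trans hdvd
  have hid : n ^ 2 • (γ : Torus) = ∑ i, c γ i • (n ^ 2 • (β i : Torus)) := by
    have h₁ : (n ^ 2 : ℕ) • γ = ((n * r * m γ : ℤ) : ℝ) + ∑ i, c γ i • ((n ^ 2 : ℕ) • β i) := by
      have hD' : (D : ℝ) ≠ 0 := by exact_mod_cast hD
      conv_lhs => rw [hcm γ hγ]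
      rw [smul_add, Finset.smul_sum]
      congr 1
      · rw [hr]
        simp only [nsmul_eq_mul]
        push_cast
        field_simp
      · refine Finset.sum_congr rfl fun i _ => ?_
        simp only [nsmul_eq_mul, zsmul_eq_mul]
        ring
    have h₂ : (((n * r * m γ : ℤ) : ℝ) : Torus) = 0 :=
      (AddCircle.coe_eq_zero_iff (1 : ℝ)).2 ⟨_, by rw [zsmul_eq_mul, mul_one]⟩
    rw [← AddCircle.coe_nsmul, h₁, AddCircle.coe_add, h₂, zero_add,
      ← QuotientAddGroup.mk'_apply, map_sum]
    rfl
  rw [hid]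
  calc ‖∑ i, c γ i • (n ^ 2 • (β i : Torus))‖
      ≤ ∑ i, |(c γ i : ℝ)| * (ε / (C + 1)) := by
        refine norm_sum_le_of_le _ fun i _ => ?_
        refine (norm_zsmul_le _ _).trans ?_
        rw [Int.norm_eq_abs]
        exact mul_le_mul_of_nonneg_left (hlt i).le (abs_nonneg _)
    _ = (∑ i, |(c γ i : ℝ)|) * (ε / (C + 1)) := by rw [Finset.sum_mul]
    _ ≤ C * (ε / (C + 1)) := by
        gcongr
        exact Finset.single_le_sum (f := fun γ => ∑ i, |(c γ i : ℝ)|)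
          (fun γ _ => by positivity) hγ
    _ < ε := by
        rw [mul_div_assoc', div_lt_iff₀ (by positivity)]
        nlinarith

end Bohr

section Weyl

variable {N : ℕ} {F : Type} [AddCommGroup F]

theorem weylT_pow_add {a : (Fin N → Torus) × F}
    {U : ((Fin N → Torus) × F) ≃+ ((Fin N → Torus) × F)} {A : Matrix (Fin N) (Fin N) ℤ}
    (hU : ∀ x : Fin N → Torus, U (x, (0 : F)) = (fun j => ∑ i, A j i • x i, (0 : F)))
    (m : ℕ) (x : (Fin N → Torus) × F) (w : Fin N → Torus) :
    (weylT a U ^ m) (x + (w, 0)) = (weylT a U ^ m) x + (matAct (A ^ m) w, 0) := by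
  induction m with
  | zero => simp [matAct_one]
  | succ m ih =>
    rw [pow_succ', Equiv.Perm.mul_apply, Equiv.Perm.mul_apply, ih, pow_succ' A, matAct_mul]
    change a + U (_ + _) = (a + U _) + _
    rw [map_add, add_assoc, hU]
    rfl

/-- A power of a Weyl transformation maps a given fiber over the finite factor to itself by a
unipotent affine map. -/
theorem exists_weylT_pow_mul_eq [Finite F] {a : (Fin N → Torus) × F}
    {U : ((Fin N → Torus) × F) ≃+ ((Fin N → Torus) × F)} {A : Matrix (Fin N) (Fin N) ℤ}
    (hU : ∀ x : Fin N → Torus, U (x, (0 : F)) = (fun j => ∑ i, A j i • x i, (0 : F))) (f : F) :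
    ∃ (q : ℕ) (b : Fin N → Torus), q ≠ 0 ∧ ∀ (j : ℕ) (z : Fin N → Torus),
      (weylT a U ^ (q * j)) (z, f) = ((affMap (A ^ q) b)^[j] z, f) := by
  have hsplit : ∀ (m : ℕ) (z : Fin N → Torus) (f : F),
      (weylT a U ^ m) (z, f) = (weylT a U ^ m) (0, f) + (matAct (A ^ m) z, 0) := by
    intro m z f
    rw [← weylT_pow_add hU]
    simp
  have hsurj : Function.Surjective fun f : F => (weylT a U (0, f)).2 := by
    intro f'
    obtain ⟨⟨z, f⟩, hzf⟩ := (weylT a U).surjective (0, f')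
    refine ⟨f, ?_⟩
    have := congrArg Prod.snd (hsplit 1 z f)
    rw [pow_one, hzf] at this
    simpa using this.symm
  set σ : Equiv.Perm F := Equiv.ofBijective _ ⟨Finite.injective_iff_surjective.2 hsurj, hsurj⟩
  have hsnd : ∀ (m : ℕ) (f : F), ((weylT a U ^ m) (0, f)).2 = (σ ^ m) f := by
    intro m f
    induction m with
    | zero => simp
    | succ m ih =>
      rw [pow_succ', pow_succ', Equiv.Perm.mul_apply, Equiv.Perm.mul_apply, ← ih]
      set x := (weylT a U ^ m) (0, f)
      have := congrArg Prod.snd (hsplit 1 x.1 x.2)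
      change _ = (weylT a U (0, x.2)).2
      simpa using this
  have hfix : ((weylT a U ^ orderOf σ) (0, f)).2 = f := by
    rw [hsnd, pow_orderOf_eq_one, Equiv.Perm.one_apply]
  refine ⟨orderOf σ, ((weylT a U ^ orderOf σ) (0, f)).1, (orderOf_pos σ).ne', fun j => ?_⟩
  induction j with
  | zero => simp
  | succ j ih =>
    intro z
    rw [mul_add, mul_one, pow_add, Equiv.Perm.mul_apply, hsplit (orderOf σ), Function.iterate_succ,
      Function.comp_apply, ← ih]
    congr 1
    refine Prod.ext ?_ ?_
    · simp [affMap, add_comm]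
    · simp [hfix]

end Weyl

theorem exists_forall_toCircle_re_nonneg :
    ∃ ε > 0, ∀ t : Torus, ‖t‖ < ε → 0 ≤ (AddCircle.toCircle t : ℂ).re := by
  have hcont : Continuous fun t : Torus => (AddCircle.toCircle t : ℂ).re :=
    Complex.continuous_re.comp (continuous_subtype_val.comp AddCircle.continuous_toCircle)
  have hev := (hcont.tendsto 0).eventually (lt_mem_nhds (a := 0) (by simp))
  obtain ⟨ε, hε, h⟩ := Metric.eventually_nhds_iff.1 hev
  exact ⟨ε, hε, fun t ht => (h (by simpa using ht)).le⟩

end WeylRecurrence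

/-- Every set of `{n, 2n}`-measurable recurrence for every Weyl system is a set of
`{n²}`-measurable recurrence for every Weyl system. -/
theorem stmt19 (R : Set ℕ)
    (hrec : ∀ (N : ℕ) (F : Type) [AddCommGroup F] [Fintype F]
      [TopologicalSpace F] [DiscreteTopology F]
      [MeasurableSpace F] [MeasurableSingletonClass F]
      (a : (Fin N → Torus) × F)
      (U : ((Fin N → Torus) × F) ≃+ ((Fin N → Torus) × F))
      (A : Matrix (Fin N) (Fin N) ℤ), IsWeylSystemWith a U A →
      ∀ S : Set ((Fin N → Torus) × F), MeasurableSet S → 0 < weylMeasure N F S →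
        ∃ n ∈ R, 0 < weylMeasure N F
          (S ∩ (weylT a U ^ n) ⁻¹' S ∩ (weylT a U ^ (2 * n)) ⁻¹' S)) :
    ∀ (N : ℕ) (F : Type) [AddCommGroup F] [Fintype F]
      [TopologicalSpace F] [DiscreteTopology F]
      [MeasurableSpace F] [MeasurableSingletonClass F]
      (a : (Fin N → Torus) × F)
      (U : ((Fin N → Torus) × F) ≃+ ((Fin N → Torus) × F))
      (A : Matrix (Fin N) (Fin N) ℤ), IsWeylSystemWith a U A →
      ∀ S : Set ((Fin N → Torus) × F), MeasurableSet S → 0 < weylMeasure N F S →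
        ∃ n ∈ R, 0 < weylMeasure N F (S ∩ (weylT a U ^ (n ^ 2)) ⁻¹' S) := by
  intro N F _ _ _ _ _ _ a U A hsys S hS hpos
  have hR : WeylRecurrence.IsDoubleRecurrent R := hrec
  obtain ⟨hA, -, hU, hErg⟩ := hsys
  obtain ⟨f, hf⟩ := (WeylRecurrence.weylMeasure_pos_iff hS).1 hpos
  obtain ⟨q, b, hq, hpow⟩ := WeylRecurrence.exists_weylT_pow_mul_eq (a := a) hU f
  obtain ⟨K, J, hKJ⟩ := WeylRecurrence.exists_forall_volume_inter_pos
    (WeylRecurrence.isNilpotent_pow_sub_one ⟨N, hA⟩ q) b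
    (WeylRecurrence.measurableSet_fiber hS f) hf
  choose θ hθ using fun k : Fin N → ℤ =>
    QuotientAddGroup.mk_surjective (WeylRecurrence.latticePair k b)
  obtain ⟨ε, hε, hεre⟩ := WeylRecurrence.exists_forall_toCircle_re_nonneg
  obtain ⟨n, hn, ⟨r, hr⟩, hlt⟩ := hR.exists_sq_nsmul_coe_norm_lt
    (K.image fun k => θ k / q) (mul_ne_zero hq J.succ_ne_zero) hε
  refine ⟨n, hn, ?_⟩
  rcases Nat.eq_zero_or_pos n with rfl | hn₀
  · simpa using hpos
  have hmeas : MeasurableSet (S ∩ (weylT a U ^ (n ^ 2)) ⁻¹' S) := by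
    rw [← Equiv.Perm.iterate_eq_pow]
    exact hS.inter ((hErg.measurable.iterate _) hS)
  have hr₀ : 0 < r := Nat.pos_of_ne_zero fun h => by simp [h] at hr; omega
  set j := (J + 1) * r * n with hj
  have hnj : n ^ 2 = q * j := by
    rw [hj, sq]
    nth_rewrite 1 [hr]
    rw [Nat.succ_eq_add_one]
    ring
  have hjJ : J ≤ j := by
    rw [hj, mul_assoc]
    exact J.le_succ.trans (Nat.le_mul_of_pos_right _ (Nat.mul_pos hr₀ hn₀))
  refine (WeylRecurrence.weylMeasure_pos_iff hmeas).2 ⟨f, ?_⟩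
  refine (hKJ j hjJ fun k hk => hεre _ ?_).trans_le (measure_mono fun z hz => ?_)
  · have h := hlt _ (Finset.mem_image_of_mem _ hk)
    have hq' : (q : ℝ) ≠ 0 := by exact_mod_cast hq
    rwa [hnj, mul_nsmul, ← AddCircle.coe_nsmul (n := q), nsmul_eq_mul, mul_div_cancel₀ _ hq',
      show ((θ k : ℝ) : Torus) = _ from hθ k] at h
  · refine ⟨hz.1, ?_⟩
    change (weylT a U ^ (n ^ 2)) (z, f) ∈ S
    rw [hnj, hpow]
    exact hz.2

end
end
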